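/- Let Ω be a bounded, connected open set in ℂ^N (N ≥ 1), let x₀ be a point of Ω, and let ε > 0. Then there exists a polynomially convex arc J in ℂ^N such that x₀ ∈ J ⊆ Ω, m(Ω \ J) < ε, P(J) = C(J), and the set of polynomials in z₁,…,z_N that are zero-free on J is dense in P(cl Ω); i.e., for every polynomial p and every δ > 0 there is a polynomial q with no zero on J such that sup_{z ∈ cl Ω} |p(z) − q(z)| < δ. -/

import Mathlib

open Set MvPolynomial Topology MeasureTheory

noncomputable section

/-- The polynomial hull of a set `X ⊆ ℂ^N`: points where every polynomial in the
coordinates is dominated by its supremum over `X`. -/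
def polyHull {N : ℕ} (X : Set (Fin N → ℂ)) : Set (Fin N → ℂ) :=
  {z | ∀ p : MvPolynomial (Fin N) ℂ, ‖eval z p‖ ≤ ⨆ x ∈ X, ‖eval x p‖}

/-- A set is polynomially convex if it equals its polynomial hull. -/
def IsPolynomiallyConvex {N : ℕ} (X : Set (Fin N → ℂ)) : Prop :=
  polyHull X = X

/-- `J` is an arc from `a` to `b`: the image of an injective continuous map on `[0,1]`
(equivalently, in a Hausdorff space, a subset homeomorphic to `[0,1]`). -/
def IsArcFrom {α : Type*} [TopologicalSpace α] (J : Set α) (a b : α) : Prop :=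
  ∃ γ : ℝ → α, ContinuousOn γ (Icc 0 1) ∧ InjOn γ (Icc 0 1) ∧
    γ '' Icc 0 1 = J ∧ γ 0 = a ∧ γ 1 = b

/-- `J` is an arc: a subset homeomorphic to the closed unit interval. -/
def IsArc {α : Type*} [TopologicalSpace α] (J : Set α) : Prop :=
  ∃ a b, IsArcFrom J a b

/-- `J` is a simple closed curve: a subset homeomorphic to the unit circle. -/
def IsSimpleClosedCurve {α : Type*} [TopologicalSpace α] (J : Set α) : Prop :=
  ∃ γ : Circle → α, Continuous γ ∧ Function.Injective γ ∧ Set.range γ = J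

/-- A `C^∞`-smooth open arc: the image of an injective `C^∞` map on an open interval,
with nowhere vanishing derivative, that is a homeomorphism onto its image. -/
def IsSmoothOpenArc {E : Type*} [NormedAddCommGroup E] [NormedSpace ℝ E]
    (A : Set E) : Prop :=
  ∃ (a b : ℝ) (γ : ℝ → E), a < b ∧ ContDiffOn ℝ (⊤ : ℕ∞) γ (Ioo a b) ∧
    (∀ t ∈ Ioo a b, derivWithin γ (Ioo a b) t ≠ 0) ∧
    InjOn γ (Ioo a b) ∧
    IsEmbedding ((Ioo a b).restrict γ) ∧
    γ '' Ioo a b = A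

/-- `P(X) = C(X)`: every continuous function on `X` is a uniform limit of polynomials. -/
def PolyEqContinuous {N : ℕ} (X : Set (Fin N → ℂ)) : Prop :=
  ∀ f : (Fin N → ℂ) → ℂ, ContinuousOn f X → ∀ δ : ℝ, 0 < δ →
    ∃ p : MvPolynomial (Fin N) ℂ, ∀ x ∈ X, ‖f x - eval x p‖ < δ

/-- `L` is a complex affine line in `ℂ^N`. -/
def IsComplexAffineLine {N : ℕ} (L : Set (Fin N → ℂ)) : Prop :=
  ∃ (z₀ v : Fin N → ℂ), v ≠ 0 ∧ L = {z | ∃ t : ℂ, z = z₀ + t • v}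

section parta

/-- Conjugates of coordinates are approximable by polynomials. -/
def CP {N : ℕ} (X : Set (Fin N → ℂ)) : Prop :=
  ∀ i : Fin N, ∀ δ : ℝ, 0 < δ → ∃ p : MvPolynomial (Fin N) ℂ,
    ∀ z ∈ X, ‖eval z p - (starRingEnd ℂ) (z i)‖ < δ

theorem CP.mono {N : ℕ} {X Y : Set (Fin N → ℂ)} (h : CP Y) (hXY : X ⊆ Y) : CP X := by
  intro i δ hδ
  obtain ⟨p, hp⟩ := h i δ hδ
  exact ⟨p, fun z hz => hp z (hXY hz)⟩

theorem continuous_eval_mv {N : ℕ} (p : MvPolynomial (Fin N) ℂ) :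
    Continuous fun z : Fin N → ℂ => eval z p := by
  exact MvPolynomial.continuous_eval p

theorem PolyEqContinuous.cp {N : ℕ} {X : Set (Fin N → ℂ)} (h : PolyEqContinuous X) : CP X := by
  intro i δ hδ
  obtain ⟨p, hp⟩ := h (fun z => (starRingEnd ℂ) (z i)) (by fun_prop) δ hδ
  exact ⟨p, fun z hz => by rw [norm_sub_rev]; exact hp z hz⟩

/-- Abstract Stone-Weierstrass: an algebra generated by finitely many functions. -/
theorem CP.polyEq {N : ℕ} {X : Set (Fin N → ℂ)} (hX : IsCompact X) (h : CP X) :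
    PolyEqContinuous X := by
  have : CompactSpace X := isCompact_iff_compactSpace.mp hX
  let co : Fin N → C(X, ℂ) := fun i => ⟨fun x => x.1 i, (continuous_apply i).comp continuous_subtype_val⟩
  let φ : MvPolynomial (Fin N) ℂ →ₐ[ℂ] C(X, ℂ) := aeval co
  have hφ : ∀ p (x : X), φ p x = eval x.1 p := by
    intro p x
    induction p using MvPolynomial.induction_on with
    | C a => simp [φ]
    | add p q hp hq => simp [hp, hq]
    | mul_X p i hp => simp only [map_mul, ContinuousMap.mul_apply, hp, eval_X]; simp [φ, co]
  let A := φ.range.topologicalClosure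
  have hA : ∀ p, φ p ∈ A := fun p => φ.range.le_topologicalClosure ⟨p, rfl⟩
  have hstar : ∀ p, star (φ p) ∈ A := by
    intro p
    induction p using MvPolynomial.induction_on with
    | C a =>
      have : star (φ (C a)) = φ (C (star a)) := by
        ext x; simp [hφ]
      rw [this]; exact hA _
    | add p q hp hq => rw [map_add, star_add]; exact add_mem hp hq
    | mul_X p i hp =>
      rw [map_mul, star_mul']
      refine mul_mem hp ?_
      change _ ∈ closure (φ.range : Set C(X, ℂ))
      rw [Metric.mem_closure_iff]
      intro ε hε
      obtain ⟨q, hq⟩ := h i (ε/2) (by positivity)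
      refine ⟨φ q, ⟨q, rfl⟩, ?_⟩
      refine lt_of_le_of_lt ((ContinuousMap.dist_le (C := ε/2) (by positivity)).2 ?_) (by linarith)
      intro x
      rw [dist_comm, dist_eq_norm, hφ]
      have := (hq x.1 x.2).le
      simpa [φ, co] using this
  let B : StarSubalgebra ℂ C(X, ℂ) :=
    { A with
      star_mem' := by
        intro a ha
        have ha' : a ∈ closure (φ.range : Set C(X, ℂ)) := ha
        have hcl : IsClosed {a : C(X, ℂ) | star a ∈ A} :=
          (φ.range.isClosed_topologicalClosure).preimage continuous_star
        exact closure_minimal (t := {a : C(X, ℂ) | star a ∈ A})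
          (by rintro _ ⟨p, rfl⟩; exact hstar p) hcl ha' }
  have hB : B.topologicalClosure = ⊤ := by
    apply ContinuousMap.starSubalgebra_topologicalClosure_eq_top_of_separatesPoints
    intro x y hxy
    have : ∃ i, x.1 i ≠ y.1 i := by
      by_contra hcon; push Not at hcon
      exact hxy (Subtype.ext (funext hcon))
    obtain ⟨i, hi⟩ := this
    refine ⟨φ (MvPolynomial.X i), ⟨φ (MvPolynomial.X i), hA _, rfl⟩, ?_⟩
    simpa [hφ] using hi
  intro f hf δ hδ
  let F : C(X, ℂ) := ⟨fun x => f x.1, continuousOn_iff_continuous_restrict.1 hf⟩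
  have hF : F ∈ closure (A : Set C(X, ℂ)) := by
    have : F ∈ B.topologicalClosure := by rw [hB]; trivial
    exact this
  have hF2 : F ∈ closure (φ.range : Set C(X, ℂ)) := by
    rw [IsClosed.closure_eq (φ.range.isClosed_topologicalClosure)] at hF
    exact hF
  obtain ⟨_, ⟨p, rfl⟩, hp⟩ := Metric.mem_closure_iff.1 hF2 δ hδ
  refine ⟨p, fun x hx => ?_⟩
  have := (ContinuousMap.dist_lt_iff hδ).1 hp ⟨x, hx⟩
  rw [dist_eq_norm] at this
  have e : (φ.toRingHom p) ⟨x, hx⟩ = eval x p := hφ p ⟨x, hx⟩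
  rw [← e]; exact this

theorem PolyEqContinuous.isPolynomiallyConvex {N : ℕ} {J : Set (Fin N → ℂ)} (hJ : IsCompact J)
    (h : PolyEqContinuous J) : IsPolynomiallyConvex J := by
  have hbdd : ∀ p : MvPolynomial (Fin N) ℂ, ∃ M, 0 ≤ M ∧ ∀ x ∈ J, ‖eval x p‖ ≤ M := by
    intro p
    obtain ⟨M, hM⟩ := hJ.exists_bound_of_continuousOn (MvPolynomial.continuous_eval p).continuousOn
    exact ⟨max M 0, le_max_right _ _, fun x hx => (hM x hx).trans (le_max_left _ _)⟩
  apply Subset.antisymm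
  · intro z hz
    by_contra hzJ
    -- squared distance
    let s : (Fin N → ℂ) → ℝ := fun x => ∑ j, ‖x j - z j‖ ^ 2
    have hs : Continuous s := by fun_prop
    have hspos : ∀ x ∈ J, 0 < s x := by
      intro x hx
      have hne : x ≠ z := fun e => hzJ (e ▸ hx)
      obtain ⟨i, hi⟩ := Function.ne_iff.1 hne
      refine Finset.sum_pos' (fun j _ => by positivity) ⟨i, Finset.mem_univ _, ?_⟩
      have := norm_pos_iff.2 (sub_ne_zero.2 hi)
      positivity
    let g : Fin N → (Fin N → ℂ) → ℂ := fun i x => (starRingEnd ℂ) (x i - z i) / (s x : ℂ)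
    have hg : ∀ i, ContinuousOn (g i) J := by
      intro i
      refine ContinuousOn.div (by fun_prop) (by fun_prop) ?_
      intro x hx
      exact_mod_cast (hspos x hx).ne'
    obtain ⟨R, hR⟩ := hJ.isBounded.exists_norm_le
    have hR0 : ∀ x ∈ J, ∀ i, ‖x i - z i‖ ≤ |R| + ‖z‖ := by
      intro x hx i
      calc ‖x i - z i‖ ≤ ‖x i‖ + ‖z i‖ := norm_sub_le _ _
        _ ≤ |R| + ‖z‖ := add_le_add
            ((norm_le_pi_norm x i).trans ((hR x hx).trans (le_abs_self _))) (norm_le_pi_norm z i)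
    set M := |R| + ‖z‖ with hM
    have hM0 : 0 ≤ M := by positivity
    let δ : ℝ := 1 / (2 * (N + 1) * (M + 1))
    have hδ : 0 < δ := by positivity
    choose p hp using fun i => h (g i) (hg i) δ hδ
    let q : MvPolynomial (Fin N) ℂ := 1 - ∑ i, (MvPolynomial.X i - C (z i)) * p i
    have hq : ∀ x, eval x q = 1 - ∑ i, (x i - z i) * eval x (p i) := by
      intro x; simp [q, map_sum]
    have hqz : eval z q = 1 := by rw [hq]; simp
    have hqJ : ∀ x ∈ J, ‖eval x q‖ ≤ 1/2 := by
      intro x hx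
      have e1 : ∑ i, (x i - z i) * g i x = 1 := by
        have : ∀ i, (x i - z i) * g i x = ((‖x i - z i‖ ^ 2 : ℝ) : ℂ) / (s x : ℂ) := by
          intro i
          simp only [g]
          rw [← mul_div_assoc, Complex.mul_conj, Complex.normSq_eq_norm_sq]
        rw [Finset.sum_congr rfl (fun i _ => this i), ← Finset.sum_div, ← Complex.ofReal_sum]
        apply div_self
        exact_mod_cast (hspos x hx).ne'
      have e2 : eval x q = ∑ i, (x i - z i) * (g i x - eval x (p i)) := by
        rw [hq, ← e1, ← Finset.sum_sub_distrib]
        exact Finset.sum_congr rfl fun i _ => by ring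
      rw [e2]
      calc ‖∑ i, (x i - z i) * (g i x - eval x (p i))‖
          ≤ ∑ i : Fin N, ‖(x i - z i) * (g i x - eval x (p i))‖ := norm_sum_le _ _
        _ ≤ ∑ i : Fin N, M * δ := by
            refine Finset.sum_le_sum fun i _ => ?_
            rw [norm_mul]
            exact mul_le_mul (hR0 x hx i) (hp i x hx).le (norm_nonneg _) hM0
        _ = N * (M * δ) := by simp
        _ ≤ 1/2 := by
            simp only [δ]
            rw [mul_one_div, mul_div_assoc', div_le_div_iff₀ (by positivity) (by positivity)]
            nlinarith [(Nat.cast_nonneg N : (0:ℝ) ≤ N)]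
    have hh := hz q
    rw [hqz] at hh
    have h1 : ⨆ x ∈ J, ‖eval x q‖ ≤ 1/2 := by
      refine Real.iSup_le (fun x => Real.iSup_le (fun hx => hqJ x hx) (by norm_num)) (by norm_num)
    norm_num at hh
    linarith
  · intro z hz p
    obtain ⟨M, hM0, hM⟩ := hbdd p
    have hb : BddAbove (range fun x => ⨆ (_ : x ∈ J), ‖eval x p‖) := by
      refine ⟨M, ?_⟩
      rintro _ ⟨x, rfl⟩
      exact Real.iSup_le (fun hx => hM x hx) hM0
    refine le_trans ?_ (le_ciSup hb z)
    exact le_ciSup (f := fun _ : z ∈ J => ‖eval z p‖) ⟨M, by rintro _ ⟨hx, rfl⟩; exact hM _ hx⟩ hz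


end parta

section partb

/-- `∂f/∂z̄`. -/
def dbar (f : ℂ → ℂ) (x : ℂ) : ℂ :=
  (1/2) * (fderiv ℝ f x 1 + Complex.I * fderiv ℝ f x Complex.I)

theorem continuous_dbar {f : ℂ → ℂ} (hf : ContDiff ℝ 1 f) : Continuous (dbar f) := by
  have := hf.continuous_fderiv one_ne_zero
  unfold dbar
  fun_prop

theorem hasCompactSupport_dbar {f : ℂ → ℂ} (hf : HasCompactSupport f) :
    HasCompactSupport (dbar f) := by
  have h := hf.fderiv (𝕜 := ℝ)
  refine HasCompactSupport.intro h.isCompact (fun x hx => ?_)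
  have : fderiv ℝ f x = 0 := by
    by_contra hc
    exact hx (subset_tsupport _ hc)
  simp [dbar, this]

theorem pompeiu {f : ℂ → ℂ} (hf : ContDiff ℝ 1 f) (hc : HasCompactSupport f) (z : ℂ) :
    ∫ w, dbar f (z + w) / w = - Real.pi * f z := by
  rw [← Complex.integral_comp_polarCoord_symm]
  have hD : Continuous (fderiv ℝ f) := hf.continuous_fderiv one_ne_zero
  have hdiff : Differentiable ℝ f := hf.differentiable one_ne_zero
  -- support bound
  obtain ⟨R0, hR0⟩ := hc.isCompact.isBounded.exists_norm_le
  set R : ℝ := |R0| + ‖z‖ + 1 with hR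
  have hRpos : 0 < R := by positivity
  let E : ℝ → ℂ := fun θ => Complex.exp (θ * Complex.I)
  have hE : Continuous E := by fun_prop
  have hEn : ∀ θ, ‖E θ‖ = 1 := fun θ => Complex.norm_exp_ofReal_mul_I θ
  have hout : ∀ r θ : ℝ, R ≤ r → z + r * E θ ∉ tsupport f := by
    intro r θ hr hmem
    have h1 := hR0 _ hmem
    have h2 : ‖(r:ℂ) * E θ‖ = r := by
      rw [norm_mul, hEn, mul_one, Complex.norm_real, Real.norm_of_nonneg (hRpos.le.trans hr)]
    have h3 : ‖(r:ℂ) * E θ‖ ≤ ‖z + r * E θ‖ + ‖z‖ := by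
      calc _ = ‖(z + r * E θ) - z‖ := by congr 1; ring
        _ ≤ _ := norm_sub_le _ _
    have := le_abs_self R0
    linarith
  have hfder0 : ∀ r θ : ℝ, R ≤ r → fderiv ℝ f (z + r * E θ) = 0 := by
    intro r θ hr
    by_contra hcon
    exact hout r θ hr (support_fderiv_subset ℝ hcon)
  have hf0 : ∀ r θ : ℝ, R ≤ r → f (z + r * E θ) = 0 := by
    intro r θ hr
    by_contra hcon
    exact hout r θ hr (subset_tsupport _ hcon)
  let A : ℝ × ℝ → ℂ := fun p => fderiv ℝ f (z + p.1 * E p.2) (E p.2)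
  let B : ℝ × ℝ → ℂ := fun p => fderiv ℝ f (z + p.1 * E p.2) (Complex.I * E p.2)
  have hAc : Continuous A := by
    refine Continuous.clm_apply ?_ ?_
    · exact hD.comp (by fun_prop)
    · fun_prop
  have hBc : Continuous B := by
    refine Continuous.clm_apply ?_ ?_
    · exact hD.comp (by fun_prop)
    · fun_prop
  have hFint : ∀ F : ℝ × ℝ → ℂ, Continuous F → (∀ p : ℝ × ℝ, R ≤ p.1 → F p = 0) →
      IntegrableOn F (Ioi (0:ℝ) ×ˢ Ioo (-Real.pi) Real.pi) := by
    intro F hF hF0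
    have h1 : IntegrableOn F (Icc (0:ℝ) R ×ˢ Icc (-Real.pi) Real.pi) :=
      hF.continuousOn.integrableOn_compact (isCompact_Icc.prod isCompact_Icc)
    have h2 := integrableOn_zero (ε' := ℂ) (s := (Ioi R ×ˢ Ioo (-Real.pi) Real.pi)) (μ := (volume : Measure (ℝ × ℝ)))
    have h3 : IntegrableOn F (Ioi R ×ˢ Ioo (-Real.pi) Real.pi) := by
      refine h2.congr_fun (fun p hp => ?_) (measurableSet_Ioi.prod measurableSet_Ioo)
      exact (hF0 p (le_of_lt hp.1)).symm
    refine (h1.union h3).mono_set ?_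
    rintro ⟨r, θ⟩ ⟨h4, h5⟩
    by_cases h6 : r ≤ R
    · exact Or.inl ⟨⟨le_of_lt h4, h6⟩, Ioo_subset_Icc_self h5⟩
    · exact Or.inr ⟨not_le.1 h6, h5⟩
  have hAi := hFint A hAc (fun p hp => by simp [A, hfder0 _ _ hp])
  have hBi := hFint B hBc (fun p hp => by simp [B, hfder0 _ _ hp])
  have htarget : polarCoord.target = Ioi (0:ℝ) ×ˢ Ioo (-Real.pi) Real.pi := rfl
  have hms : MeasurableSet (Ioi (0:ℝ) ×ˢ Ioo (-Real.pi) Real.pi) :=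
    measurableSet_Ioi.prod measurableSet_Ioo
  have hcongr : ∫ p in polarCoord.target, p.1 • (dbar f (z + Complex.polarCoord.symm p) /
      Complex.polarCoord.symm p) =
      ∫ p in Ioi (0:ℝ) ×ˢ Ioo (-Real.pi) Real.pi, ((1/2) * A p + (Complex.I/2) * B p) := by
    rw [htarget]
    refine setIntegral_congr_fun hms ?_
    rintro ⟨r, θ⟩ ⟨hr, -⟩
    have hr : 0 < r := hr
    have e1 : Complex.polarCoord.symm (r, θ) = r * E θ := by
      rw [Complex.polarCoord_symm_apply]
      simp only [E, Complex.exp_mul_I]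
      push_cast; ring
    simp only [e1, A, B]
    have e2 : E θ = (Real.cos θ) • (1:ℂ) + (Real.sin θ) • Complex.I := by
      simp only [E, Complex.exp_mul_I, Complex.real_smul]; push_cast; ring
    have e3 : Complex.I * E θ = (Real.cos θ) • Complex.I + (-Real.sin θ) • (1:ℂ) := by
      rw [e2]; simp only [Complex.real_smul]; push_cast
      linear_combination (Complex.sin (θ:ℂ)) * Complex.I_sq
    have hE0 : E θ ≠ 0 := Complex.exp_ne_zero _
    have hrc : (r:ℂ) ≠ 0 := by exact_mod_cast hr.ne'
    rw [e3]
    generalize hd : fderiv ℝ f (z + r * E θ) = d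
    rw [show d (E θ) = (Real.cos θ) • d 1 + (Real.sin θ) • d Complex.I by
      rw [e2, map_add, map_smul, map_smul], map_add, map_smul, map_smul]
    simp only [dbar, hd, Complex.real_smul]
    rw [mul_div_assoc', div_eq_iff (mul_ne_zero hrc hE0), e2]
    simp only [Complex.real_smul]
    push_cast
    have hcs : (Real.cos θ : ℂ)^2 + (Real.sin θ : ℂ)^2 = 1 := by
      push_cast; exact Complex.cos_sq_add_sin_sq (θ:ℂ)
    push_cast at hcs
    have hI := Complex.I_sq
    generalize Complex.cos (θ:ℂ) = c at *
    generalize Complex.sin (θ:ℂ) = s at *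
    generalize d 1 = a
    generalize d Complex.I = b
    linear_combination (-(r:ℂ)/2 * (a + Complex.I * b)) * hcs + ((r:ℂ)/2 * (a + Complex.I * b) * s^2 - (r:ℂ)/2 * s * b * (c + s * Complex.I)) * hI
  rw [hcongr]
  have hAi' : IntegrableOn (fun p => (1/2) * A p) (Ioi (0:ℝ) ×ˢ Ioo (-Real.pi) Real.pi) :=
    hAi.const_mul _
  have hBi' : IntegrableOn (fun p => (Complex.I/2) * B p) (Ioi (0:ℝ) ×ˢ Ioo (-Real.pi) Real.pi) :=
    hBi.const_mul _
  rw [integral_add hAi' hBi', integral_const_mul, integral_const_mul]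
  have hB : ∫ p in Ioi (0:ℝ) ×ˢ Ioo (-Real.pi) Real.pi, B p = 0 := by
    rw [Measure.volume_eq_prod, setIntegral_prod _ hBi]
    have : ∀ r ∈ Ioi (0:ℝ), ∫ θ in Ioo (-Real.pi) Real.pi, B (r, θ) = 0 := by
      intro r hr
      have hr : 0 < r := hr
      have hrc : (r:ℂ) ≠ 0 := by exact_mod_cast hr.ne'
      rw [← integral_Ioc_eq_integral_Ioo, ← intervalIntegral.integral_of_le (by linarith [Real.pi_pos])]
      have hd : ∀ θ ∈ uIcc (-Real.pi) Real.pi,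
          HasDerivAt (fun θ : ℝ => (1/(r:ℂ)) * f (z + r * E θ)) (B (r, θ)) θ := by
        intro θ _
        have h1 : HasDerivAt (fun θ : ℝ => z + r * E θ) (r * (Complex.I * E θ)) θ := by
          have : HasDerivAt E (Complex.I * E θ) θ := by
            have h0 : HasDerivAt (fun θ : ℝ => (θ:ℂ) * Complex.I) (1 * Complex.I) θ :=
              (Complex.ofRealCLM.hasDerivAt (x := θ)).mul_const _
            convert h0.cexp using 1
            simp only [E]; ring
          exact (this.const_mul (r:ℂ)).const_add z
        have h2 := (hdiff (z + r * E θ)).hasFDerivAt.comp_hasDerivAt θ h1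
        have h3 := h2.const_mul (1/(r:ℂ))
        refine HasDerivAt.congr_deriv h3 ?_
        change _ = fderiv ℝ f (z + r * E θ) (Complex.I * E θ)
        rw [show (r:ℂ) * (Complex.I * E θ) = r • (Complex.I * E θ) by simp, map_smul,
          Complex.real_smul]
        field_simp
      rw [intervalIntegral.integral_eq_sub_of_hasDerivAt hd]
      · have : E Real.pi = E (-Real.pi) := by
          simp [E, Complex.exp_neg]
        rw [this]; simp
      · exact (hBc.comp (by fun_prop : Continuous fun θ : ℝ => (r, θ))).intervalIntegrable _ _
    rw [setIntegral_congr_fun measurableSet_Ioi this]; simp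
  have hA : ∫ p in Ioi (0:ℝ) ×ˢ Ioo (-Real.pi) Real.pi, A p = - (2 * Real.pi) * f z := by
    rw [Measure.volume_eq_prod, ← setIntegral_prod_swap, setIntegral_prod]
    · have : ∀ θ ∈ Ioo (-Real.pi) Real.pi, ∫ r in Ioi (0:ℝ), A (Prod.swap (θ, r)) = - f z := by
        intro θ _
        have hd : ∀ r ∈ Ici (0:ℝ), HasDerivAt (fun r : ℝ => f (z + r * E θ)) (A (r, θ)) r := by
          intro r _
          have h1 : HasDerivAt (fun r : ℝ => z + r * E θ) (E θ) r := by
            have := ((Complex.ofRealCLM.hasDerivAt (x := r)).mul_const (E θ)).const_add z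
            simpa using this
          exact (hdiff (z + r * E θ)).hasFDerivAt.comp_hasDerivAt r h1
        have hi : IntegrableOn (fun r => A (r, θ)) (Ioi 0) := by
          have h1 : IntegrableOn (fun r => A (r, θ)) (Icc 0 R) :=
            (hAc.comp (by fun_prop : Continuous fun r : ℝ => (r, θ))).continuousOn.integrableOn_compact
              isCompact_Icc
          have h3 : IntegrableOn (fun r => A (r, θ)) (Ioi R) := by
            refine (integrableOn_zero (ε' := ℂ)).congr_fun (fun r hr => ?_) measurableSet_Ioi
            simp [A, hfder0 r θ (le_of_lt hr)]
          refine (h1.union h3).mono_set ?_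
          intro r hr
          by_cases h6 : r ≤ R
          · exact Or.inl ⟨le_of_lt hr, h6⟩
          · exact Or.inr (not_le.1 h6)
        have ht : Filter.Tendsto (fun r : ℝ => f (z + r * E θ)) Filter.atTop (𝓝 0) := by
          refine tendsto_const_nhds.congr' ?_
          filter_upwards [Filter.eventually_ge_atTop R] with r hr
          exact (hf0 r θ hr).symm
        have := integral_Ioi_of_hasDerivAt_of_tendsto' hd hi ht
        simpa using this
      rw [setIntegral_congr_fun measurableSet_Ioo this, setIntegral_const]
      simp only [Measure.real, Real.volume_Ioo]
      rw [ENNReal.toReal_ofReal (by linarith [Real.pi_pos])]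
      simp only [Complex.real_smul]; push_cast; ring
    · exact hAi.swap
  rw [hA, hB]; ring


end partb

section partc

/-- Uniform approximability by polynomials on a planar set. -/
def App (Y : Set ℂ) (f : ℂ → ℂ) : Prop :=
  ∀ δ : ℝ, 0 < δ → ∃ p : Polynomial ℂ, ∀ z ∈ Y, ‖f z - p.eval z‖ < δ

theorem inv_locallyIntegrable : LocallyIntegrable (fun w : ℂ => w⁻¹) := by
  refine locallyIntegrable_of_norm_le_rpow (C := 1) (α := 1) (by simp) (by simp) ?_ ?_
  · refine Filter.Eventually.of_forall fun x => ?_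
    simp [Real.rpow_neg_one]
  · exact (measurable_inv).aestronglyMeasurable

/-- small-set uniform estimate for the Cauchy kernel -/
theorem cauchy_kernel_small (R : ℝ) {η : ENNReal} (hη : η ≠ 0) :
    ∃ δ > 0, ∀ (A : Set ℂ) (z : ℂ), MeasurableSet A → volume A < δ → A ⊆ Metric.ball z R →
      ∫⁻ ζ in A, ‖(ζ - z)⁻¹‖ₑ < η := by
  have hfin : ∫⁻ w in Metric.closedBall (0:ℂ) R, ‖w⁻¹‖ₑ ≠ ⊤ := by
    have := (locallyIntegrable_iff.1 inv_locallyIntegrable) _ (isCompact_closedBall (0:ℂ) R)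
    exact this.2.ne
  have hfin' : ∫⁻ w, (Metric.closedBall (0:ℂ) R).indicator (fun w => ‖w⁻¹‖ₑ) w ≠ ⊤ := by
    rwa [lintegral_indicator Metric.isClosed_closedBall.measurableSet]
  obtain ⟨δ, hδ, h⟩ := exists_pos_setLIntegral_lt_of_measure_lt hfin' hη
  refine ⟨δ, hδ, fun A z hAm hA hAR => ?_⟩
  have hmp : MeasurePreserving (fun ζ : ℂ => ζ - z) volume volume :=
    measurePreserving_sub_right volume z
  have hemb : MeasurableEmbedding (fun ζ : ℂ => ζ - z) :=
    (MeasurableEquiv.subRight z).measurableEmbedding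
  have h1 := hmp.setLIntegral_comp_emb hemb
    (fun w => (Metric.closedBall (0:ℂ) R).indicator (fun w => ‖w⁻¹‖ₑ) w) A
  have h2 : volume ((fun ζ : ℂ => ζ - z) '' A) < δ := by
    rw [← hmp.measure_preimage_emb hemb]
    rwa [preimage_image_eq _ hemb.injective]
  have h3 := h _ h2
  rw [← h1] at h3
  refine lt_of_le_of_lt (le_of_eq ?_) h3
  refine setLIntegral_congr_fun hAm fun ζ hζ => ?_
  have : ζ - z ∈ Metric.closedBall (0:ℂ) R := by
    have := hAR hζ
    rw [Metric.mem_ball, dist_eq_norm] at this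
    simpa using this.le
  simp only [indicator_of_mem this]

theorem app_of_dbar {Y : Set ℂ} (hY : IsCompact Y) (hconn : IsPreconnected Yᶜ) {f : ℂ → ℂ}
    (hf : ContDiff ℝ 1 f) (hc : HasCompactSupport f)
    (h0 : ∀ᵐ ζ, ζ ∈ Y → dbar f ζ = 0) : App Y f := by
  have : CompactSpace Y := isCompact_iff_compactSpace.mp hY
  let xid : C(Y, ℂ) := ⟨fun x => x.1, continuous_subtype_val⟩
  let φ : Polynomial ℂ →ₐ[ℂ] C(Y, ℂ) := Polynomial.aeval xid
  have hφ : ∀ p (x : Y), φ p x = p.eval x.1 := by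
    intro p x
    induction p using Polynomial.induction_on' with
    | add p q hp hq => simp [hp, hq]
    | monomial n a => simp [φ, xid, Polynomial.aeval_monomial]
  let A := φ.range.topologicalClosure
  have hAcl : IsClosed (A : Set C(Y, ℂ)) := φ.range.isClosed_topologicalClosure
  have hcomplete : CompleteSpace A := hAcl.completeSpace_coe
  let xA : A := ⟨xid, φ.range.le_topologicalClosure ⟨Polynomial.X, by simp [φ]⟩⟩
  have hsp : spectrum ℂ (xA : C(Y, ℂ)) = Y := by
    rw [ContinuousMap.spectrum_eq_range]
    exact Subtype.range_coe
  have hsp2 : spectrum ℂ xA = Y := by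
    refine (Subalgebra.spectrum_eq_of_isPreconnected_compl A xA ?_).trans hsp
    rw [hsp]; exact hconn
  have hunit : ∀ ζ ∉ Y, IsUnit (algebraMap ℂ A ζ - xA) := by
    intro ζ hζ
    rw [← hsp2] at hζ
    exact spectrum.notMem_iff.1 hζ
  have hval : ∀ ζ ∉ Y, ∀ z : Y, ((resolvent xA ζ : A) : C(Y, ℂ)) z = (ζ - z.1)⁻¹ := by
    intro ζ hζ z
    have h1 : (algebraMap ℂ A ζ - xA) * resolvent xA ζ = 1 :=
      Ring.mul_inverse_cancel _ (hunit ζ hζ)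
    have h2 := congrArg (fun a : A => (a : C(Y, ℂ)) z) h1
    have h3 : (ζ - z.1) * ((resolvent xA ζ : A) : C(Y, ℂ)) z = 1 := by simpa [xA, xid] using h2
    exact eq_inv_of_mul_eq_one_right h3
  let g := dbar f
  have hg : Continuous g := continuous_dbar hf
  have hgc : HasCompactSupport g := hasCompactSupport_dbar hc
  obtain ⟨M, hM⟩ := hg.bounded_above_of_compact_support hgc
  let S := tsupport g
  have hS : IsCompact S := hgc
  let Φ : ℂ → A := fun ζ => g ζ • resolvent xA ζ
  have hΦ : ContinuousOn Φ Yᶜ := by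
    refine hg.continuousOn.smul ?_
    intro ζ hζ
    refine ContinuousAt.continuousWithinAt ?_
    have h1 := NormedRing.inverse_continuousAt (hunit ζ hζ).unit
    have h2 : ContinuousAt (fun ζ : ℂ => algebraMap ℂ A ζ - xA) ζ := by fun_prop
    exact ContinuousAt.comp (g := Ring.inverse) h1 h2
  intro δ hδ
  obtain ⟨R0, hR0⟩ := hY.isBounded.exists_norm_le
  let R : ℝ := 2 * |R0| + 2
  have hthR : ∀ z ∈ Y, ∀ r ≤ 1, Metric.thickening r Y ⊆ Metric.ball z R := by
    intro z hz r hr ζ hζ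
    obtain ⟨y, hy, hyd⟩ := Metric.mem_thickening_iff.1 hζ
    rw [Metric.mem_ball]
    have h1 := hR0 z hz
    have h2 := hR0 y hy
    have h3 : dist y z ≤ ‖y‖ + ‖z‖ := by rw [dist_eq_norm]; exact norm_sub_le _ _
    have := dist_triangle ζ y z
    have := le_abs_self R0
    simp only [R]; linarith
  have hM0 : 0 ≤ M := (norm_nonneg _).trans (hM 0)
  let η : ℝ := δ / (2 * (M + 1))
  have hη : 0 < η := by positivity
  obtain ⟨δ1, hδ1, hker⟩ := cauchy_kernel_small R (η := ENNReal.ofReal η)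
    (by simpa using hη)
  obtain ⟨r, hr0, hr1, hrm⟩ : ∃ r : ℝ, 0 < r ∧ r ≤ 1 ∧
      volume (Metric.thickening r Y \ Y) < δ1 := by
    have ht := tendsto_measure_thickening_of_isClosed (μ := (volume : Measure ℂ)) (s := Y)
      ⟨1, one_pos, (hY.isBounded.thickening (δ := 1)).measure_lt_top.ne⟩ hY.isClosed
    have hlt : volume Y < volume Y + δ1 :=
      ENNReal.lt_add_right hY.measure_lt_top.ne hδ1.ne'
    have h1 := ht.eventually (eventually_lt_nhds hlt)
    have h2 : ∀ᶠ r in 𝓝[>] (0:ℝ), 0 < r ∧ r ≤ 1 := by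
      filter_upwards [Ioc_mem_nhdsGT (zero_lt_one' ℝ)] with r hr using hr
    obtain ⟨r, hr, hr2⟩ := (h1.and h2).exists
    refine ⟨r, hr2.1, hr2.2, ?_⟩
    rw [measure_sdiff (Metric.self_subset_thickening hr2.1 _) hY.measurableSet.nullMeasurableSet
      hY.measure_lt_top.ne]
    exact ENNReal.sub_lt_of_lt_add (measure_mono (Metric.self_subset_thickening hr2.1 _))
      (by rwa [add_comm])
  let U : Set ℂ := (Metric.thickening r Y)ᶜ
  have hUc : IsClosed U := Metric.isOpen_thickening.isClosed_compl
  have hUY : U ⊆ Yᶜ := compl_subset_compl.2 (Metric.self_subset_thickening hr0 _)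
  have hW : IsCompact (U ∩ S) := hS.inter_left hUc
  have hΦi : IntegrableOn Φ (U ∩ S) :=
    (hΦ.mono (inter_subset_left.trans hUY)).integrableOn_compact hW
  let F : A := ∫ ζ in U ∩ S, Φ ζ
  have hF : ∀ z : Y, (F : C(Y, ℂ)) z = ∫ ζ in U ∩ S, g ζ * (ζ - z.1)⁻¹ := by
    intro z
    let L : A →L[ℂ] ℂ :=
      (ContinuousMap.evalCLM ℂ z).comp (Submodule.subtypeL (Subalgebra.toSubmodule A))
    have h1 : L F = ∫ ζ in U ∩ S, L (Φ ζ) := (L.integral_comp_comm hΦi).symm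
    have h2 : L F = (F : C(Y, ℂ)) z := rfl
    rw [← h2, h1]
    refine setIntegral_congr_fun (hUc.inter hS.isClosed).measurableSet fun ζ hζ => ?_
    have h3 : L (Φ ζ) = g ζ * ((resolvent xA ζ : A) : C(Y, ℂ)) z := rfl
    change L (Φ ζ) = _
    rw [h3, hval ζ (hUY hζ.1)]
  have hFmem : (F : C(Y, ℂ)) ∈ closure (φ.range : Set C(Y, ℂ)) := F.2
  obtain ⟨_, ⟨p, rfl⟩, hp⟩ := Metric.mem_closure_iff.1 hFmem (δ/2) (by positivity)
  refine ⟨Polynomial.C (-(Real.pi:ℂ)⁻¹) * p, fun z hz => ?_⟩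
  have hp' := (ContinuousMap.dist_lt_iff (by positivity)).1 hp ⟨z, hz⟩
  have e : (φ.toRingHom p) ⟨z, hz⟩ = p.eval z := hφ p ⟨z, hz⟩
  rw [e, dist_eq_norm, hF] at hp'
  have hpi : (Real.pi:ℂ) ≠ 0 := by exact_mod_cast Real.pi_ne_zero
  have hinti : Integrable (fun ζ => g ζ * (ζ - z)⁻¹) := by
    have h1 : Integrable (fun w => g (w + z) • w⁻¹) := by
      refine inv_locallyIntegrable.integrable_smul_left_of_hasCompactSupport (by fun_prop) ?_
      exact hgc.comp_homeomorph (Homeomorph.addRight z)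
    have h2 := h1.comp_sub_right z
    simpa using h2
  have hpomp : ∫ ζ, g ζ * (ζ - z)⁻¹ = - Real.pi * f z := by
    rw [← pompeiu hf hc z, ← integral_add_left_eq_self _ z]
    simp [g, div_eq_mul_inv]
  have hsplit : ∫ ζ, g ζ * (ζ - z)⁻¹ = (∫ ζ in U ∩ S, g ζ * (ζ - z)⁻¹) +
      ∫ ζ in Metric.thickening r Y, g ζ * (ζ - z)⁻¹ := by
    rw [← integral_add_compl hUc.measurableSet hinti]
    congr 1
    · refine setIntegral_eq_of_subset_of_forall_sdiff_eq_zero hUc.measurableSet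
        inter_subset_left ?_
      rintro ζ ⟨h1, h2⟩
      have : g ζ = 0 := by
        by_contra hcon
        exact h2 ⟨h1, subset_tsupport _ hcon⟩
      simp [this]
    · simp [U]
  have hsmall : ‖∫ ζ in Metric.thickening r Y, g ζ * (ζ - z)⁻¹‖ ≤ δ / 2 := by
    have hms : MeasurableSet (Metric.thickening r Y) := Metric.isOpen_thickening.measurableSet
    have h1 : ∫ ζ in Metric.thickening r Y, g ζ * (ζ - z)⁻¹ =
        ∫ ζ in Metric.thickening r Y \ Y, g ζ * (ζ - z)⁻¹ := by
      refine setIntegral_eq_of_subset_of_ae_sdiff_eq_zero hms.nullMeasurableSet sdiff_subset ?_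
      filter_upwards [h0] with ζ hζ h2
      have : ζ ∈ Y := by
        by_contra hcon
        exact h2.2 ⟨h2.1, hcon⟩
      simp [g, hζ this]
    rw [h1]
    have h2 : ‖∫ ζ in Metric.thickening r Y \ Y, g ζ * (ζ - z)⁻¹‖ₑ ≤
        ENNReal.ofReal M * ENNReal.ofReal η := by
      refine (enorm_integral_le_lintegral_enorm _).trans ?_
      have h3 := hker (Metric.thickening r Y \ Y) z (hms.diff hY.measurableSet) hrm
        (sdiff_subset.trans (hthR z hz r hr1))
      calc ∫⁻ ζ in Metric.thickening r Y \ Y, ‖g ζ * (ζ - z)⁻¹‖ₑ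
          ≤ ∫⁻ ζ in Metric.thickening r Y \ Y, ENNReal.ofReal M * ‖(ζ - z)⁻¹‖ₑ := by
            refine lintegral_mono fun ζ => ?_
            rw [enorm_mul]
            gcongr
            rw [← ofReal_norm]
            exact ENNReal.ofReal_le_ofReal (hM ζ)
        _ = ENNReal.ofReal M * ∫⁻ ζ in Metric.thickening r Y \ Y, ‖(ζ - z)⁻¹‖ₑ := by
            rw [lintegral_const_mul' _ _ ENNReal.ofReal_ne_top]
        _ ≤ _ := by gcongr
    rw [← ENNReal.ofReal_mul hM0, ← ofReal_norm,
      ENNReal.ofReal_le_ofReal_iff (by positivity)] at h2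
    refine h2.trans ?_
    simp only [η]
    rw [mul_div_assoc', div_le_div_iff₀ (by positivity) (by positivity)]
    nlinarith
  have hfz : f z = -(Real.pi:ℂ)⁻¹ * ((∫ ζ in U ∩ S, g ζ * (ζ - z)⁻¹) +
      ∫ ζ in Metric.thickening r Y, g ζ * (ζ - z)⁻¹) := by
    rw [← hsplit, hpomp]; field_simp
  rw [hfz, Polynomial.eval_mul, Polynomial.eval_C, ← mul_sub, norm_mul]
  have hpin : ‖-(Real.pi:ℂ)⁻¹‖ ≤ 1 := by
    rw [norm_neg, norm_inv, Complex.norm_real, Real.norm_of_nonneg Real.pi_pos.le]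
    exact inv_le_one_of_one_le₀ (by linarith [Real.pi_gt_three])
  generalize (∫ ζ in U ∩ S, g ζ * (ζ - z)⁻¹) = a at *
  generalize (∫ ζ in Metric.thickening r Y, g ζ * (ζ - z)⁻¹) = b at *
  calc _ ≤ 1 * ‖a + b - p.eval z‖ := by gcongr
    _ = ‖(a - p.eval z) + b‖ := by rw [one_mul]; congr 1; ring
    _ ≤ ‖a - p.eval z‖ + ‖b‖ := norm_add_le _ _
    _ < δ := by linarith


end partc

section partd

/-- Planar `P(Y) = C(Y)`. -/
def PC (Y : Set ℂ) : Prop := ∀ f : ℂ → ℂ, ContinuousOn f Y → App Y f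

theorem PC_of_conj {Y : Set ℂ} (hY : IsCompact Y) (h : App Y (starRingEnd ℂ)) : PC Y := by
  let X : Set (Fin 1 → ℂ) := (fun x => x 0) ⁻¹' Y
  have hX : IsCompact X :=
    (Homeomorph.funUnique (Fin 1) ℂ).isCompact_preimage.2 hY
  have hcp : CP X := by
    intro i δ hδ
    obtain ⟨p, hp⟩ := h δ hδ
    refine ⟨Polynomial.aeval (MvPolynomial.X 0) p, fun z hz => ?_⟩
    have e : eval z (Polynomial.aeval (MvPolynomial.X 0 : MvPolynomial (Fin 1) ℂ) p) =
        p.eval (z 0) := by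
      induction p using Polynomial.induction_on' with
      | add p q hp hq => simp [Polynomial.aeval_def, Polynomial.eval₂_eq_sum_range, Polynomial.eval_eq_sum_range]
      | monomial n a => simp [Polynomial.aeval_monomial]
    rw [e, norm_sub_rev, Subsingleton.elim i 0]
    exact hp _ hz
  intro f hf δ hδ
  obtain ⟨p, hp⟩ := hcp.polyEq hX (fun x => f (x 0))
    (hf.comp (continuous_apply 0).continuousOn (fun x hx => hx)) δ hδ
  refine ⟨aeval (fun _ => (Polynomial.X : Polynomial ℂ)) p, fun z hz => ?_⟩
  have e : (aeval (fun _ => (Polynomial.X : Polynomial ℂ)) p).eval z = eval (fun _ => z) p := by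
    clear hp
    induction p using MvPolynomial.induction_on with
    | C a => simp
    | add p q hp hq => simp [hp, hq]
    | mul_X p i hp => simp [hp]
  rw [e]
  exact hp (fun _ => z) hz

theorem isPreconnected_norm_gt {R : ℝ} (hR : 0 < R) : IsPreconnected {z : ℂ | R < ‖z‖} := by
  have h1 : {z : ℂ | R < ‖z‖} = Complex.exp '' {w : ℂ | Real.log R < w.re} := by
    ext z
    simp only [mem_setOf_eq, mem_image]
    constructor
    · intro hz
      have hz0 : z ≠ 0 := by
        intro e; rw [e, norm_zero] at hz; linarith
      refine ⟨Complex.log z, ?_, Complex.exp_log hz0⟩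
      rw [Complex.log_re]
      exact Real.log_lt_log hR hz
    · rintro ⟨w, hw, rfl⟩
      rw [Complex.norm_exp]
      exact (Real.log_lt_iff_lt_exp hR).1 hw
  rw [h1]
  exact ((convex_halfSpace_re_gt _).isPreconnected).image _ Complex.continuous_exp.continuousOn

theorem PC.compl_preconnected {Y : Set ℂ} (hY : IsCompact Y) (h : PC Y) : IsPreconnected Yᶜ := by
  have hYo : IsOpen Yᶜ := hY.isClosed.isOpen_compl
  obtain ⟨R0, hR0⟩ := hY.isBounded.exists_norm_le
  set R := |R0| + 1
  have hRpos : 0 < R := by positivity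
  have hbig : {z : ℂ | R < ‖z‖} ⊆ Yᶜ := by
    intro z hz hzY
    have h1 := hR0 z hzY
    have h2 : R < ‖z‖ := hz
    have := le_abs_self R0
    simp only [R] at h2; linarith
  have key : ∀ w ∈ Yᶜ, {z : ℂ | R < ‖z‖} ⊆ connectedComponentIn Yᶜ w := by
    intro w hw
    have hunb : ¬ Bornology.IsBounded (connectedComponentIn Yᶜ w) := by
      intro hb
      set W := connectedComponentIn Yᶜ w with hW
      have hWo : IsOpen W := hYo.connectedComponentIn
      have hwW : w ∈ W := mem_connectedComponentIn hw
      have hfr : frontier W ⊆ Y := by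
        intro x hx
        by_contra hxY
        have hx2 : x ∈ closure W := frontier_subset_closure hx
        have hV : connectedComponentIn Yᶜ x ∈ 𝓝 x :=
          hYo.connectedComponentIn.mem_nhds (mem_connectedComponentIn hxY)
        obtain ⟨y, hy1, hy2⟩ := mem_closure_iff_nhds.1 hx2 _ hV
        have e1 := connectedComponentIn_eq hy1
        have e2 := connectedComponentIn_eq hy2
        have hxW : x ∈ W := by
          rw [hW, e2, ← e1]; exact mem_connectedComponentIn hxY
        rw [hWo.frontier_eq] at hx
        exact hx.2 hxW
      have hwY : ∀ z ∈ Y, z - w ≠ 0 := by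
        intro z hz e
        rw [sub_eq_zero] at e
        exact hw (e ▸ hz)
      obtain ⟨p, hp⟩ := h (fun z => (z - w)⁻¹) (ContinuousOn.inv₀ (by fun_prop) hwY)
        (1 / (2 * (R + ‖w‖ + 1))) (by positivity)
      let q : Polynomial ℂ := 1 - (Polynomial.X - Polynomial.C w) * p
      have hq : ∀ z ∈ frontier W, ‖q.eval z‖ ≤ 1/2 := by
        intro z hz
        have hzY := hfr hz
        have e : q.eval z = (z - w) * ((z - w)⁻¹ - p.eval z) := by
          simp only [q, Polynomial.eval_sub, Polynomial.eval_one, Polynomial.eval_mul,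
            Polynomial.eval_X, Polynomial.eval_C]
          rw [mul_sub, mul_inv_cancel₀ (hwY z hzY)]
        rw [e, norm_mul]
        have h1 : ‖z - w‖ ≤ R + ‖w‖ := by
          refine (norm_sub_le _ _).trans ?_
          have := hR0 z hzY
          have := le_abs_self R0
          simp only [R]; linarith
        have h2 := (hp z hzY).le
        calc _ ≤ (R + ‖w‖) * (1 / (2 * (R + ‖w‖ + 1))) := by gcongr
          _ ≤ 1/2 := by
            rw [mul_one_div, div_le_div_iff₀ (by positivity) (by positivity)]
            linarith
      have := Complex.norm_le_of_forall_mem_frontier_norm_le hb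
        (q.differentiable.diffContOnCl) hq (subset_closure hwW)
      simp [q] at this
      norm_num at this
    have : ∃ z ∈ connectedComponentIn Yᶜ w, R < ‖z‖ := by
      by_contra hcon
      push Not at hcon
      exact hunb (isBounded_iff_forall_norm_le.2 ⟨R, hcon⟩)
    obtain ⟨z, hz, hzR⟩ := this
    rw [connectedComponentIn_eq hz]
    exact (isPreconnected_norm_gt hRpos).subset_connectedComponentIn hzR hbig
  refine isPreconnected_of_forall ((R + 1 : ℝ) : ℂ) fun w hw => ?_
  refine ⟨connectedComponentIn Yᶜ w, connectedComponentIn_subset _ _, key w hw ?_,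
    mem_connectedComponentIn hw, isPreconnected_connectedComponentIn⟩
  simp only [mem_setOf_eq, Complex.norm_real, Real.norm_eq_abs]
  rw [abs_of_pos (by positivity)]; linarith

theorem PC.union_null {Y I : Set ℂ} (hY : IsCompact Y) (h : PC Y) (hI : IsCompact I)
    (hnull : volume I = 0) (hconn : IsPreconnected (Y ∪ I)ᶜ) : PC (Y ∪ I) := by
  have hYI := hY.union hI
  refine PC_of_conj hYI fun δ hδ => ?_
  obtain ⟨p0, hp0⟩ := h (starRingEnd ℂ) Complex.continuous_conj.continuousOn (δ/2) (by positivity)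
  let F : ℂ → ℂ := fun z => (starRingEnd ℂ) z - p0.eval z
  have hF : ContDiff ℝ 1 F := by
    refine ContDiff.sub (Complex.conjCLE.contDiff) ?_
    exact (Polynomial.contDiff_aeval (𝕜 := ℂ) p0 1).restrict_scalars ℝ
  obtain ⟨R0, hR0⟩ := hYI.isBounded.exists_norm_le
  let V : Set ℂ := {z | ‖F z‖ < δ/2}
  have hV : IsOpen V := isOpen_lt (hF.continuous.norm) continuous_const
  let s : Set ℂ := Y ∪ {z | R0 + 1 ≤ ‖z‖}
  let t : Set ℂ := (Y ∪ I) \ V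
  have hs : IsClosed s := hY.isClosed.union (isClosed_le continuous_const continuous_norm)
  have ht : IsClosed t := hYI.isClosed.sdiff hV
  have hst : Disjoint s t := by
    rw [Set.disjoint_left]
    rintro z (hz | hz) ⟨hz1, hz2⟩
    · exact hz2 (hp0 z hz)
    · have := hR0 z hz1
      have hz' : R0 + 1 ≤ ‖z‖ := hz
      linarith
  obtain ⟨χ, hχ0, hχ1, hχ⟩ := exists_contMDiffMap_zero_one_nhds_of_isClosed
    (modelWithCornersSelf ℝ ℂ) (n := 1) hs ht hst
  have hχc : ContDiff ℝ 1 (χ : ℂ → ℝ) := χ.contMDiff.contDiff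
  let f : ℂ → ℂ := fun z => χ z • F z
  have hf : ContDiff ℝ 1 f := hχc.smul hF
  have hfc : HasCompactSupport f := by
    refine HasCompactSupport.intro (isCompact_closedBall (0:ℂ) (R0 + 1)) fun z hz => ?_
    have : z ∈ s := by
      right
      simp only [Metric.mem_closedBall, dist_zero_right, not_le] at hz
      exact hz.le
    simp [f, hχ0.self_of_nhdsSet z this]
  have hdb : ∀ᵐ ζ, ζ ∈ Y ∪ I → dbar f ζ = 0 := by
    have hI' : ∀ᵐ ζ, ζ ∉ I := measure_eq_zero_iff_ae_notMem.1 hnull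
    filter_upwards [hI'] with ζ hζ hmem
    have hζY : ζ ∈ Y := hmem.resolve_right hζ
    have hev : ∀ᶠ x in 𝓝 ζ, χ x = 0 :=
      hχ0.filter_mono (nhds_le_nhdsSet (show ζ ∈ s from Or.inl hζY))
    have : f =ᶠ[𝓝 ζ] fun _ => 0 := by
      filter_upwards [hev] with x hx
      simp [f, hx]
    simp [dbar, this.fderiv_eq]
  obtain ⟨p1, hp1⟩ := app_of_dbar hYI hconn hf hfc hdb (δ/2) (by positivity)
  refine ⟨p0 + p1, fun z hz => ?_⟩
  have h1 := hp1 z hz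
  have h2 : ‖F z - f z‖ ≤ δ/2 := by
    have e : F z - f z = (1 - χ z) • F z := by simp only [f]; rw [sub_smul, one_smul]
    have hz01 := hχ z
    by_cases hzV : z ∈ V
    · rw [e, norm_smul, Real.norm_of_nonneg (by linarith [hz01.2])]
      have : ‖F z‖ < δ/2 := hzV
      nlinarith [hz01.1, hz01.2, norm_nonneg (F z)]
    · have : χ z = 1 := hχ1.self_of_nhdsSet z ⟨hz, hzV⟩
      rw [e, this]; simp; positivity
  have e : (starRingEnd ℂ) z - (p0 + p1).eval z = (F z - f z) + (f z - p1.eval z) := by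
    simp only [F, Polynomial.eval_add]; ring
  rw [e]
  calc _ ≤ ‖F z - f z‖ + ‖f z - p1.eval z‖ := norm_add_le _ _
    _ < δ := by linarith


end partd

section parte

section topo
variable {E : Type*} [NormedAddCommGroup E] [NormedSpace ℝ E]

theorem isCompact_seg (b c : E) : IsCompact (segment ℝ b c) := by
  rw [segment_eq_image']
  exact isCompact_Icc.image (by fun_prop)

theorem exists_off_line (h2 : 1 < Module.rank ℝ E) (v : E) :
    ∃ w : E, ∀ t : ℝ, w ≠ t • v := by
  by_contra hcon
  push Not at hcon
  have : (Submodule.span ℝ {v}) = ⊤ := by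
    rw [eq_top_iff]
    intro w _
    obtain ⟨t, rfl⟩ := hcon w
    exact Submodule.smul_mem _ _ (Submodule.mem_span_singleton_self v)
  have h3 : Module.rank ℝ (Submodule.span ℝ {v}) ≤ Cardinal.mk ({v} : Set E) := rank_span_le _
  rw [this, rank_top, Cardinal.mk_singleton] at h3
  exact absurd h2 (not_lt.2 h3)

/-- Points off the line `b + ℝ v` are dense. -/
theorem dense_off_line (h2 : 1 < Module.rank ℝ E) (b v : E) {O : Set E} (hO : IsOpen O)
    {x : E} (hx : x ∈ O) : ∃ y ∈ O, ∀ t : ℝ, y ≠ b + t • v := by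
  by_cases hxl : ∀ t : ℝ, x ≠ b + t • v
  · exact ⟨x, hx, hxl⟩
  push Not at hxl
  obtain ⟨t0, ht0⟩ := hxl
  obtain ⟨w, hw⟩ := exists_off_line h2 v
  have hcont : Filter.Tendsto (fun s : ℝ => x + s • w) (𝓝[≠] 0) (𝓝 x) := by
    have : Continuous (fun s : ℝ => x + s • w) := by fun_prop
    have h := this.tendsto 0
    simp only [zero_smul, add_zero] at h
    exact h.mono_left nhdsWithin_le_nhds
  have h1 := (hcont.eventually (hO.mem_nhds hx)).and self_mem_nhdsWithin
  obtain ⟨s, hs, hs0⟩ := h1.exists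
  refine ⟨_, hs, fun t ht => ?_⟩
  have hs0 : s ≠ 0 := hs0
  have : s • w = (t - t0) • v := by
    rw [ht0] at ht
    rw [sub_smul, eq_sub_iff_add_eq]
    have := ht
    rw [add_assoc, add_right_inj, add_comm] at this
    exact this
  apply hw (s⁻¹ * (t - t0))
  rw [mul_smul, ← this, smul_smul, inv_mul_cancel₀ hs0, one_smul]

/-- If `W` is open, covered by open `u`, `v`, disjoint on `W`: a preconnected subset of `W`
meeting `u` lies in `u`. -/
theorem sub_of_meets {α : Type*} [TopologicalSpace α] {W u v T : Set α} (hu : IsOpen u)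
    (hv : IsOpen v) (hcov : W ⊆ u ∪ v) (hdis : ¬ (W ∩ (u ∩ v)).Nonempty)
    (hT : IsPreconnected T) (hTW : T ⊆ W) {x y : α} (hx : x ∈ T) (hxu : x ∈ u) (hy : y ∈ T) :
    y ∈ u := by
  by_contra hyu
  have hyv : y ∈ v := (hcov (hTW hy)).resolve_left hyu
  obtain ⟨z, hz, hz2⟩ := hT u v hu hv (hTW.trans hcov) ⟨x, hx, hxu⟩ ⟨y, hy, hyv⟩
  exact hdis ⟨z, hTW hz, hz2⟩

theorem slit_aux (h2 : 1 < Module.rank ℝ E) {V : Set E} (hV : IsOpen V)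
    (hVc : IsPreconnected V) {b c : E} (hb : b ∉ V)
    (hseg : ∀ t ∈ Ioc (0:ℝ) 1, b + t • (c - b) ∈ V) {u v : Set E} (hu : IsOpen u)
    (hv : IsOpen v) (hcov : V \ segment ℝ b c ⊆ u ∪ v)
    (hdis : ¬ ((V \ segment ℝ b c) ∩ (u ∩ v)).Nonempty)
    (r : ℝ) (hr : 0 < r) (hball : Metric.ball c r ⊆ V) (η : ℝ) (hη : 0 < η)
    (heb : c + η • (c - b) ∈ Metric.ball c r) (heu : c + η • (c - b) ∈ u) :
    V \ segment ℝ b c ⊆ u := by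
  set d := c - b with hd
  set W := V \ segment ℝ b c with hW
  have hWo : IsOpen W := hV.sdiff (isCompact_seg b c).isClosed
  have hoff : ∀ x, (∀ t : ℝ, x ≠ b + t • d) → x ∉ segment ℝ b c := by
    intro x hx hmem
    rw [segment_eq_image'] at hmem
    obtain ⟨t, _, rfl⟩ := hmem
    exact hx t rfl
  have hmemseg : ∀ t : ℝ, b + t • d ∈ segment ℝ b c → d ≠ 0 → t ∈ Icc (0:ℝ) 1 := by
    intro t ht hd0
    rw [segment_eq_image'] at ht
    obtain ⟨s, hs, hst⟩ := ht
    have : (s - t) • d = 0 := by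
      rw [sub_smul, sub_eq_zero]; exact add_left_cancel hst
    rcases smul_eq_zero.1 this with h | h
    · have : s = t := sub_eq_zero.1 h
      exact this ▸ hs
    · exact absurd h hd0
  have hcV : c ∈ V := by
    have := hseg 1 ⟨one_pos, le_rfl⟩
    simpa [hd] using this
  have hd0 : d ≠ 0 := by
    intro h
    have : c = b := sub_eq_zero.1 h
    exact hb (this ▸ hcV)
  let y : ℝ → E := fun t => b + t • d
  have hyc : Continuous y := by fun_prop
  let G : Set ℝ := {t | ∃ r > 0, Metric.ball (y t) r ⊆ V ∧
    ∀ x ∈ Metric.ball (y t) r, (∀ s : ℝ, x ≠ b + s • d) → x ∈ u}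
  have hGo : IsOpen G := by
    rw [isOpen_iff_mem_nhds]
    rintro t ⟨ρ, hρ, h1, h3⟩
    have : ∀ᶠ s in 𝓝 t, dist (y s) (y t) < ρ / 2 :=
      (hyc.tendsto t).eventually (Metric.ball_mem_nhds _ (by positivity))
    filter_upwards [this] with s hs
    have hsub : Metric.ball (y s) (ρ/2) ⊆ Metric.ball (y t) ρ :=
      Metric.ball_subset_ball' (by linarith)
    exact ⟨ρ/2, by positivity, hsub.trans h1, fun x hx => h3 x (hsub hx)⟩
  have h1G : (1:ℝ) ∈ G := by
    refine ⟨r, hr, ?_, ?_⟩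
    · simpa [y, hd] using hball
    · have hy1 : y 1 = c := by simp [y, hd]
      rw [hy1]
      intro x hx hxl
      have hTW : segment ℝ x (c + η • d) ⊆ W := by
        intro z hz
        refine ⟨hball ((convex_ball c r).segment_subset hx heb hz), ?_⟩
        rw [segment_eq_image'] at hz
        obtain ⟨θ, hθ, rfl⟩ := hz
        rcases eq_or_lt_of_le hθ.2 with h | h
        · subst h
          intro hmem
          have e : x + (1:ℝ) • (c + η • d - x) = b + (1 + η) • d := by
            rw [one_smul, add_smul, one_smul, hd]; abel
          change x + (1:ℝ) • (c + η • d - x) ∈ _ at hmem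
          rw [e] at hmem
          have := (hmemseg _ hmem hd0).2
          linarith
        · refine hoff _ fun t ht => ?_
          apply hxl ((1-θ)⁻¹ * (t - θ * (1 + η)))
          have h1θ : (1 - θ) ≠ 0 := by linarith
          have e : x + θ • (c + η • d - x) = (1-θ) • x + θ • (b + (1 + η) • d) := by
            rw [show c = b + d by rw [hd]; abel]
            module
          change x + θ • (c + η • d - x) = _ at ht
          rw [e] at ht
          have e2 : (1-θ) • x = (1 - θ) • b + (t - θ * (1+η)) • d := by
            rw [eq_sub_of_add_eq ht]; module
          calc x = (1-θ)⁻¹ • ((1-θ) • x) := by rw [smul_smul, inv_mul_cancel₀ h1θ, one_smul]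
            _ = _ := by rw [e2, smul_add, smul_smul, smul_smul, inv_mul_cancel₀ h1θ, one_smul]
      exact sub_of_meets hu hv hcov hdis (convex_segment _ _).isPreconnected hTW
        (right_mem_segment ℝ _ _) heu (left_mem_segment ℝ _ _)
  have hGcl : ∀ s ∈ Ioc (0:ℝ) 1, s ∈ closure G → s ∈ G := by
    intro s hs hsG
    obtain ⟨ρ, hρ, hρV⟩ := Metric.isOpen_iff.1 hV (y s) (hseg s hs)
    refine ⟨ρ, hρ, hρV, fun x hx hxl => ?_⟩
    have hev : ∀ᶠ t in 𝓝 s, y t ∈ Metric.ball (y s) ρ :=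
      (hyc.tendsto s).eventually (Metric.ball_mem_nhds _ hρ)
    obtain ⟨t, ht1, ρ', hρ', ht2, ht3⟩ := mem_closure_iff_nhds.1 hsG _ hev
    have hc2 : Filter.Tendsto (fun κ : ℝ => y t + κ • (x - y s)) (𝓝[>] 0) (𝓝 (y t)) := by
      have : Continuous (fun κ : ℝ => y t + κ • (x - y s)) := by fun_prop
      have h := this.tendsto 0
      simp only [zero_smul, add_zero] at h
      exact h.mono_left nhdsWithin_le_nhds
    have hev2 := ((hc2.eventually (Metric.ball_mem_nhds _ hρ')).and
      (hc2.eventually (Metric.isOpen_ball.mem_nhds ht1))).and self_mem_nhdsWithin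
    obtain ⟨κ, ⟨hκ1, hκ2⟩, hκ0⟩ := hev2.exists
    have hκ0 : 0 < κ := hκ0
    have hlin : ∀ a : ℝ, 0 < a → ∀ τ σ : ℝ, y τ + a • (x - y s) ≠ b + σ • d := by
      intro a ha τ σ h
      apply hxl (a⁻¹ * (σ - τ) + s)
      have e : a • (x - y s) = (σ - τ) • d := by
        have : a • (x - y s) = b + σ • d - y τ := by rw [← h]; abel
        rw [this]; simp only [y]; module
      have e2 : x - y s = (a⁻¹ * (σ - τ)) • d := by
        rw [mul_smul, ← e, smul_smul, inv_mul_cancel₀ ha.ne', one_smul]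
      rw [eq_add_of_sub_eq e2]; simp only [y]; module
    have hend : y t + κ • (x - y s) ∈ u := ht3 _ hκ1 (fun σ => hlin κ hκ0 t σ)
    have hTW : segment ℝ x (y t + κ • (x - y s)) ⊆ W := by
      intro z hz
      refine ⟨hρV ((convex_ball _ ρ).segment_subset hx hκ2 hz), hoff _ fun σ hσ => ?_⟩
      rw [segment_eq_image'] at hz
      obtain ⟨θ, hθ, rfl⟩ := hz
      refine hlin ((1 - θ) + θ * κ) ?_ (s + θ * (t - s)) σ ?_
      · rcases eq_or_lt_of_le hθ.2 with h | h
        · subst h; simpa using hκ0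
        · have : 0 ≤ θ * κ := mul_nonneg hθ.1 hκ0.le
          linarith
      · rw [← hσ]; simp only [y]; module
    exact sub_of_meets hu hv hcov hdis (convex_segment _ _).isPreconnected hTW
      (right_mem_segment ℝ _ _) hend (left_mem_segment ℝ _ _)
  have hall : Ioc (0:ℝ) 1 ⊆ G := by
    refine isPreconnected_Ioc.subset_of_closure_inter_subset hGo ⟨1, ⟨one_pos, le_rfl⟩, h1G⟩ ?_
    rintro s ⟨h1, h3⟩
    exact hGcl s h3 h1
  -- conclusion
  intro x hx
  by_contra hxu
  have hxv : x ∈ v := (hcov hx).resolve_left hxu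
  let v' := W ∩ v
  let u' : Set E := (W ∩ u) ∪ ⋃ t ∈ Ioc (0:ℝ) 1, ⋃ ρ ∈ {ρ : ℝ | 0 < ρ ∧
    Metric.ball (y t) ρ ⊆ V ∧ ∀ x ∈ Metric.ball (y t) ρ, (∀ s : ℝ, x ≠ b + s • d) → x ∈ u},
      Metric.ball (y t) ρ
  have hv' : IsOpen v' := hWo.inter hv
  have hu' : IsOpen u' := by
    refine (hWo.inter hu).union ?_
    refine isOpen_biUnion fun t _ => isOpen_biUnion fun ρ _ => Metric.isOpen_ball
  have hcov' : V ⊆ u' ∪ v' := by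
    intro z hz
    by_cases hzs : z ∈ segment ℝ b c
    · left; right
      rw [segment_eq_image'] at hzs
      obtain ⟨t, ht, rfl⟩ := hzs
      have ht0 : t ≠ 0 := by
        rintro rfl
        apply hb; simpa using hz
      have htI : t ∈ Ioc (0:ℝ) 1 := ⟨lt_of_le_of_ne ht.1 ht0.symm, ht.2⟩
      obtain ⟨ρ, hρ, h3⟩ := hall htI
      simp only [mem_iUnion]
      exact ⟨t, htI, ρ, ⟨hρ, h3⟩, Metric.mem_ball_self hρ⟩
    · have hzW : z ∈ W := ⟨hz, hzs⟩
      rcases hcov hzW with h | h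
      · exact Or.inl (Or.inl ⟨hzW, h⟩)
      · exact Or.inr ⟨hzW, h⟩
  have hcu : c ∈ u' := by
    right
    obtain ⟨ρ, hρ, h3⟩ := h1G
    simp only [mem_iUnion]
    refine ⟨1, ⟨one_pos, le_rfl⟩, ρ, ⟨hρ, h3⟩, ?_⟩
    have : y 1 = c := by simp [y, hd]
    rw [this]; exact Metric.mem_ball_self hρ
  obtain ⟨z, -, hz1, hz2⟩ := hVc u' v' hu' hv' hcov' ⟨c, hcV, hcu⟩ ⟨x, hx.1, hx, hxv⟩
  rcases hz1 with hz1 | hz1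
  · exact hdis ⟨z, hz1.1, hz1.2, hz2.2⟩
  · simp only [mem_iUnion] at hz1
    obtain ⟨t, ht, ρ, ⟨hρ, h3, h4⟩, hzb⟩ := hz1
    obtain ⟨z', hz', hzl⟩ := dense_off_line h2 b d (hv'.inter Metric.isOpen_ball) ⟨hz2, hzb⟩
    exact hdis ⟨z', hz'.1.1, h4 z' hz'.2 hzl, hz'.1.2⟩

theorem slit_preconnected (h2 : 1 < Module.rank ℝ E) {V : Set E} (hV : IsOpen V)
    (hVc : IsPreconnected V) {b c : E} (hb : b ∉ V) (hcb : b ≠ c)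
    (hseg : ∀ x ∈ segment ℝ b c, x ≠ b → x ∈ V) : IsPreconnected (V \ segment ℝ b c) := by
  have hseg' : ∀ t ∈ Ioc (0:ℝ) 1, b + t • (c - b) ∈ V := by
    intro t ht
    refine hseg _ ?_ ?_
    · rw [segment_eq_image']; exact ⟨t, ⟨ht.1.le, ht.2⟩, rfl⟩
    · intro h
      have : t • (c - b) = 0 := by simpa using h
      rcases smul_eq_zero.1 this with h | h
      · exact ht.1.ne' h
      · exact hcb (sub_eq_zero.1 h).symm
  have hcV : c ∈ V := hseg c (right_mem_segment ℝ _ _) hcb.symm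
  obtain ⟨r, hr, hball⟩ := Metric.isOpen_iff.1 hV c hcV
  have hc2 : Filter.Tendsto (fun κ : ℝ => c + κ • (c - b)) (𝓝[>] 0) (𝓝 c) := by
    have : Continuous (fun κ : ℝ => c + κ • (c - b)) := by fun_prop
    have h := this.tendsto 0
    simp only [zero_smul, add_zero] at h
    exact h.mono_left nhdsWithin_le_nhds
  obtain ⟨η, hη1, hη⟩ := ((hc2.eventually (Metric.ball_mem_nhds _ hr)).and
    self_mem_nhdsWithin).exists
  have hη : 0 < η := hη
  have heW : c + η • (c - b) ∈ V \ segment ℝ b c := by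
    refine ⟨hball hη1, fun hmem => ?_⟩
    rw [segment_eq_image'] at hmem
    obtain ⟨s, hs, hst⟩ := hmem
    have : (s - (1 + η)) • (c - b) = 0 := by
      have h3 : s • (c - b) = (1 + η) • (c - b) := by
        have h4 : s • (c - b) = c + η • (c - b) - b := by rw [← hst]; simp
        rw [h4]; module
      rw [sub_smul, h3, sub_self]
    rcases smul_eq_zero.1 this with h | h
    · linarith [hs.2]
    · exact hcb (sub_eq_zero.1 h).symm
  intro u v hu hv hcov hxu hxv
  by_contra hdis
  obtain ⟨x, hx, hxu⟩ := hxu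
  obtain ⟨x', hx', hxv'⟩ := hxv
  rcases hcov heW with h | h
  · exact hdis ⟨x', hx', slit_aux h2 hV hVc hb hseg' hu hv hcov hdis r hr hball η hη hη1 h hx', hxv'⟩
  · refine hdis ⟨x, hx, hxu, slit_aux h2 hV hVc hb hseg' hv hu (by rwa [union_comm])
      (by rwa [inter_comm v u]) r hr hball η hη hη1 h hx⟩

end topo

end parte

section partf

section topo2
variable {E : Type*} [NormedAddCommGroup E] [NormedSpace ℝ E]

theorem ball_punctured_preconnected (h2 : 1 < Module.rank ℝ E) (c : E) {r : ℝ} (hr : 0 < r) :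
    IsPreconnected (Metric.ball c r \ {c}) := by
  have h := (isConnected_compl_singleton_of_one_lt_rank h2 c).isPreconnected
  have hc : Continuous (fun x : E => c + (r / (1 + ‖x - c‖)) • (x - c)) := by
    have : ∀ x : E, 1 + ‖x - c‖ ≠ 0 := fun x => by positivity
    fun_prop (disch := assumption)
  have := h.image _ hc.continuousOn
  convert this using 1
  ext y
  constructor
  · rintro ⟨hy, hyc⟩
    have hyc : y - c ≠ 0 := sub_ne_zero.2 hyc
    have hyr : ‖y - c‖ < r := by simpa [dist_eq_norm] using hy
    have hpos : 0 < r - ‖y - c‖ := by linarith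
    refine ⟨c + (1 / (r - ‖y - c‖)) • (y - c), ?_, ?_⟩
    · intro h
      have h : (1 / (r - ‖y - c‖)) • (y - c) = 0 := by simpa using h
      rcases smul_eq_zero.1 h with h | h
      · have : 0 < 1 / (r - ‖y - c‖) := by positivity
        linarith
      · exact hyc h
    · simp only [add_sub_cancel_left]
      rw [norm_smul, smul_smul, Real.norm_of_nonneg (by positivity)]
      have : r / (1 + 1 / (r - ‖y - c‖) * ‖y - c‖) * (1 / (r - ‖y - c‖)) = 1 := by
        field_simp
        have : r - ‖y - c‖ + ‖y - c‖ = r := by ring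
        rw [this]
      rw [this, one_smul]; abel
  · rintro ⟨x, hx, rfl⟩
    have hx : x - c ≠ 0 := sub_ne_zero.2 hx
    have hx' : 0 < ‖x - c‖ := norm_pos_iff.2 hx
    refine ⟨?_, ?_⟩
    · simp only [Metric.mem_ball, dist_eq_norm, add_sub_cancel_left, norm_smul]
      rw [Real.norm_of_nonneg (by positivity), div_mul_eq_mul_div, div_lt_iff₀ (by positivity)]
      nlinarith
    · intro h
      have h : (r / (1 + ‖x - c‖)) • (x - c) = 0 := by simpa using h
      rcases smul_eq_zero.1 h with h | h
      · have : 0 < r / (1 + ‖x - c‖) := by positivity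
        linarith
      · exact hx h

theorem point_removal_aux {V : Set E} (hVo : IsOpen V)
    (hV : IsPreconnected V) {c : E} {r : ℝ} (hr : 0 < r) (hb : Metric.ball c r ⊆ V)
    (hc : c ∈ V)
    {u v : Set E} (hu : IsOpen u) (hv : IsOpen v) (hcov : V \ {c} ⊆ u ∪ v)
    (hdis : ¬ ((V \ {c}) ∩ (u ∩ v)).Nonempty) (hbu : Metric.ball c r \ {c} ⊆ u) :
    V \ {c} ⊆ u := by
  intro x hx
  by_contra hxu
  have hxv := (hcov hx).resolve_left hxu
  have hW : IsOpen (V \ {c}) := hVo.sdiff isClosed_singleton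
  obtain ⟨z, -, hz1, hz2⟩ := hV ((V \ {c}) ∩ u ∪ Metric.ball c r) ((V \ {c}) ∩ v)
    ((hW.inter hu).union Metric.isOpen_ball) (hW.inter hv) (by
      intro y hy
      by_cases hyc : y = c
      · left; right; rw [hyc]; exact Metric.mem_ball_self hr
      · rcases hcov ⟨hy, hyc⟩ with h | h
        · exact Or.inl (Or.inl ⟨⟨hy, hyc⟩, h⟩)
        · exact Or.inr ⟨⟨hy, hyc⟩, h⟩) ⟨c, hc, Or.inr (Metric.mem_ball_self hr)⟩ ⟨x, hx.1, hx, hxv⟩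
  rcases hz1 with h | h
  · exact hdis ⟨z, h.1, h.2, hz2.2⟩
  · exact hdis ⟨z, hz2.1, hbu ⟨h, hz2.1.2⟩, hz2.2⟩

theorem point_removal (h2 : 1 < Module.rank ℝ E) {V : Set E} (hVo : IsOpen V)
    (hV : IsPreconnected V) (c : E) : IsPreconnected (V \ {c}) := by
  by_cases hc : c ∈ V
  swap
  · rwa [sdiff_singleton_eq_self hc]
  obtain ⟨r, hr, hb⟩ := Metric.isOpen_iff.1 hVo c hc
  intro u v hu hv hcov hxu hxv
  by_contra hdis
  obtain ⟨x, hx, hxu⟩ := hxu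
  obtain ⟨x', hx', hxv'⟩ := hxv
  have hbW : Metric.ball c r \ {c} ⊆ V \ {c} := sdiff_subset_sdiff_left hb
  have hbp := ball_punctured_preconnected h2 c hr
  by_cases hbu : Metric.ball c r \ {c} ⊆ u
  · exact hdis ⟨x', hx', point_removal_aux hVo hV hr hb hc hu hv hcov hdis hbu hx', hxv'⟩
  · obtain ⟨y, hy, hyu⟩ := not_subset.1 hbu
    have hyv := (hcov (hbW hy)).resolve_left hyu
    have hbv : Metric.ball c r \ {c} ⊆ v := fun z hz =>
      sub_of_meets hv hu (by rwa [union_comm]) (by rwa [inter_comm v u]) hbp hbW hy hyv hz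
    exact hdis ⟨x, hx, hxu, point_removal_aux hVo hV hr hb hc hv hu (by rwa [union_comm])
      (by rwa [inter_comm v u]) hbv hx⟩

/-- Removing a convex body after a slit. -/
theorem body_removal {V B S : Set E} {c : E} (hV : IsOpen V) (hVn : Vᶜ.Nonempty)
    (hBc : Convex ℝ B) (hBk : IsCompact B) (hc : c ∈ interior B) (hcS : c ∈ S) (hSB : S ⊆ B)
    (hVS : IsPreconnected (V \ S))
    (he : ∀ x ∈ B \ S, c + (gauge ((fun y => c + y) ⁻¹' B) (x - c))⁻¹ • (x - c) ∈ V) :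
    IsPreconnected (V \ B) := by
  set B0 := (fun y => c + y) ⁻¹' B with hB0
  have hB0c : Convex ℝ B0 := hBc.translate_preimage_right c
  have hB0n : B0 ∈ 𝓝 (0:E) := by
    have hcont : Continuous (fun y : E => c + y) := by fun_prop
    apply hcont.continuousAt
    change B ∈ 𝓝 (c + 0)
    rw [add_zero]
    exact mem_interior_iff_mem_nhds.1 hc
  have hB0cl : IsClosed B0 := hBk.isClosed.preimage (by fun_prop)
  have hB0b : Bornology.IsVonNBounded ℝ B0 := by
    rw [NormedSpace.isVonNBounded_iff]
    have h1 : B0 = (fun y => -c + y) '' B := by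
      ext y; simp [hB0, add_comm]
    rw [h1]
    exact (hBk.image (by fun_prop)).isBounded
  have habs : Absorbent ℝ B0 := absorbent_nhds_zero hB0n
  let g : E → ℝ := fun x => gauge B0 (x - c)
  have hgc : Continuous g := (continuous_gauge hB0c hB0n).comp (by fun_prop)
  have hgB : ∀ x, x ∈ B ↔ g x ≤ 1 := by
    intro x
    change _ ↔ gauge B0 (x - c) ≤ 1
    rw [gauge_le_one_iff_mem_closure hB0c hB0n, hB0cl.closure_eq]
    simp [hB0]
  have hgpos : ∀ x, x ≠ c → 0 < g x := fun x hx =>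
    (gauge_pos habs hB0b).2 (sub_ne_zero.2 hx)
  have hgs : ∀ (s : ℝ) (x : E), 0 ≤ s → g (c + s • (x - c)) = s * g x := by
    intro s x hs
    change gauge B0 _ = s * gauge B0 _
    rw [add_sub_cancel_left, gauge_smul_of_nonneg hs, smul_eq_mul]
  let e : E → E := fun x => c + (g x)⁻¹ • (x - c)
  let δ : E → ℝ := fun x => Metric.infDist (e x) Vᶜ / (2 * (1 + ‖e x - c‖))
  let m : E → ℝ := fun x => max 1 ((1 + δ x) / g x)
  let ρ : E → E := fun x => c + m x • (x - c)
  have hδ0 : ∀ x, 0 ≤ δ x := fun x => by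
    have := Metric.infDist_nonneg (x := e x) (s := Vᶜ)
    positivity
  have hec : ContinuousOn e {c}ᶜ := by
    have : ∀ x ∈ ({c}ᶜ : Set E), g x ≠ 0 := fun x hx => (hgpos x hx).ne'
    exact continuousOn_const.add ((hgc.continuousOn.inv₀ this).smul (by fun_prop))
  have hδc : ContinuousOn δ {c}ᶜ := by
    refine ContinuousOn.div ((Metric.continuous_infDist_pt _).comp_continuousOn hec) ?_ ?_
    · exact continuousOn_const.mul (continuousOn_const.add
        ((hec.sub continuousOn_const).norm))
    · intro x _; positivity
  have hρc : ContinuousOn ρ {c}ᶜ := by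
    have : ∀ x ∈ ({c}ᶜ : Set E), g x ≠ 0 := fun x hx => (hgpos x hx).ne'
    refine continuousOn_const.add (ContinuousOn.smul ?_ (by fun_prop))
    exact ContinuousOn.sup continuousOn_const ((continuousOn_const.add hδc).div hgc.continuousOn this)
  have hSc : V \ S ⊆ {c}ᶜ := fun x hx h => hx.2 (by rw [mem_singleton_iff.1 h]; exact hcS)
  -- key: small radial extension from e stays in V
  have key : ∀ x, e x ∈ V → ∀ s : ℝ, 1 ≤ s → s ≤ 1 + δ x → c + s • (e x - c) ∈ V := by
    intro x hx s h1 h2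
    by_contra hcon
    have hle := Metric.infDist_le_dist_of_mem (x := e x) (s := Vᶜ) hcon
    have hd : dist (e x) (c + s • (e x - c)) ≤ δ x * ‖e x - c‖ := by
      rw [dist_comm, dist_eq_norm]
      have : c + s • (e x - c) - e x = (s - 1) • (e x - c) := by module
      rw [this, norm_smul, Real.norm_of_nonneg (by linarith)]
      gcongr; linarith
    have hpos : 0 < Metric.infDist (e x) Vᶜ := by
      rw [← hV.isClosed_compl.notMem_iff_infDist_pos hVn]
      exact fun h => h hx
    have : δ x * ‖e x - c‖ < Metric.infDist (e x) Vᶜ := by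
      change Metric.infDist (e x) Vᶜ / (2 * (1 + ‖e x - c‖)) * ‖e x - c‖ < _
      rw [div_mul_eq_mul_div, div_lt_iff₀ (by positivity)]
      have := norm_nonneg (e x - c)
      nlinarith
    linarith
  have hxe : ∀ x, x ≠ c → ∀ t : ℝ, c + t • (x - c) = c + (t * g x) • (e x - c) := by
    intro x hx t
    have := (hgpos x hx).ne'
    simp only [e, add_sub_cancel_left, smul_smul]
    rw [mul_assoc, mul_inv_cancel₀ this, mul_one]
  -- radial segment for x outside B
  have hrad : ∀ x ∈ V \ B, ∀ t : ℝ, 1 ≤ t → t ≤ m x → c + t • (x - c) ∈ V \ B := by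
    intro x hx t h1 h2
    have hxc : x ≠ c := fun h => hx.2 (by rw [h]; exact interior_subset hc)
    have hg1 : 1 < g x := by
      have := hx.2; rw [hgB] at this; exact not_le.1 this
    refine ⟨?_, ?_⟩
    · rcases eq_or_lt_of_le h1 with h | h
      · rw [← h, one_smul]; simpa using hx.1
      have hm : m x = (1 + δ x) / g x := by
        rcases max_choice 1 ((1 + δ x) / g x) with h3 | h3
        · have : m x = 1 := h3
          linarith
        · exact h3
      have h4 : t * g x ≤ 1 + δ x := by
        rw [hm, le_div_iff₀ (by linarith)] at h2; exact h2
      have h5 : 1 < t * g x := by nlinarith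
      have hev : e x ∈ V := by
        by_contra hcon
        have : δ x = 0 := by
          change Metric.infDist (e x) Vᶜ / _ = 0
          rw [Metric.infDist_zero_of_mem hcon, zero_div]
        linarith
      rw [hxe x hxc]
      exact key x hev _ h5.le h4
    · rw [hgB, hgs _ _ (by linarith)]
      push Not
      nlinarith
  have hm1 : ∀ x, 1 ≤ m x := fun x => le_max_left _ _
  have hρ : ∀ x ∈ V \ S, ρ x ∈ V \ B := by
    intro x hx
    by_cases hxB : x ∈ B
    · have hxc : x ≠ c := hSc hx
      have hev : e x ∈ V := he x ⟨hxB, hx.2⟩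
      have hg0 := hgpos x hxc
      have hg1 : g x ≤ 1 := (hgB x).1 hxB
      have hm : m x = (1 + δ x) / g x := max_eq_right (by
        rw [le_div_iff₀ hg0]; linarith [hδ0 x])
      have hmg : m x * g x = 1 + δ x := by rw [hm, div_mul_cancel₀ _ hg0.ne']
      have hδpos : 0 < δ x := by
        have hpos : 0 < Metric.infDist (e x) Vᶜ := by
          rw [← hV.isClosed_compl.notMem_iff_infDist_pos hVn]
          exact fun h => h hev
        change 0 < Metric.infDist (e x) Vᶜ / (2 * (1 + ‖e x - c‖))
        positivity
      refine ⟨?_, ?_⟩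
      · change c + m x • (x - c) ∈ V
        rw [hxe x hxc, hmg]
        exact key x hev _ (by linarith) le_rfl
      · rw [hgB]
        change ¬ g (c + m x • (x - c)) ≤ 1
        rw [hgs _ _ (by linarith [hm1 x]), hmg]
        linarith
    · exact hrad x ⟨hx.1, hxB⟩ _ (hm1 x) le_rfl
  have hP : IsPreconnected (ρ '' (V \ S)) := hVS.image _ (hρc.mono hSc)
  have hPs : ρ '' (V \ S) ⊆ V \ B := by
    rintro _ ⟨x, hx, rfl⟩; exact hρ x hx
  have hBS : V \ B ⊆ V \ S := sdiff_subset_sdiff_right hSB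
  rcases (V \ B).eq_empty_or_nonempty with h | ⟨x0, hx0⟩
  · rw [h]; exact isPreconnected_empty
  refine isPreconnected_of_forall (ρ x0) fun y hy => ?_
  refine ⟨ρ '' (V \ S) ∪ (fun t : ℝ => c + t • (y - c)) '' Icc 1 (m y), ?_, ?_, ?_, ?_⟩
  · refine union_subset hPs ?_
    rintro _ ⟨t, ht, rfl⟩
    exact hrad y hy t ht.1 ht.2
  · exact Or.inl ⟨x0, hBS hx0, rfl⟩
  · exact Or.inr ⟨1, ⟨le_rfl, hm1 y⟩, by simp⟩
  · refine IsPreconnected.union (ρ y) ⟨y, hBS hy, rfl⟩ ⟨m y, ⟨hm1 y, le_rfl⟩, rfl⟩ hP ?_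
    exact isPreconnected_Icc.image _ (by fun_prop)

end topo2

end partf

section partg

theorem janiszewski {P Q : Set ℂ} (hP : IsOpen P) (hQ : IsOpen Q) (hPc : IsPreconnected P)
    (hQc : IsPreconnected Q) (hPQ : P ∪ Q = univ) : IsPreconnected (P ∩ Q) := by
  classical
  intro u v hu hv hcov ⟨a, ha, hau⟩ ⟨a', ha', hav'⟩
  by_contra hdis
  obtain ⟨η, h0, h1, -⟩ := exists_continuous_zero_one_of_isClosed (hQ.isClosed_compl)
    (hP.isClosed_compl) (by
      rw [disjoint_left]
      intro x hx hx'
      have : x ∈ P ∪ Q := by rw [hPQ]; trivial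
      exact this.elim hx' hx)
  set A := P ∩ Q ∩ u with hA
  have hAo : IsOpen A := (hP.inter hQ).inter hu
  set A' := P ∩ Q ∩ v with hA'
  have hAo' : IsOpen A' := (hP.inter hQ).inter hv
  have hAA' : ∀ x ∈ A', x ∉ A := fun x hx hx' => hdis ⟨x, hx.1, hx'.2, hx.2⟩
  have hcont : ∀ (κ : ℂ → ℝ), Continuous κ → ∀ z, (z ∈ P ∩ Q ∨ κ z = 0) →
      ContinuousAt (fun w => if w ∈ A then κ w else 0) z := by
    intro κ hκ z hz
    by_cases hzPQ : z ∈ P ∩ Q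
    · rcases hcov hzPQ with h | h
      · have : (fun w => if w ∈ A then κ w else 0) =ᶠ[𝓝 z] κ := by
          filter_upwards [hAo.mem_nhds ⟨hzPQ, h⟩] with w hw
          simp [hw]
        exact (hκ.continuousAt).congr this.symm
      · have : (fun w => if w ∈ A then κ w else 0) =ᶠ[𝓝 z] fun _ => 0 := by
          filter_upwards [hAo'.mem_nhds ⟨hzPQ, h⟩] with w hw
          simp [hAA' w hw]
        exact continuousAt_const.congr this.symm
    · have hz0 : κ z = 0 := hz.resolve_left hzPQ
      have hzA : z ∉ A := fun h => hzPQ h.1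
      have hk : Filter.Tendsto κ (𝓝 z) (𝓝 0) := hz0 ▸ hκ.tendsto z
      unfold ContinuousAt
      simp only [if_neg hzA]
      rw [tendsto_zero_iff_norm_tendsto_zero] at hk ⊢
      refine squeeze_zero (fun w => norm_nonneg _) (fun w => ?_) hk
      split_ifs
      · exact le_rfl
      · simp
  let κ1 : ℂ → ℝ := fun w => 2 * Real.pi * η w
  let κ2 : ℂ → ℝ := fun w => 2 * Real.pi * (η w - 1)
  have hκ1 : Continuous κ1 := by fun_prop
  have hκ2 : Continuous κ2 := by fun_prop
  let θ1 : ℂ → ℝ := fun w => if w ∈ A then κ1 w else 0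
  let θ2 : ℂ → ℝ := fun w => if w ∈ A then κ2 w else 0
  have hθ1 : ∀ z ∈ P, ContinuousAt θ1 z := by
    intro z hz
    refine hcont κ1 hκ1 z ?_
    by_cases hq : z ∈ Q
    · exact Or.inl ⟨hz, hq⟩
    · right; simp only [κ1]; rw [h0 hq]; simp
  have hθ2 : ∀ z ∈ Q, ContinuousAt θ2 z := by
    intro z hz
    refine hcont κ2 hκ2 z ?_
    by_cases hq : z ∈ P
    · exact Or.inl ⟨hq, hz⟩
    · right; simp only [κ2]; rw [h1 hq]; simp
  have hexp : ∀ z, Circle.exp (θ1 z) = Circle.exp (θ2 z) := by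
    intro z
    simp only [θ1, θ2]
    split_ifs
    · rw [Circle.exp_eq_exp]
      exact ⟨1, by simp only [κ1, κ2]; push_cast; ring⟩
    · rfl
  have hg : Continuous (fun z => Circle.exp (θ1 z)) := by
    rw [continuous_iff_continuousAt]
    intro z
    have : z ∈ P ∪ Q := by rw [hPQ]; trivial
    rcases this with h | h
    · exact Circle.exp.continuous.continuousAt.comp (hθ1 z h)
    · simp only [hexp]
      exact Circle.exp.continuous.continuousAt.comp (hθ2 z h)
  obtain ⟨φ, ⟨-, hφ⟩, -⟩ := Circle.isCoveringMap_exp.existsUnique_continuousMap_lifts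
    (⟨_, hg⟩ : C(ℂ, Circle)) 0 (θ1 0) rfl
  have hφ' : ∀ z, Circle.exp (φ z) = Circle.exp (θ1 z) := fun z => congrFun hφ z
  have hconst : ∀ (R : Set ℂ) (θ : ℂ → ℝ), IsPreconnected R → (∀ z ∈ R, ContinuousAt θ z) →
      (∀ z, Circle.exp (θ1 z) = Circle.exp (θ z)) → a ∈ R → a' ∈ R →
      φ a - θ a = φ a' - θ a' := by
    intro R θ hR hθ he haR haR'
    have him : IsPreconnected ((fun z => φ z - θ z) '' R) :=
      hR.image _ (φ.continuous.continuousOn.sub fun z hz => (hθ z hz).continuousWithinAt)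
    have hsub : (fun z => φ z - θ z) '' R ⊆ range (fun n : ℤ => (n:ℝ) * (2 * Real.pi)) := by
      rintro _ ⟨z, _, rfl⟩
      obtain ⟨m, hm⟩ := Circle.exp_eq_exp.1 ((hφ' z).trans (he z))
      exact ⟨m, by simp only; rw [hm]; ring⟩
    exact (countable_range _).isTotallyDisconnected _ hsub him
      ⟨a, haR, rfl⟩ ⟨a', haR', rfl⟩
  have e1 := hconst P θ1 hPc hθ1 (fun _ => rfl) ha.1 ha'.1
  have e2 := hconst Q θ2 hQc hθ2 hexp ha.2 ha'.2
  have haA : a ∈ A := ⟨ha, hau⟩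
  have haA' : a' ∉ A := hAA' a' ⟨ha', hav'⟩
  simp only [θ1, θ2, if_pos haA, if_neg haA', κ1, κ2] at e1 e2
  have := Real.pi_pos
  linarith

theorem inv_open_aux {P : Set ℂ} (hP : IsOpen P) (hb : Bornology.IsBounded Pᶜ) :
    IsOpen {w : ℂ | w = 0 ∨ 1 + w⁻¹ ∈ P} := by
  rw [isOpen_iff_mem_nhds]
  intro w hw
  by_cases hw0 : w = 0
  · subst hw0
    have h1 : Filter.Tendsto (fun w : ℂ => 1 + w⁻¹) (𝓝[≠] 0) (Bornology.cobounded ℂ) :=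
      (tendsto_const_add_cobounded (1:ℂ)).comp Filter.tendsto_inv₀_nhdsNE_zero
    have h2 : P ∈ Bornology.cobounded ℂ := by
      have := Bornology.isCobounded_compl_iff.2 hb
      rwa [compl_compl] at this
    have h3 := h1.eventually h2
    rw [eventually_nhdsWithin_iff] at h3
    filter_upwards [h3] with x hx
    by_cases h : x = 0
    · exact Or.inl h
    · exact Or.inr (hx h)
  · have hc : ContinuousAt (fun w : ℂ => 1 + w⁻¹) w :=
      continuousAt_const.add (continuousAt_inv₀ hw0)
    have hwP : 1 + w⁻¹ ∈ P := hw.resolve_left hw0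
    filter_upwards [hc.eventually (hP.mem_nhds hwP)] with x hx
    exact Or.inr hx

theorem inv_conn_aux {P : Set ℂ} (hP : IsOpen P) (hb : Bornology.IsBounded Pᶜ)
    (hPc : IsPreconnected P) (h1 : (1:ℂ) ∉ P) :
    IsPreconnected {w : ℂ | w = 0 ∨ 1 + w⁻¹ ∈ P} := by
  have him : IsPreconnected ((fun z : ℂ => (z - 1)⁻¹) '' P) := by
    refine hPc.image _ (ContinuousOn.inv₀ (by fun_prop) ?_)
    intro x hx h
    exact h1 (sub_eq_zero.1 h ▸ hx)
  have hsub : (fun z : ℂ => (z - 1)⁻¹) '' P ⊆ {w : ℂ | w = 0 ∨ 1 + w⁻¹ ∈ P} := by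
    rintro _ ⟨z, hz, rfl⟩
    right
    simpa using hz
  refine him.subset_closure hsub ?_
  intro w hw
  have hmem : ∀ x ∈ {w : ℂ | w = 0 ∨ 1 + w⁻¹ ∈ P}, x ≠ 0 → x ∈ (fun z : ℂ => (z - 1)⁻¹) '' P := by
    intro x hx hx0
    exact ⟨1 + x⁻¹, hx.resolve_left hx0, by simp⟩
  by_cases hw0 : w = 0
  · subst hw0
    rw [mem_closure_iff_nhds]
    intro t ht
    have h3 : t ∩ {w : ℂ | w = 0 ∨ 1 + w⁻¹ ∈ P} ∈ 𝓝 (0:ℂ) :=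
      Filter.inter_mem ht ((inv_open_aux hP hb).mem_nhds (Or.inl rfl))
    have h4 : ∀ᶠ x in 𝓝[≠] (0:ℂ), x ∈ t ∩ {w : ℂ | w = 0 ∨ 1 + w⁻¹ ∈ P} :=
      nhdsWithin_le_nhds h3
    obtain ⟨x, hx, hx0⟩ := (h4.and self_mem_nhdsWithin).exists
    exact ⟨x, hx.1, hmem x hx.2 hx0⟩
  · exact subset_closure (hmem w hw hw0)

theorem rank_complex : 1 < Module.rank ℝ ℂ := by
  rw [Complex.rank_real_complex]; norm_num

theorem join_planar {Y1 Y2 : Set ℂ} (h1 : IsCompact Y1) (h2 : IsCompact Y2)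
    (hc1 : IsPreconnected Y1ᶜ) (hc2 : IsPreconnected Y2ᶜ) (hd : Disjoint Y1 Y2)
    (m0 : (0:ℂ) ∈ Y1) (m1 : (1:ℂ) ∈ Y2)
    (hs : ∀ x ∈ segment ℝ (0:ℂ) 1, x ≠ 0 → x ≠ 1 → x ∉ Y1 ∧ x ∉ Y2) :
    IsPreconnected ((Y1 ∪ Y2) ∪ segment ℝ (0:ℂ) 1)ᶜ := by
  have hPc : IsPreconnected (Y1ᶜ \ segment ℝ (0:ℂ) 1) := by
    refine slit_preconnected rank_complex h1.isClosed.isOpen_compl hc1 (by simpa using m0)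
      zero_ne_one ?_
    intro x hx hx0
    by_cases hx1 : x = 1
    · rw [hx1]; exact fun h => disjoint_left.1 hd h m1
    · exact (hs x hx hx0 hx1).1
  set P := Y1ᶜ \ segment ℝ (0:ℂ) 1 with hP
  have hPo : IsOpen P := h1.isClosed.isOpen_compl.sdiff (isCompact_seg _ _).isClosed
  set Q := Y2ᶜ with hQ
  have hQo : IsOpen Q := h2.isClosed.isOpen_compl
  have hPb : Bornology.IsBounded Pᶜ := by
    have : Pᶜ = Y1 ∪ segment ℝ (0:ℂ) 1 := by
      rw [hP, sdiff_eq, compl_inter, compl_compl, compl_compl]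
    rw [this]; exact (h1.union (isCompact_seg _ _)).isBounded
  have hQb : Bornology.IsBounded Qᶜ := by rw [hQ, compl_compl]; exact h2.isBounded
  have hP1 : (1:ℂ) ∉ P := fun h => h.2 (right_mem_segment ℝ _ _)
  have hQ1 : (1:ℂ) ∉ Q := fun h => h m1
  have hJ := janiszewski (inv_open_aux hPo hPb) (inv_open_aux hQo hQb)
    (inv_conn_aux hPo hPb hPc hP1) (inv_conn_aux hQo hQb hc2 hQ1) (by
      rw [eq_univ_iff_forall]
      intro w
      by_cases hw : w = 0
      · exact Or.inl (Or.inl hw)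
      by_cases hwQ : 1 + w⁻¹ ∈ Q
      · exact Or.inr (Or.inr hwQ)
      · left; right
        have hwY : 1 + w⁻¹ ∈ Y2 := by simpa [hQ] using hwQ
        refine ⟨fun h => disjoint_left.1 hd h hwY, fun hseg => ?_⟩
        have hne1 : 1 + w⁻¹ ≠ 1 := by simpa using hw
        have hne0 : 1 + w⁻¹ ≠ 0 := fun h => disjoint_left.1 hd (h ▸ m0) hwY
        exact (hs _ hseg hne0 hne1).2 hwY)
  have hR := point_removal rank_complex ((inv_open_aux hPo hPb).inter (inv_open_aux hQo hQb)) hJ 0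
  have him := hR.image (fun w : ℂ => 1 + w⁻¹) (continuousOn_const.add
    (continuousOn_id.inv₀ fun x hx => hx.2))
  convert him using 1
  ext z
  constructor
  · intro hz
    have hz1 : z ≠ 1 := fun h => hz (Or.inl (Or.inr (h ▸ m1)))
    have hzP : z ∈ P := ⟨fun h => hz (Or.inl (Or.inl h)), fun h => hz (Or.inr h)⟩
    have hzQ : z ∈ Q := fun h => hz (Or.inl (Or.inr h))
    have : z - 1 ≠ 0 := sub_ne_zero.2 hz1
    refine ⟨(z-1)⁻¹, ⟨⟨Or.inr ?_, Or.inr ?_⟩, by simpa using this⟩, by simp⟩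
    · simpa using hzP
    · simpa using hzQ
  · rintro ⟨w, ⟨⟨hw1, hw2⟩, hw0⟩, rfl⟩
    have h3 := hw1.resolve_left hw0
    have h4 := hw2.resolve_left hw0
    rintro ((h | h) | h)
    · exact h3.1 h
    · exact h4 h
    · exact h3.2 h


end partg

section parth

/-- Correct a polynomial `k` that is small on the common zero set of the `ℓ j` in `X`. -/
theorem ideal_correct {N : ℕ} {X : Set (Fin N → ℂ)} (hX : IsCompact X) (hP : PolyEqContinuous X)
    (k : MvPolynomial (Fin N) ℂ) (l : Fin N → MvPolynomial (Fin N) ℂ) {ε : ℝ} (hε : 0 < ε)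
    (hk : ∀ z ∈ X, (∀ j, eval z (l j) = 0) → ‖eval z k‖ < ε) :
    ∃ P : Fin N → MvPolynomial (Fin N) ℂ,
      ∀ z ∈ X, ‖eval z (k + ∑ j, l j * P j)‖ < 2 * ε := by
  let L : (Fin N → ℂ) → ℝ := fun z => ∑ j, ‖eval z (l j)‖ ^ 2
  have hLc : Continuous L := by
    refine continuous_finsetSum _ fun j _ => ((continuous_eval_mv (l j)).norm.pow 2)
  have hL0 : ∀ z, 0 ≤ L z := fun z => Finset.sum_nonneg fun j _ => by positivity
  have hkc : Continuous fun z : Fin N → ℂ => eval z k := continuous_eval_mv k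
  have hLdef : ∀ z, L z = ∑ j, ‖eval z (l j)‖ ^ 2 := fun z => rfl
  have hLz : ∀ z, L z = 0 → ∀ j, eval z (l j) = 0 := by
    intro z hz j
    have := (Finset.sum_eq_zero_iff_of_nonneg (fun j _ => by positivity)).1 hz j (Finset.mem_univ j)
    simpa using this
  clear_value L
  obtain ⟨σ, hσ, hσX⟩ : ∃ σ > 0, ∀ z ∈ X, ‖eval z k‖ * (σ / (L z + σ)) < ε := by
    let X' := X ∩ {z | ε ≤ ‖eval z k‖}
    have hX' : IsCompact X' := hX.inter_right (isClosed_le continuous_const hkc.norm)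
    rcases X'.eq_empty_or_nonempty with h | h
    · refine ⟨1, one_pos, fun z hz => ?_⟩
      have h1 : ‖eval z k‖ < ε := by
        by_contra hcon
        have : z ∈ X' := ⟨hz, not_lt.1 hcon⟩
        rw [h] at this; exact this
      have : 1 / (L z + 1) ≤ 1 := by
        rw [div_le_one (by linarith [hL0 z])]; linarith [hL0 z]
      nlinarith [norm_nonneg (eval z k)]
    · obtain ⟨zm, hzm, hmin⟩ := hX'.exists_isMinOn h hLc.continuousOn
      obtain ⟨zM, hzM, hmax⟩ := hX'.exists_isMaxOn h hkc.norm.continuousOn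
      have hm : 0 < L zm := by
        rcases eq_or_lt_of_le (hL0 zm) with h0 | h0
        · have := hk zm hzm.1 (hLz zm h0.symm)
          exact absurd hzm.2 (not_le.2 this)
        · exact h0
      have hM : 0 < ‖eval zM k‖ := lt_of_lt_of_le hε hzM.2
      refine ⟨ε * L zm / (2 * ‖eval zM k‖), div_pos (mul_pos hε hm) (by linarith), fun z hz => ?_⟩
      set σ := ε * L zm / (2 * ‖eval zM k‖) with hσ
      have hσ0 : 0 < σ := div_pos (mul_pos hε hm) (by linarith)
      by_cases hz' : z ∈ X'
      · have h1 : L zm ≤ L z := hmin hz'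
        have h2 : ‖eval z k‖ ≤ ‖eval zM k‖ := hmax hz'
        rw [← mul_div_assoc, div_lt_iff₀ (by linarith)]
        have : ‖eval z k‖ * σ ≤ ε * L zm / 2 := by
          calc _ ≤ ‖eval zM k‖ * σ := by gcongr
            _ = _ := by rw [hσ]; field_simp
        nlinarith
      · have h1 : ‖eval z k‖ < ε := by
          by_contra hcon
          exact hz' ⟨hz, not_lt.1 hcon⟩
        have : σ / (L z + σ) ≤ 1 := by
          rw [div_le_one (by linarith [hL0 z])]; linarith [hL0 z]
        have h0 : 0 ≤ σ / (L z + σ) := div_nonneg hσ0.le (by linarith [hL0 z])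
        nlinarith [norm_nonneg (eval z k)]
  -- bound on the l j
  obtain ⟨M, hM⟩ : ∃ M, ∀ z ∈ X, ∑ j, ‖eval z (l j)‖ ≤ M := by
    have : Continuous fun z : Fin N → ℂ => ∑ j, ‖eval z (l j)‖ :=
      continuous_finsetSum _ fun j _ => (continuous_eval_mv (l j)).norm
    obtain ⟨M, hM⟩ := (hX.image this).isBounded.subset_closedBall 0
    refine ⟨M, fun z hz => ?_⟩
    have := hM ⟨z, hz, rfl⟩
    rw [Metric.mem_closedBall, dist_zero_right, Real.norm_eq_abs] at this
    exact (le_abs_self _).trans this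
  have hM' : 0 < |M| + 1 := by positivity
  have hden : ∀ z, ((L z + σ : ℝ) : ℂ) ≠ 0 := fun z => by
    exact_mod_cast (by linarith [hL0 z] : L z + σ ≠ 0)
  have happ : ∀ j, ∃ p : MvPolynomial (Fin N) ℂ, ∀ z ∈ X,
      ‖(-(eval z k) * (starRingEnd ℂ) (eval z (l j)) / ((L z + σ : ℝ) : ℂ)) - eval z p‖
        < ε / (|M| + 1) := by
    intro j
    refine hP _ ?_ _ (by positivity)
    refine Continuous.continuousOn ?_
    refine Continuous.div ?_ ?_ hden
    · exact hkc.neg.mul (Complex.continuous_conj.comp (continuous_eval_mv (l j)))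
    · exact Complex.continuous_ofReal.comp (hLc.add continuous_const)
  choose P hPP using happ
  refine ⟨P, fun z hz => ?_⟩
  have hid : eval z k + ∑ j, eval z (l j) *
      (-(eval z k) * (starRingEnd ℂ) (eval z (l j)) / ((L z + σ : ℝ) : ℂ))
      = eval z k * ((σ / (L z + σ) : ℝ) : ℂ) := by
    have h1 : ∑ j, eval z (l j) *
      (-(eval z k) * (starRingEnd ℂ) (eval z (l j)) / ((L z + σ : ℝ) : ℂ))
      = -(eval z k) / ((L z + σ : ℝ) : ℂ) * (L z : ℂ) := by
      rw [show (∑ j, eval z (l j) *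
      (-(eval z k) * (starRingEnd ℂ) (eval z (l j)) / ((L z + σ : ℝ) : ℂ))) = _ from rfl]
      generalize ((L z + σ : ℝ) : ℂ) = den
      rw [hLdef, Complex.ofReal_sum, Finset.mul_sum]
      refine Finset.sum_congr rfl fun j _ => ?_
      have : ((‖eval z (l j)‖ ^ 2 : ℝ) : ℂ) = eval z (l j) * (starRingEnd ℂ) (eval z (l j)) := by
        rw [Complex.mul_conj, Complex.normSq_eq_norm_sq]
      rw [this]; ring
    rw [h1]
    have h2 := hden z
    rw [Complex.ofReal_div]
    field_simp
    push_cast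
    ring
  have hsplit : eval z (k + ∑ j, l j * P j) = eval z k * ((σ / (L z + σ) : ℝ) : ℂ)
      - ∑ j, eval z (l j) * ((-(eval z k) * (starRingEnd ℂ) (eval z (l j)) /
        ((L z + σ : ℝ) : ℂ)) - eval z (P j)) := by
    rw [← hid]
    simp only [map_add, map_sum, map_mul, mul_sub, Finset.sum_sub_distrib]
    ring
  rw [hsplit]
  have h1 : ‖eval z k * ((σ / (L z + σ) : ℝ) : ℂ)‖ < ε := by
    rw [norm_mul, Complex.norm_real, Real.norm_of_nonneg
      (div_nonneg hσ.le (by linarith [hL0 z]))]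
    exact hσX z hz
  have h2 : ‖∑ j, eval z (l j) * ((-(eval z k) * (starRingEnd ℂ) (eval z (l j)) /
        ((L z + σ : ℝ) : ℂ)) - eval z (P j))‖ ≤ ε := by
    calc _ ≤ ∑ j, ‖eval z (l j)‖ * (ε / (|M| + 1)) := by
          refine (norm_sum_le _ _).trans (Finset.sum_le_sum fun j _ => ?_)
          rw [norm_mul]
          exact mul_le_mul_of_nonneg_left (hPP j z hz).le (norm_nonneg _)
      _ = (∑ j, ‖eval z (l j)‖) * (ε / (|M| + 1)) := by rw [Finset.sum_mul]
      _ ≤ (|M| + 1) * (ε / (|M| + 1)) := by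
          gcongr
          linarith [hM z hz, le_abs_self M]
      _ = ε := by field_simp
  calc _ ≤ _ := norm_sub_le _ _
    _ < 2 * ε := by linarith

theorem isCompact_slice {N : ℕ} {X : Set (Fin N → ℂ)} (hX : IsCompact X) (p v : Fin N → ℂ)
    (hv : v ≠ 0) : IsCompact {t : ℂ | p + t • v ∈ X} := by
  have hcl : IsClosedEmbedding (fun t : ℂ => p + t • v) :=
    (Homeomorph.addLeft p).isClosedEmbedding.comp (isClosedEmbedding_smul_left hv)
  exact hcl.isCompact_preimage hX

theorem eval_line {N : ℕ} (p v : Fin N → ℂ) (t : ℂ) (q : MvPolynomial (Fin N) ℂ) :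
    Polynomial.eval t (MvPolynomial.aeval (fun i => Polynomial.C (p i) +
      Polynomial.X * Polynomial.C (v i)) q) = eval (p + t • v) q := by
  induction q using MvPolynomial.induction_on with
  | C a => simp
  | add f g hf hg => simp only [map_add, Polynomial.eval_add, hf, hg]
  | mul_X f i hf => simp only [map_mul, Polynomial.eval_mul, hf, aeval_X]; simp; left; ring

theorem eval_comp_poly {N : ℕ} (k : Polynomial ℂ) (P : MvPolynomial (Fin N) ℂ) (z : Fin N → ℂ) :
    eval z (Polynomial.aeval P k) = Polynomial.eval (eval z P) k := by
  induction k using Polynomial.induction_on' with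
  | add f g hf hg => simp only [map_add, Polynomial.eval_add, hf, hg]
  | monomial n a => simp [Polynomial.aeval_monomial]

theorem PC_slice {N : ℕ} {X : Set (Fin N → ℂ)} (hX : IsCompact X) (hP : PolyEqContinuous X)
    (p v : Fin N → ℂ) (hv : v ≠ 0) : PC {t : ℂ | p + t • v ∈ X} := by
  obtain ⟨i0, hi0⟩ : ∃ i, v i ≠ 0 := Function.ne_iff.1 hv
  refine PC_of_conj (isCompact_slice hX p v hv) ?_
  intro δ hδ
  obtain ⟨q, hq⟩ := hP (fun z => (starRingEnd ℂ) ((z i0 - p i0) / v i0))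
    (Continuous.continuousOn (Complex.continuous_conj.comp (by fun_prop))) δ hδ
  refine ⟨MvPolynomial.aeval (fun i => Polynomial.C (p i) +
    Polynomial.X * Polynomial.C (v i)) q, fun t ht => ?_⟩
  rw [eval_line]
  have h1 := hq _ ht
  have h2 : ((p + t • v) i0 - p i0) / v i0 = t := by
    simp [hi0]
  rw [h2] at h1
  exact h1

theorem seg_mem_iff {N : ℕ} (p q z : Fin N → ℂ) :
    z ∈ segment ℝ p q ↔ ∃ t ∈ segment ℝ (0:ℂ) 1, z = p + t • (q - p) := by
  rw [segment_eq_image', segment_eq_image']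
  constructor
  · rintro ⟨θ, hθ, rfl⟩
    refine ⟨(θ : ℂ), ⟨θ, hθ, by simp⟩, ?_⟩
    ext i; simp
  · rintro ⟨_, ⟨θ, hθ, rfl⟩, rfl⟩
    refine ⟨θ, hθ, ?_⟩
    ext i; simp

/-- Lemma E -/
theorem seg_union_polyEq {N : ℕ} {X : Set (Fin N → ℂ)} (hX : IsCompact X)
    (hP : PolyEqContinuous X) {p q : Fin N → ℂ} (hpq : p ≠ q)
    (hPC : PC ({t : ℂ | p + t • (q - p) ∈ X} ∪ segment ℝ (0:ℂ) 1)) :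
    PolyEqContinuous (X ∪ segment ℝ p q) := by
  refine CP.polyEq (hX.union (isCompact_seg p q)) ?_
  set v := q - p with hv
  have hv0 : v ≠ 0 := sub_ne_zero.2 hpq.symm
  obtain ⟨i0, hi0⟩ : ∃ i, v i ≠ 0 := Function.ne_iff.1 hv0
  intro i δ hδ
  obtain ⟨p0, hp0⟩ := hP.cp i (δ/8) (by positivity)
  obtain ⟨k, hk⟩ := hPC (fun t => (starRingEnd ℂ) ((p + t • v) i) - eval (p + t • v) p0)
    (Continuous.continuousOn (by
      refine Continuous.sub (Complex.continuous_conj.comp ?_) ((continuous_eval_mv p0).comp ?_)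
      · simp only [Pi.add_apply, Pi.smul_apply]; fun_prop
      · fun_prop)) (δ/8) (by positivity)
  let T : MvPolynomial (Fin N) ℂ := (MvPolynomial.X i0 - C (p i0)) * C (v i0)⁻¹
  have hT : ∀ z : Fin N → ℂ, eval z T = (z i0 - p i0) * (v i0)⁻¹ := fun z => by simp [T]
  let l : Fin N → MvPolynomial (Fin N) ℂ := fun j =>
    MvPolynomial.X j - C (p j) - T * C (v j)
  have hl : ∀ (z : Fin N → ℂ) j, eval z (l j) = z j - p j - (eval z T) * v j :=
    fun z j => by simp [l]
  have hTl : ∀ t : ℂ, eval (p + t • v) T = t := fun t => by rw [hT]; simp [hi0]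
  obtain ⟨P, hPk⟩ := ideal_correct hX hP (Polynomial.aeval T k) l (ε := δ/4) (by positivity) (by
    intro z hz hzl
    rw [eval_comp_poly]
    have hzz : z = p + (eval z T) • v := by
      ext j
      have := hzl j
      rw [hl] at this
      simp only [Pi.add_apply, Pi.smul_apply, smul_eq_mul]
      linear_combination this
    have h1 := hk (eval z T) (Or.inl (by rw [mem_ofPred_eq, ← hzz]; exact hz))
    simp only at h1
    rw [← hzz] at h1
    have h2 := hp0 z hz
    set a := (starRingEnd ℂ) (z i)
    have : Polynomial.eval (eval z T) k = -((a - eval z p0 - Polynomial.eval (eval z T) k)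
      + (eval z p0 - a)) := by ring
    rw [this, norm_neg]
    refine (norm_add_le _ _).trans_lt (by linarith))
  refine ⟨p0 + (Polynomial.aeval T k + ∑ j, l j * P j), fun z hz => ?_⟩
  rcases hz with hz | hz
  · have h1 := hp0 z hz
    have h2 := hPk z hz
    rw [map_add]
    have : eval z p0 + eval z (Polynomial.aeval T k + ∑ j, l j * P j) - (starRingEnd ℂ) (z i)
      = (eval z p0 - (starRingEnd ℂ) (z i)) + eval z (Polynomial.aeval T k + ∑ j, l j * P j) := by
      ring
    rw [this]
    refine (norm_add_le _ _).trans_lt (by linarith)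
  · obtain ⟨t, ht, rfl⟩ := (seg_mem_iff p q z).1 hz
    rw [← hv]
    have h1 := hk t (Or.inr ht)
    simp only at h1
    have hl0 : ∀ j, eval (p + t • v) (l j) = 0 := by
      intro j
      rw [hl, hTl]; simp
    rw [map_add, map_add, map_sum, eval_comp_poly, hTl]
    simp only [map_mul, hl0, zero_mul, Finset.sum_const_zero, add_zero]
    rw [← norm_neg]
    have : -(eval (p + t • v) p0 + Polynomial.eval t k - (starRingEnd ℂ) ((p + t • v) i))
      = (starRingEnd ℂ) ((p + t • v) i) - eval (p + t • v) p0 - Polynomial.eval t k := by ring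
    rw [this]
    linarith

theorem volume_seg01 : volume (segment ℝ (0:ℂ) 1) = 0 := by
  have hsub : segment ℝ (0:ℂ) 1 ⊆ (Submodule.span ℝ {(1:ℂ)} : Set ℂ) := by
    rw [segment_eq_image']
    rintro _ ⟨θ, _, rfl⟩
    simp only [zero_add, sub_zero]
    exact Submodule.smul_mem _ _ (Submodule.mem_span_singleton_self _)
  refine measure_mono_null hsub (Measure.addHaar_submodule _ _ ?_)
  intro h
  have : Complex.I ∈ Submodule.span ℝ {(1:ℂ)} := by rw [h]; trivial
  obtain ⟨a, ha⟩ := Submodule.mem_span_singleton.1 this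
  have := congrArg Complex.im ha
  simp at this

theorem seg_union_of_conn {N : ℕ} {X : Set (Fin N → ℂ)} (hX : IsCompact X)
    (hP : PolyEqContinuous X) {p q : Fin N → ℂ} (hpq : p ≠ q)
    (hc : IsPreconnected ({t : ℂ | p + t • (q - p) ∈ X} ∪ segment ℝ (0:ℂ) 1)ᶜ) :
    PolyEqContinuous (X ∪ segment ℝ p q) := by
  have hv0 : q - p ≠ 0 := sub_ne_zero.2 hpq.symm
  exact seg_union_polyEq hX hP hpq ((PC_slice hX hP p _ hv0).union_null
    (isCompact_slice hX p _ hv0) (isCompact_seg _ _) volume_seg01 hc)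

theorem seg_mem_of_param {N : ℕ} {p q : Fin N → ℂ} {t : ℂ} (ht : t ∈ segment ℝ (0:ℂ) 1) :
    p + t • (q - p) ∈ segment ℝ p q := (seg_mem_iff p q _).2 ⟨t, ht, rfl⟩

theorem param_eq_start {N : ℕ} {p q : Fin N → ℂ} (hpq : p ≠ q) {t : ℂ}
    (h : p + t • (q - p) = p) : t = 0 := by
  have : t • (q - p) = 0 := by simpa using h
  exact (smul_eq_zero.1 this).resolve_right (sub_ne_zero.2 hpq.symm)

theorem param_eq_end {N : ℕ} {p q : Fin N → ℂ} (hpq : p ≠ q) {t : ℂ}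
    (h : p + t • (q - p) = q) : t = 1 := by
  have : (t - 1) • (q - p) = 0 := by
    rw [sub_smul, one_smul, sub_eq_zero]
    exact eq_sub_of_add_eq' h
  exact sub_eq_zero.1 ((smul_eq_zero.1 this).resolve_right (sub_ne_zero.2 hpq.symm))

/-- one-ended extension -/
theorem seg_one_ended {N : ℕ} {X : Set (Fin N → ℂ)} (hX : IsCompact X)
    (hP : PolyEqContinuous X) {p q : Fin N → ℂ} (hpq : p ≠ q) (hp : p ∈ X)
    (hd : ∀ z ∈ segment ℝ p q, z ∈ X → z = p) :
    PolyEqContinuous (X ∪ segment ℝ p q) := by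
  have hv0 : q - p ≠ 0 := sub_ne_zero.2 hpq.symm
  refine seg_union_of_conn hX hP hpq ?_
  have hPC := PC_slice hX hP p _ hv0
  have hk := isCompact_slice hX p _ hv0
  rw [compl_union, ← sdiff_eq]
  refine slit_preconnected rank_complex hk.isClosed.isOpen_compl (hPC.compl_preconnected hk)
    (by simpa using hp) zero_ne_one ?_
  intro t ht ht0 htY
  exact ht0 (param_eq_start hpq (hd _ (seg_mem_of_param ht) htY))

theorem PC.mono {Y Y' : Set ℂ} (hY : IsCompact Y) (h : PC Y') (hs : Y ⊆ Y') : PC Y := by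
  refine PC_of_conj hY fun δ hδ => ?_
  obtain ⟨p, hp⟩ := h (starRingEnd ℂ) Complex.continuous_conj.continuousOn δ hδ
  exact ⟨p, fun z hz => hp z (hs hz)⟩

/-- join -/
theorem seg_join {N : ℕ} {X1 X2 : Set (Fin N → ℂ)} (hX1 : IsCompact X1) (hX2 : IsCompact X2)
    (hdis : Disjoint X1 X2)
    (hP : PolyEqContinuous (X1 ∪ X2)) {p q : Fin N → ℂ} (hp : p ∈ X1) (hq : q ∈ X2)
    (hd : ∀ z ∈ segment ℝ p q, z ∈ X1 ∪ X2 → z = p ∨ z = q) :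
    PolyEqContinuous ((X1 ∪ X2) ∪ segment ℝ p q) := by
  have hpq : p ≠ q := fun h => disjoint_left.1 hdis hp (h ▸ hq)
  have hv0 : q - p ≠ 0 := sub_ne_zero.2 hpq.symm
  have hX := hX1.union hX2
  refine seg_union_of_conn hX hP hpq ?_
  have hPC := PC_slice hX hP p _ hv0
  have hk1 := isCompact_slice hX1 p _ hv0
  have hk2 := isCompact_slice hX2 p _ hv0
  have heq : {t : ℂ | p + t • (q - p) ∈ X1 ∪ X2} =
    {t : ℂ | p + t • (q - p) ∈ X1} ∪ {t : ℂ | p + t • (q - p) ∈ X2} := rfl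
  rw [heq] at hPC ⊢
  refine join_planar hk1 hk2 ((hPC.mono hk1 subset_union_left).compl_preconnected hk1)
    ((hPC.mono hk2 subset_union_right).compl_preconnected hk2) ?_ (by simpa using hp)
    (by simpa using hq) ?_
  · rw [disjoint_left]
    intro t h1 h2
    exact disjoint_left.1 hdis h1 h2
  · intro t ht h0 h1
    have hh : ∀ h : p + t • (q - p) ∈ X1 ∪ X2, False := fun h => by
      rcases hd _ (seg_mem_of_param ht) h with h | h
      · exact h0 (param_eq_start hpq h)
      · exact h1 (param_eq_end hpq h)
    exact ⟨fun h => hh (Or.inl h), fun h => hh (Or.inr h)⟩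


end parth

section parti

/-- smooth staircase -/
def stair (h d : ℝ) (n : ℕ) (x : ℝ) : ℝ :=
  h * ∑ j ∈ Finset.range n, Real.smoothTransition ((x - j * h) / d)

theorem stair_approx {h d : ℝ} (hd : 0 < d) (hdh : d ≤ h) (n : ℕ) :
    ∀ x, 0 ≤ x → x ≤ n * h → |stair h d n x - x| ≤ h := by
  have hh : 0 < h := hd.trans_le hdh
  have hfull : ∀ (n : ℕ) (x : ℝ), n * h ≤ x → stair h d n x = n * h := by
    intro n x hx
    unfold stair
    have : ∀ j ∈ Finset.range n, Real.smoothTransition ((x - j * h) / d) = 1 := by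
      intro j hj
      apply Real.smoothTransition.one_of_one_le
      rw [le_div_iff₀ hd]
      have : (j:ℝ) + 1 ≤ n := by exact_mod_cast Finset.mem_range.1 hj
      nlinarith
    rw [Finset.sum_congr rfl this]; simp [mul_comm]
  induction n with
  | zero => intro x h0 h1; simp at h1; simp [stair]; rw [abs_of_nonneg h0]; linarith
  | succ n ih =>
    intro x h0 h1
    have hs : stair h d (n+1) x = stair h d n x + h * Real.smoothTransition ((x - n * h) / d) := by
      unfold stair; rw [Finset.sum_range_succ, mul_add]
    rcases le_total x (n * h) with hx | hx
    · rw [hs, Real.smoothTransition.zero_of_nonpos (div_nonpos_of_nonpos_of_nonneg (by linarith) hd.le),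
        mul_zero, add_zero]
      exact ih x h0 hx
    · rw [hs, hfull n x hx]
      have a1 := Real.smoothTransition.nonneg ((x - n * h) / d)
      have a2 := Real.smoothTransition.le_one ((x - n * h) / d)
      push_cast at h1
      rw [abs_le]
      constructor <;> nlinarith

theorem stair_contDiff (h d : ℝ) (n : ℕ) : ContDiff ℝ 1 (stair h d n) := by
  unfold stair
  refine contDiff_const.mul (ContDiff.sum fun j _ => ?_)
  exact Real.smoothTransition.contDiff.comp (by fun_prop)

theorem deriv_smoothTransition_eq_zero {x : ℝ} (hx : x ≤ 0 ∨ 1 ≤ x) :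
    HasDerivAt Real.smoothTransition 0 x := by
  have hdiff : DifferentiableAt ℝ Real.smoothTransition x :=
    (Real.smoothTransition.contDiff (n := 1)).differentiable (by norm_num) x
  have hext : IsLocalExtr Real.smoothTransition x := by
    rcases hx with hx | hx
    · left
      exact Filter.Eventually.of_forall fun y => by
        rw [Real.smoothTransition.zero_of_nonpos hx]; exact Real.smoothTransition.nonneg y
    · right
      exact Filter.Eventually.of_forall fun y => by
        rw [Real.smoothTransition.one_of_one_le hx]; exact Real.smoothTransition.le_one y
  have := hext.deriv_eq_zero
  exact this ▸ hdiff.hasDerivAt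

theorem stair_deriv {h d : ℝ} (hd : 0 < d) (n : ℕ) {x : ℝ}
    (hx : ∀ j : ℕ, x ≤ j * h ∨ j * h + d ≤ x) : HasDerivAt (stair h d n) 0 x := by
  unfold stair
  have : HasDerivAt (fun x => h * ∑ j ∈ Finset.range n, Real.smoothTransition ((x - j * h) / d))
      (h * ∑ j ∈ Finset.range n, 0) x := by
    refine HasDerivAt.const_mul h (HasDerivAt.fun_sum (A' := fun _ => (0:ℝ)) fun j _ => ?_)
    have h1 : HasDerivAt (fun x : ℝ => (x - j * h) / d) (1 / d) x :=
      ((hasDerivAt_id x).sub_const _).div_const d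
    have h2 : HasDerivAt Real.smoothTransition 0 ((x - j * h) / d) := by
      apply deriv_smoothTransition_eq_zero
      rcases hx j with h | h
      · left; exact div_nonpos_of_nonpos_of_nonneg (by linarith) hd.le
      · right; rw [le_div_iff₀ hd]; linarith
    exact (h2.comp x h1).congr_deriv (g' := (0:ℝ)) (by simp)
  simpa using this

/-- The fat Cantor-like set. -/
def CS (δ : ℕ → ℝ) : Set ℝ := {x | ∀ n : ℕ, ∀ j : ℤ, δ n ≤ |x - j / 2 ^ n|}

theorem CS_closed (δ : ℕ → ℝ) : IsClosed (CS δ) := by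
  have : CS δ = ⋂ n : ℕ, ⋂ j : ℤ, {x : ℝ | δ n ≤ |x - j / 2 ^ n|} := by
    ext x; simp [CS]
  rw [this]
  exact isClosed_iInter fun n => isClosed_iInter fun j =>
    isClosed_le continuous_const (by fun_prop)

/-- smooth approximation of the identity, locally flat on the Cantor set -/
theorem flat_approx {δ : ℕ → ℝ} (hδ : ∀ n, 0 < δ n) (R ε : ℝ) (hε : 0 < ε) :
    ∃ g : ℝ → ℝ, ContDiff ℝ 1 g ∧ (∀ x, |x| ≤ R → |g x - x| ≤ ε) ∧
      ∀ x ∈ CS δ, HasDerivAt g 0 x := by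
  obtain ⟨m, hm⟩ := exists_pow_lt_of_lt_one hε (by norm_num : (1/2:ℝ) < 1)
  set h : ℝ := (1/2) ^ m with hh
  have hpos : 0 < h := by positivity
  set d := min (δ m) h with hd
  have hdpos : 0 < d := lt_min (hδ m) hpos
  obtain ⟨M, hM⟩ := exists_nat_ge (|R| / h)
  rw [div_le_iff₀ hpos] at hM
  refine ⟨fun x => stair h d (2 * M) (x + M * h) - M * h, ?_, ?_, ?_⟩
  · exact ((stair_contDiff h d _).comp (by fun_prop)).sub contDiff_const
  · intro x hx
    have hxa := abs_le.1 (hx.trans (le_abs_self R))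
    have := stair_approx hdpos (min_le_right _ _) (2 * M) (x + M * h) (by linarith)
      (by push_cast; linarith)
    have e : stair h d (2 * M) (x + M * h) - M * h - x =
      stair h d (2 * M) (x + M * h) - (x + M * h) := by ring
    rw [e]; linarith
  · intro x hx
    have h1 : HasDerivAt (stair h d (2 * M)) 0 (x + M * h) := by
      refine stair_deriv hdpos _ fun j => ?_
      have := hx m ((j:ℤ) - M)
      have e : (((j:ℤ) - (M:ℤ) : ℤ) : ℝ) / 2 ^ m = (j - M) * h := by
        rw [hh]; push_cast; rw [one_div, inv_pow]; ring
      rw [e] at this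
      have h3 : d ≤ δ m := min_le_left _ _
      rcases le_abs.1 this with h | h
      · right; linarith
      · left; linarith
    have h2 := h1.comp_add_const x (M * h)
    exact h2.sub_const _

section planar
variable (C : Set ℝ) (h τ R : ℝ)

def GG : Set ℝ := {x | ∀ j : ℤ, 2 * τ ≤ |x - j * h|}
def SS : Set ℝ := {y | ∃ j : ℤ, y = j * h + 2 * τ}
def EE : Set ℂ := {z | |z.re| ≤ R ∧ |z.im| ≤ R ∧
  ((z.re ∈ C ∧ z.im ∈ GG h τ) ∨ (z.re ∈ GG h τ ∧ z.im ∈ SS h τ))}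

theorem GG_closed : IsClosed (GG h τ) := by
  have : GG h τ = ⋂ j : ℤ, {x | 2 * τ ≤ |x - j * h|} := by ext x; simp [GG]
  rw [this]
  exact isClosed_iInter fun j => isClosed_le continuous_const (by fun_prop)

theorem SS_closed (hh : 0 < h) : IsClosed (SS h τ) := by
  have h1 : SS h τ = (fun y => (y - 2 * τ) / h) ⁻¹' (range (Int.cast : ℤ → ℝ)) := by
    ext y
    simp only [SS, mem_ofPred_eq, mem_preimage, mem_range]
    refine exists_congr fun j => ?_
    rw [eq_div_iff hh.ne']
    constructor <;> intro h <;> linarith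
  rw [h1]
  exact Int.isClosedEmbedding_coe_real.isClosed_range.preimage (by fun_prop)

theorem EE_compact (hC : IsClosed C) (hh : 0 < h) : IsCompact (EE C h τ R) := by
  have hcl : IsClosed (EE C h τ R) := by
    have e : EE C h τ R = {z | |z.re| ≤ R} ∩ ({z | |z.im| ≤ R} ∩
      ((Complex.re ⁻¹' C ∩ Complex.im ⁻¹' GG h τ) ∪
        (Complex.re ⁻¹' GG h τ ∩ Complex.im ⁻¹' SS h τ))) := by
      ext z; simp [EE]
    rw [e]
    have c1 := Complex.continuous_re
    have c2 := Complex.continuous_im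
    refine (isClosed_le c1.abs continuous_const).inter
      ((isClosed_le c2.abs continuous_const).inter ?_)
    exact ((hC.preimage c1).inter ((GG_closed h τ).preimage c2)).union
      (((GG_closed h τ).preimage c1).inter ((SS_closed h τ hh).preimage c2))
  refine Metric.isCompact_of_isClosed_isBounded hcl ?_
  refine (Metric.isBounded_closedBall (x := (0:ℂ)) (r := 2 * R)).subset fun z hz => ?_
  rw [mem_closedBall_zero_iff]
  have := Complex.norm_le_abs_re_add_abs_im z
  linarith [hz.1, hz.2.1]

theorem vline_preconn (a y1 y2 : ℝ) :
    IsPreconnected ((fun y : ℝ => (a : ℂ) + y * Complex.I) '' uIcc y1 y2) :=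
  isPreconnected_uIcc.image _ (by fun_prop)

theorem hline_preconn (a x1 x2 : ℝ) :
    IsPreconnected ((fun x : ℝ => (x : ℂ) + a * Complex.I) '' uIcc x1 x2) :=
  isPreconnected_uIcc.image _ (by fun_prop)

theorem EE_compl (hh : 0 < h) (hτ : 0 < τ) (h4 : 4 * τ ≤ h) (hC : C ⊆ GG h τ) :
    IsPreconnected (EE C h τ R)ᶜ := by
  -- the hub
  have hEG : ∀ z ∈ EE C h τ R, z.re ∈ GG h τ ∧ z.im ∈ GG h τ := by
    rintro z ⟨-, -, ⟨h1, h2⟩ | ⟨h1, h2⟩⟩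
    · exact ⟨hC h1, h2⟩
    · refine ⟨h1, ?_⟩
      obtain ⟨j, hj⟩ := h2
      intro i
      rw [hj]
      rcases lt_or_ge j i with hij | hij
      · have : (j:ℝ) + 1 ≤ i := by exact_mod_cast hij
        rw [le_abs]; right; nlinarith
      · have : (i:ℝ) ≤ j := by exact_mod_cast hij
        rw [le_abs]; left; nlinarith
  have hnotG : ∀ j : ℤ, (j:ℝ) * h ∉ GG h τ := fun j hj => by
    have := hj j; simp at this; linarith
  let c0 : ℂ := ((R + 1 : ℝ) : ℂ)
  have hA : {z : ℂ | R < z.re} ⊆ (EE C h τ R)ᶜ := fun z hz hE => by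
    have := hE.1; have hz : R < z.re := hz; linarith [le_abs_self z.re]
  have hAc : IsPreconnected {z : ℂ | R < z.re} := (convex_halfSpace_re_gt R).isPreconnected
  have hc0 : c0 ∈ {z : ℂ | R < z.re} := by simp [c0]
  -- horizontal move
  have hmoveH : ∀ z : ℂ, (∀ x : ℝ, (x : ℂ) + z.im * Complex.I ∉ EE C h τ R) →
      ∃ t ⊆ (EE C h τ R)ᶜ, c0 ∈ t ∧ z ∈ t ∧ IsPreconnected t := by
    intro z hz
    refine ⟨{z : ℂ | R < z.re} ∪ (fun x : ℝ => (x : ℂ) + z.im * Complex.I) '' uIcc z.re (R+1),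
      union_subset hA ?_, Or.inl hc0, Or.inr ⟨z.re, left_mem_uIcc, Complex.re_add_im z⟩, ?_⟩
    · rintro _ ⟨x, _, rfl⟩; exact hz x
    · exact hAc.union _ (by simp) ⟨R+1, right_mem_uIcc, rfl⟩ (hline_preconn _ _ _)
  -- vertical then horizontal
  have hmoveV : ∀ (z : ℂ) (y' : ℝ), y' ∉ GG h τ →
      (∀ y ∈ uIcc z.im y', (z.re : ℂ) + y * Complex.I ∉ EE C h τ R) →
      ∃ t ⊆ (EE C h τ R)ᶜ, c0 ∈ t ∧ z ∈ t ∧ IsPreconnected t := by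
    intro z y' hy' hz
    obtain ⟨t, ht, h0, h1, h2⟩ := hmoveH ((z.re : ℂ) + y' * Complex.I) (fun x hx => by
      have := (hEG _ hx).2; simp at this; exact hy' this)
    refine ⟨t ∪ (fun y : ℝ => (z.re : ℂ) + y * Complex.I) '' uIcc z.im y', union_subset ht ?_,
      Or.inl h0, Or.inr ⟨z.im, left_mem_uIcc, Complex.re_add_im z⟩, ?_⟩
    · rintro _ ⟨y, hy, rfl⟩; exact hz y hy
    · exact h2.union _ h1 ⟨y', right_mem_uIcc, rfl⟩ (vline_preconn _ _ _)
  refine isPreconnected_of_forall c0 fun z hz => ?_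
  by_cases hy : |z.im| ≤ R ∧ z.im ∈ GG h τ
  swap
  · refine hmoveH z fun x hx => hy ?_
    have h1 := hx.2.1
    have h2 := (hEG _ hx).2
    simp at h1 h2
    exact ⟨h1, h2⟩
  by_cases hx : |z.re| ≤ R ∧ z.re ∈ GG h τ
  swap
  · refine hmoveV z (0 : ℤ) (by simpa using hnotG 0) fun y _ hE => hx ?_
    have h1 := hE.1
    have h2 := (hEG _ hE).1
    simp at h1 h2
    exact ⟨h1, h2⟩
  have hxC : z.re ∉ C := fun hc => hz ⟨hx.1, hy.1, Or.inl ⟨hc, hy.2⟩⟩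
  have hyS : z.im ∉ SS h τ := fun hc => hz ⟨hx.1, hy.1, Or.inr ⟨hx.2, hc⟩⟩
  set j := ⌊z.im / h⌋ with hj
  have hj1 : j * h ≤ z.im := (le_div_iff₀ hh).1 (Int.floor_le _)
  have hj2 : z.im < (j + 1) * h := (div_lt_iff₀ hh).1 (Int.lt_floor_add_one _)
  have hj3 : j * h + 2 * τ < z.im := by
    have h1 := hy.2 j
    rw [abs_of_nonneg (by linarith)] at h1
    refine lt_of_le_of_ne (by linarith) fun h => hyS ⟨j, h.symm⟩
  refine hmoveV z ((j + 1 : ℤ) * h) (hnotG _) fun y hy' hE => ?_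
  push_cast at hy'
  rw [uIcc_of_le hj2.le] at hy'
  rcases hE.2.2 with h1 | h1
  · simp at h1; exact hxC h1.1
  · have := h1.2
    simp only [Complex.add_im, Complex.ofReal_im, Complex.mul_im, Complex.ofReal_re, Complex.I_im,
      mul_one, Complex.I_re, mul_zero, add_zero, zero_add] at this
    obtain ⟨i, hi⟩ := this
    rcases le_or_gt i j with hij | hij
    · have : (i:ℝ) ≤ j := by exact_mod_cast hij
      nlinarith [hy'.1]
    · have : (j:ℝ) + 1 ≤ i := by exact_mod_cast hij
      nlinarith [hy'.2]

end planar


end parti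

section partj

theorem hline_null (S : Set ℝ) (hS : S.Countable) : volume (Complex.im ⁻¹' S) = 0 := by
  have h1 : Complex.im ⁻¹' S = ⋃ y ∈ S, Complex.im ⁻¹' {y} := by
    ext z; simp
  rw [h1, measure_biUnion_null_iff hS]
  intro y _
  have h2 : Complex.measurableEquivRealProd.symm ⁻¹' (Complex.im ⁻¹' {y}) = univ ×ˢ {y} := by
    ext z; simp [Complex.measurableEquivRealProd]
  have h3 := Complex.volume_preserving_equiv_real_prod.symm.measure_preimage_equiv
    (Complex.im ⁻¹' {y})
  rw [← h3, h2, Measure.volume_eq_prod, Measure.prod_prod]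
  simp

theorem SS_countable (h τ : ℝ) : (SS h τ).Countable := by
  have : SS h τ = range (fun j : ℤ => (j:ℝ) * h + 2 * τ) := by
    ext y; simp [SS, eq_comm]
  rw [this]; exact countable_range _

theorem EE_app {δ : ℕ → ℝ} (hδ : ∀ n, 0 < δ n) {h τ R : ℝ} (hh : 0 < h) (hτ : 0 < τ)
    (h4 : 4 * τ ≤ h) (hC : CS δ ⊆ GG h τ) : App (EE (CS δ) h τ R) (starRingEnd ℂ) := by
  have hK := EE_compact (CS δ) h τ R (CS_closed δ) hh
  have hconn := EE_compl (CS δ) h τ R hh hτ h4 hC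
  intro ε hε
  obtain ⟨g, hg1, hg2, hg3⟩ := flat_approx hδ R (ε/8) (by positivity)
  obtain ⟨b, hbs, hb1⟩ : ∃ b : ContDiffBump (0:ℂ), b.rIn = 2 * |R| + 1 ∧ True :=
    ⟨⟨2 * |R| + 1, 2 * |R| + 2, by positivity, by linarith⟩, rfl, trivial⟩
  let f : ℂ → ℂ := fun z => (b z : ℂ) * ((g z.re : ℝ) : ℂ)
  have hEb : ∀ z ∈ EE (CS δ) h τ R, ‖z‖ < 2 * |R| + 1 := by
    intro z hz
    have := Complex.norm_le_abs_re_add_abs_im z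
    linarith [hz.1, hz.2.1, le_abs_self R]
  have hnear : ∀ z : ℂ, ‖z‖ < 2 * |R| + 1 → b z = 1 := by
    intro z hz
    apply b.one_of_mem_closedBall
    rw [mem_closedBall_zero_iff, hbs]; exact hz.le
  have hf : ContDiff ℝ 1 f := by
    refine ContDiff.mul ?_ ?_
    · exact Complex.ofRealCLM.contDiff.comp b.contDiff
    · exact Complex.ofRealCLM.contDiff.comp (hg1.comp Complex.reCLM.contDiff)
  have hfc : HasCompactSupport f := by
    have h1 : HasCompactSupport (fun z : ℂ => ((b z : ℝ) : ℂ)) :=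
      b.hasCompactSupport.comp_left (g := fun x : ℝ => (x : ℂ)) (by simp)
    exact h1.mul_right
  have happ : App (EE (CS δ) h τ R) f := by
    refine app_of_dbar hK hconn hf hfc ?_
    have hae : ∀ᵐ ζ : ℂ, ζ ∉ Complex.im ⁻¹' (SS h τ) :=
      measure_eq_zero_iff_ae_notMem.1 (hline_null _ (SS_countable h τ))
    filter_upwards [hae] with ζ hζ hE
    have hre : ζ.re ∈ CS δ := by
      rcases hE.2.2 with h1 | h1
      · exact h1.1
      · exact absurd h1.2 hζ
    have hev : f =ᶠ[𝓝 ζ] fun z => ((g z.re : ℝ) : ℂ) := by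
      have : ∀ᶠ z in 𝓝 ζ, ‖z‖ < 2 * |R| + 1 :=
        (continuous_norm.tendsto ζ).eventually (gt_mem_nhds (hEb ζ hE))
      filter_upwards [this] with z hz
      simp [f, hnear z hz]
    have hd : HasFDerivAt (fun z : ℂ => ((g z.re : ℝ) : ℂ)) (0 : ℂ →L[ℝ] ℂ) ζ := by
      have h1 : HasFDerivAt g (0 : ℝ →L[ℝ] ℝ) ζ.re := by
        exact (hg3 _ hre).hasFDerivAt.congr_fderiv (by ext; simp)
      have h2 := Complex.ofRealCLM.hasFDerivAt.comp ζ (h1.comp ζ Complex.reCLM.hasFDerivAt)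
      exact h2.congr_fderiv (by ext <;> simp)
    unfold dbar
    rw [hev.fderiv_eq, hd.fderiv]; simp
  obtain ⟨p, hp⟩ := happ (ε/8) (by positivity)
  refine ⟨Polynomial.C 2 * p - Polynomial.X, fun z hz => ?_⟩
  have h1 := hp z hz
  have h2 : ‖((g z.re : ℝ) : ℂ) - (z.re : ℂ)‖ ≤ ε / 8 := by
    rw [← Complex.ofReal_sub, Complex.norm_real]; exact hg2 _ hz.1
  have h3 : f z = ((g z.re : ℝ) : ℂ) := by simp [f, hnear z (hEb z hz)]
  rw [h3] at h1
  have hc : (starRingEnd ℂ) z = 2 * (z.re : ℂ) - z := by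
    apply Complex.ext <;> simp; ring
  simp only [Polynomial.eval_sub, Polynomial.eval_mul, Polynomial.eval_C, Polynomial.eval_X]
  rw [hc]
  have e : 2 * (z.re : ℂ) - z - (2 * Polynomial.eval z p - z) =
    2 * ((((g z.re : ℝ) : ℂ) - Polynomial.eval z p) - (((g z.re : ℝ) : ℂ) - (z.re : ℂ))) := by ring
  rw [e, norm_mul]
  have := norm_sub_le (((g z.re : ℝ) : ℂ) - Polynomial.eval z p) (((g z.re : ℝ) : ℂ) - (z.re : ℂ))
  have h5 : ‖(2:ℂ)‖ = 2 := by simp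
  rw [h5]; linarith

def II (h s : ℝ) (j : ℤ) : Set ℝ := Icc (j * h + s) ((j + 1) * h - s)

def comb (C : Set ℝ) (h τ : ℝ) (j k : ℤ) : Set ℂ :=
  {z | z.re ∈ II h (2 * τ) j ∧ z.im ∈ II h (2 * τ) k ∧ (z.re ∈ C ∨ z.im = k * h + 2 * τ)}

theorem comb_compact {C : Set ℝ} (hC : IsClosed C) (h τ : ℝ) (j k : ℤ) :
    IsCompact (comb C h τ j k) := by
  have c1 := Complex.continuous_re
  have c2 := Complex.continuous_im
  have hb : IsCompact (II h (2 * τ) j ×ℂ II h (2 * τ) k) := isCompact_Icc.reProdIm isCompact_Icc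
  have e : comb C h τ j k = (II h (2 * τ) j ×ℂ II h (2 * τ) k) ∩
      (Complex.re ⁻¹' C ∪ {z | z.im = k * h + 2 * τ}) := by
    ext z; simp [comb, Complex.mem_reProdIm, and_assoc]
  rw [e]
  exact hb.inter_right ((hC.preimage c1).union (isClosed_eq c2 continuous_const))

theorem comb_preconn {C : Set ℝ} {h τ : ℝ} (h4 : 4 * τ ≤ h) (j k : ℤ) :
    IsPreconnected (comb C h τ j k) := by
  have hlow : (k:ℝ) * h + 2 * τ ∈ II h (2 * τ) k := ⟨le_rfl, by nlinarith⟩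
  have hlowj : (j:ℝ) * h + 2 * τ ∈ II h (2 * τ) j := ⟨le_rfl, by nlinarith⟩
  let base : Set ℂ := (fun x : ℝ => (x : ℂ) + ((k * h + 2 * τ : ℝ) : ℂ) * Complex.I) ''
    II h (2 * τ) j
  have hbase : IsPreconnected base := isPreconnected_Icc.image _ (by fun_prop)
  have hbs : base ⊆ comb C h τ j k := by
    rintro _ ⟨x, hx, rfl⟩
    refine ⟨by simpa using hx, ?_, Or.inr ?_⟩ 
    · simpa using hlow
    · simp
  refine isPreconnected_of_forall ((((j:ℝ) * h + 2 * τ : ℝ) : ℂ) +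
    ((k * h + 2 * τ : ℝ) : ℂ) * Complex.I) fun z hz => ?_
  rcases hz.2.2 with hc | hc
  · refine ⟨base ∪ (fun y : ℝ => (z.re : ℂ) + (y : ℂ) * Complex.I) '' II h (2 * τ) k,
      union_subset hbs ?_, Or.inl ⟨_, hlowj, rfl⟩,
      Or.inr ⟨z.im, hz.2.1, Complex.re_add_im z⟩, ?_⟩
    · rintro _ ⟨y, hy, rfl⟩
      refine ⟨by simpa using hz.1, by simpa using hy, Or.inl (by simpa using hc)⟩
    · exact hbase.union _ ⟨z.re, hz.1, rfl⟩ ⟨_, hlow, rfl⟩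
        (isPreconnected_Icc.image _ (by fun_prop))
  · refine ⟨base, hbs, ⟨_, hlowj, rfl⟩, ⟨z.re, hz.1, ?_⟩, hbase⟩
    simp only; rw [← hc]; exact Complex.re_add_im z

/-- a level of boxes and combs -/
structure Level {N : ℕ} (K : Set (Fin N → ℂ)) (η : ℝ)
    (F : Set (Set (Fin N → ℂ) × Set (Fin N → ℂ))) : Prop where
  fin : F.Finite
  conv : ∀ b ∈ F, Convex ℝ b.1
  comp : ∀ b ∈ F, IsCompact b.1
  qcomp : ∀ b ∈ F, IsCompact b.2
  qconn : ∀ b ∈ F, IsPreconnected b.2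
  qint : ∀ b ∈ F, b.2 ⊆ interior b.1
  Kq : ∀ b ∈ F, K ∩ b.1 ⊆ b.2
  Kne : ∀ b ∈ F, (K ∩ b.1).Nonempty
  diam : ∀ b ∈ F, ∀ x ∈ b.1, ∀ y ∈ b.1, dist x y ≤ η
  dis : ∀ b ∈ F, ∀ b' ∈ F, b ≠ b' → Disjoint b.1 b'.1
  cov : K ⊆ ⋃ b ∈ F, b.1
  cp : CP (⋃ b ∈ F, b.2)

theorem II_floor {h s x : ℝ} {j : ℤ} (hh : 0 < h) (hs : 0 < s) (hx : x ∈ II h s j) :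
    ⌊x / h⌋ = j := by
  rw [Int.floor_eq_iff, le_div_iff₀ hh, div_lt_iff₀ hh]
  exact ⟨by linarith [hx.1], by linarith [hx.2]⟩

theorem mem_II_floor {h s x : ℝ} (hh : 0 < h) (hx : ∀ j : ℤ, s ≤ |x - j * h|) :
    x ∈ II h s ⌊x / h⌋ := by
  have h1 : ⌊x / h⌋ * h ≤ x := (le_div_iff₀ hh).1 (Int.floor_le _)
  have h2 : x < (⌊x / h⌋ + 1) * h := (div_lt_iff₀ hh).1 (Int.lt_floor_add_one _)
  have a := hx ⌊x / h⌋
  have b := hx (⌊x / h⌋ + 1)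
  push_cast at b
  rw [abs_of_nonneg (by linarith)] at a
  rw [abs_of_neg (by linarith)] at b
  exact ⟨by linarith, by linarith⟩

theorem exists_level {N : ℕ} {δ : ℕ → ℝ} (hδ : ∀ n, 0 < δ n) {K : Set (Fin N → ℂ)}
    (hK : IsCompact K) (hKC : ∀ z ∈ K, ∀ i, (z i).re ∈ CS δ ∧ (z i).im ∈ CS δ) {η : ℝ}
    (hη : 0 < η) : ∃ F, Level K η F := by
  obtain ⟨n, hn⟩ := exists_pow_lt_of_lt_one (half_pos hη) (by norm_num : (1/2:ℝ) < 1)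
  set h : ℝ := (1/2) ^ n with hh
  have hpos : 0 < h := by positivity
  set τ := min (δ n / 3) (h / 8) with hτd
  have hτ : 0 < τ := lt_min (by have := hδ n; positivity) (by positivity)
  have hτ1 : 3 * τ ≤ δ n := by have := min_le_left (δ n / 3) (h / 8); linarith
  have hτ2 : 8 * τ ≤ h := by have := min_le_right (δ n / 3) (h / 8); linarith
  have h4 : 4 * τ ≤ h := by linarith
  have hC3 : ∀ x ∈ CS δ, ∀ j : ℤ, 3 * τ ≤ |x - j * h| := by
    intro x hx j
    have := hx n j
    have e : (j:ℝ) / 2 ^ n = j * h := by rw [hh, one_div, inv_pow]; rfl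
    rw [e] at this; linarith
  have hCG : CS δ ⊆ GG h τ := fun x hx j => by linarith [hC3 x hx j]
  let idx : (Fin N → ℂ) → (Fin N → ℤ) × (Fin N → ℤ) := fun z =>
    (fun i => ⌊(z i).re / h⌋, fun i => ⌊(z i).im / h⌋)
  let B : (Fin N → ℤ) × (Fin N → ℤ) → Set (Fin N → ℂ) := fun a =>
    univ.pi fun i => II h τ (a.1 i) ×ℂ II h τ (a.2 i)
  let Q : (Fin N → ℤ) × (Fin N → ℤ) → Set (Fin N → ℂ) := fun a =>
    univ.pi fun i => comb (CS δ) h τ (a.1 i) (a.2 i)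
  have hidx : ∀ a z, z ∈ B a → idx z = a := by
    intro a z hz
    ext i
    · exact II_floor hpos hτ (hz i (mem_univ i)).1
    · exact II_floor hpos hτ (hz i (mem_univ i)).2
  have hKB : ∀ z ∈ K, z ∈ B (idx z) := by
    intro z hz i _
    exact ⟨mem_II_floor hpos fun j => by linarith [hC3 _ (hKC z hz i).1 j],
      mem_II_floor hpos fun j => by linarith [hC3 _ (hKC z hz i).2 j]⟩
  have hKQ : ∀ z ∈ K, z ∈ Q (idx z) := by
    intro z hz i _
    exact ⟨mem_II_floor hpos fun j => by linarith [hC3 _ (hKC z hz i).1 j],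
      mem_II_floor hpos fun j => by linarith [hC3 _ (hKC z hz i).2 j], Or.inl (hKC z hz i).1⟩
  obtain ⟨R0, hR0⟩ := hK.isBounded.subset_closedBall 0
  have hKR : ∀ z ∈ K, ∀ i, |(z i).re| ≤ R0 ∧ |(z i).im| ≤ R0 := by
    intro z hz i
    have h1 : ‖z‖ ≤ R0 := by simpa using hR0 hz
    have h2 := norm_le_pi_norm z i
    exact ⟨(Complex.abs_re_le_norm _).trans (h2.trans h1),
      (Complex.abs_im_le_norm _).trans (h2.trans h1)⟩
  have hfin : (idx '' K).Finite := by
    refine ((Set.finite_Icc (fun _ : Fin N => ⌊-R0 / h⌋) (fun _ => ⌊R0 / h⌋)).prod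
      (Set.finite_Icc (fun _ : Fin N => ⌊-R0 / h⌋) (fun _ => ⌊R0 / h⌋))).subset ?_
    rintro _ ⟨z, hz, rfl⟩
    have key : ∀ x : ℝ, |x| ≤ R0 → ⌊-R0 / h⌋ ≤ ⌊x / h⌋ ∧ ⌊x / h⌋ ≤ ⌊R0 / h⌋ := by
      intro x hx
      have := abs_le.1 hx
      constructor
      · exact Int.floor_le_floor (by gcongr; exact this.1)
      · exact Int.floor_le_floor (by gcongr; exact this.2)
    exact ⟨⟨fun i => (key _ (hKR z hz i).1).1, fun i => (key _ (hKR z hz i).1).2⟩,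
      ⟨fun i => (key _ (hKR z hz i).2).1, fun i => (key _ (hKR z hz i).2).2⟩⟩
  have hcr : Continuous (fun z : ℂ => z.re) := Complex.continuous_re
  have hci : Continuous (fun z : ℂ => z.im) := Complex.continuous_im
  refine ⟨(fun a => (B a, Q a)) '' (idx '' K), ?_⟩
  constructor
  · exact hfin.image _
  · rintro _ ⟨a, _, rfl⟩
    refine convex_pi fun i _ => ?_
    exact ((convex_Icc (𝕜 := ℝ) _ _).linear_preimage Complex.reLm).inter
      ((convex_Icc (𝕜 := ℝ) _ _).linear_preimage Complex.imLm)
  · rintro _ ⟨a, _, rfl⟩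
    exact isCompact_univ_pi fun i => isCompact_Icc.reProdIm isCompact_Icc
  · rintro _ ⟨a, _, rfl⟩
    exact isCompact_univ_pi fun i => comb_compact (CS_closed δ) h τ _ _
  · rintro _ ⟨a, _, rfl⟩
    exact isPreconnected_univ_pi fun i => comb_preconn h4 _ _
  · rintro _ ⟨a, _, rfl⟩
    change Q a ⊆ interior (B a)
    have hsub : (univ.pi fun i => Ioo (a.1 i * h + τ) ((a.1 i + 1) * h - τ) ×ℂ
        Ioo (a.2 i * h + τ) ((a.2 i + 1) * h - τ)) ⊆ interior (B a) := by
      refine interior_maximal (Set.pi_mono fun i _ => ?_) ?_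
      · exact fun z hz => ⟨Ioo_subset_Icc_self hz.1, Ioo_subset_Icc_self hz.2⟩
      · exact isOpen_set_pi finite_univ fun i _ => isOpen_Ioo.reProdIm isOpen_Ioo
    refine Subset.trans (Set.pi_mono fun i _ => ?_) hsub
    intro z hz
    have h1 := hz.1
    have h2 := hz.2.1
    exact ⟨⟨by linarith [h1.1], by linarith [h1.2]⟩, ⟨by linarith [h2.1], by linarith [h2.2]⟩⟩
  · rintro _ ⟨a, _, rfl⟩ z ⟨hzK, hzB⟩
    have := hKQ z hzK
    rwa [hidx a z hzB] at this
  · rintro _ ⟨_, ⟨z, hz, rfl⟩, rfl⟩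
    exact ⟨z, hz, hKB z hz⟩
  · rintro _ ⟨a, _, rfl⟩ x hx y hy
    rw [dist_pi_le_iff hη.le]
    intro i
    have h1 := hx i (mem_univ i)
    have h2 := hy i (mem_univ i)
    rw [dist_eq_norm]
    refine (Complex.norm_le_abs_re_add_abs_im _).trans ?_
    have e1 : |(x i - y i).re| ≤ h := by
      rw [Complex.sub_re, abs_le]
      constructor <;> linarith [h1.1.1, h1.1.2, h2.1.1, h2.1.2]
    have e2 : |(x i - y i).im| ≤ h := by
      rw [Complex.sub_im, abs_le]
      constructor <;> linarith [h1.2.1, h1.2.2, h2.2.1, h2.2.2]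
    linarith
  · rintro _ ⟨a, _, rfl⟩ _ ⟨a', _, rfl⟩ hne
    rw [disjoint_left]
    intro z hz hz'
    apply hne
    rw [← hidx a z hz, ← hidx a' z hz']
  · intro z hz
    simp only [mem_iUnion]
    exact ⟨_, ⟨_, ⟨z, hz, rfl⟩, rfl⟩, hKB z hz⟩
  · intro i ε hε
    obtain ⟨p, hp⟩ := EE_app hδ (R := R0 + h) hpos hτ h4 hCG ε hε
    refine ⟨Polynomial.aeval (MvPolynomial.X i) p, fun z hz => ?_⟩
    rw [eval_comp_poly, eval_X, norm_sub_rev]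
    apply hp
    simp only [mem_iUnion] at hz
    obtain ⟨_, ⟨_, ⟨w, hw, rfl⟩, rfl⟩, hzQ⟩ := hz
    have hz1 := hzQ i (mem_univ i)
    have hGII : ∀ (x : ℝ) (j : ℤ), x ∈ II h (2 * τ) j → x ∈ GG h τ := by
      intro x j hx k
      rcases le_or_gt k j with hkj | hkj
      · have : (k:ℝ) ≤ j := by exact_mod_cast hkj
        rw [le_abs]; left; nlinarith [hx.1]
      · have : (j:ℝ) + 1 ≤ k := by exact_mod_cast hkj
        rw [le_abs]; right; nlinarith [hx.2]
    have hR : ∀ (x : ℝ) (y : ℝ), |y| ≤ R0 → x ∈ II h (2 * τ) ⌊y / h⌋ → |x| ≤ R0 + h := by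
      intro x y hy hx
      have h1 : ⌊y / h⌋ * h ≤ y := (le_div_iff₀ hpos).1 (Int.floor_le _)
      have h2 : y < (⌊y / h⌋ + 1) * h := (div_lt_iff₀ hpos).1 (Int.lt_floor_add_one _)
      have := abs_le.1 hy
      rw [abs_le]
      constructor <;> nlinarith [hx.1, hx.2]
    refine ⟨hR _ _ (hKR w hw i).1 hz1.1, hR _ _ (hKR w hw i).2 hz1.2.1, ?_⟩
    rcases hz1.2.2 with hc | hc
    · exact Or.inl ⟨hc, hGII _ _ hz1.2.1⟩
    · exact Or.inr ⟨hGII _ _ hz1.1, ⟨_, hc⟩⟩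


end partj

section partk

theorem null_of_lines {N : ℕ} {S : Set (Fin N → ℂ)} (hS : MeasurableSet S) (x₀ : Fin N → ℂ)
    (h : ∀ v : Fin N → ℂ, {t : ℝ | x₀ + t • v ∈ S}.Countable) : volume S = 0 := by
  let f : (Fin N → ℂ) × ℝ → (Fin N → ℂ) := fun p => x₀ + p.2 • p.1
  have hf : Measurable f := by
    apply Continuous.measurable; fun_prop
  have hm : MeasurableSet (f ⁻¹' S) := hf hS
  have h0 : (volume.prod volume : Measure ((Fin N → ℂ) × ℝ)) (f ⁻¹' S) = 0 := by
    rw [Measure.measure_prod_null hm]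
    exact Filter.Eventually.of_forall fun v => (h v).measure_zero _
  let g : ℝ × (Fin N → ℂ) → (Fin N → ℂ) := fun p => x₀ + p.1 • p.2
  have h1 : (volume.prod volume : Measure (ℝ × (Fin N → ℂ))) (g ⁻¹' S) = 0 := by
    rw [← Measure.prod_swap, Measure.map_apply measurable_swap]
    · exact h0
    · have hg : Measurable g := by
        apply Continuous.measurable; fun_prop
      exact hg hS
  have h2 := Measure.measure_ae_null_of_prod_null h1
  have h3 : ∀ᵐ t : ℝ, t ≠ 0 := by
    rw [ae_iff]; simp
  obtain ⟨t, ht, ht0⟩ := (h2.and h3).exists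
  have e : Prod.mk t ⁻¹' (g ⁻¹' S) = (t • ·) ⁻¹' ((x₀ + ·) ⁻¹' S) := rfl
  have h4 : volume ((t • · : (Fin N → ℂ) → (Fin N → ℂ)) ⁻¹' ((x₀ + ·) ⁻¹' S)) = 0 := ht
  rw [Measure.addHaar_preimage_smul _ ht0, measure_preimage_add] at h4
  rcases mul_eq_zero.1 h4 with h5 | h5
  · rw [ENNReal.ofReal_eq_zero] at h5
    have : 0 < |(t ^ Module.finrank ℝ (Fin N → ℂ))⁻¹| := by positivity
    linarith
  · exact h5

/-- complex lines through a point off `Z` meet `Z` in a countable set -/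
def GZ {N : ℕ} (Z : Set (Fin N → ℂ)) : Prop :=
  ∀ p ∉ Z, ∀ v, {t : ℂ | p + t • v ∈ Z}.Countable

theorem exists_Z {N : ℕ} {Ω : Set (Fin N → ℂ)} (hb : Bornology.IsBounded Ω) (x₀ : Fin N → ℂ) :
    ∃ Z : Set (Fin N → ℂ), x₀ ∉ Z ∧ GZ Z ∧ MeasurableSet Z ∧ volume Z = 0 ∧
      ∀ J : Set (Fin N → ℂ), (∀ z ∈ J, z ∉ Z) → ∀ (p : MvPolynomial (Fin N) ℂ) (δ : ℝ), 0 < δ →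
        ∃ q : MvPolynomial (Fin N) ℂ, (∀ z ∈ J, eval z q ≠ 0) ∧
          ∀ z ∈ closure Ω, ‖eval z p - eval z q‖ < δ := by
  have hc : IsCompact (closure Ω) := hb.isCompact_closure
  have : CompactSpace (closure Ω) := isCompact_iff_compactSpace.1 hc
  let r : MvPolynomial (Fin N) ℂ → C(closure Ω, ℂ) := fun q =>
    ⟨fun z => eval (z : Fin N → ℂ) q, (continuous_eval_mv q).comp continuous_subtype_val⟩
  let S : Set C(closure Ω, ℂ) := r '' {q | eval x₀ q ≠ 0}
  obtain ⟨T, hTS, hTc, hST⟩ :=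
    (TopologicalSpace.IsSeparable.of_separableSpace S).exists_countable_dense_subset
  have hTS' : ∀ f : C(closure Ω, ℂ), f ∈ T → ∃ q : MvPolynomial (Fin N) ℂ,
    eval x₀ q ≠ 0 ∧ r q = f := fun f hf => hTS hf
  choose! c hc1 hc2 using hTS'
  have hcl : ∀ q : MvPolynomial (Fin N) ℂ, IsClosed {z | eval z q = 0} := fun q =>
    isClosed_eq (continuous_eval_mv q) continuous_const
  have hGZ : GZ (⋃ f ∈ T, {z | eval z (c f) = 0}) := by
    intro p hp v
    have : {t : ℂ | p + t • v ∈ ⋃ f ∈ T, {z | eval z (c f) = 0}} =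
      ⋃ f ∈ T, {t : ℂ | eval (p + t • v) (c f) = 0} := by ext t; simp
    rw [this]
    refine hTc.biUnion fun f hf => ?_
    let P : Polynomial ℂ := MvPolynomial.aeval (fun i => Polynomial.C (p i) +
      Polynomial.X * Polynomial.C (v i)) (c f)
    have hP : P ≠ 0 := by
      intro h0
      have h1 := eval_line p v 0 (c f)
      change Polynomial.eval 0 P = _ at h1
      rw [h0] at h1
      apply hp
      simp only [mem_iUnion]
      refine ⟨f, hf, ?_⟩
      simpa using h1.symm
    refine (P.rootSet_finite ℂ).countable.mono fun t ht => ?_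
    rw [Polynomial.mem_rootSet]
    refine ⟨hP, ?_⟩
    have := eval_line p v t (c f)
    rw [Polynomial.coe_aeval_eq_eval]
    exact this.trans ht
  have hx : x₀ ∉ ⋃ f ∈ T, {z | eval z (c f) = 0} := by
    simp only [mem_iUnion, not_exists]
    exact fun f hf h => hc1 f hf h
  have hmeas : MeasurableSet (⋃ f ∈ T, {z | eval z (c f) = 0}) :=
    MeasurableSet.biUnion hTc fun f _ => (hcl _).measurableSet
  refine ⟨⋃ f ∈ T, {z | eval z (c f) = 0}, hx, hGZ, hmeas, ?_, ?_⟩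
  · refine null_of_lines hmeas x₀ fun v => ?_
    have := (hGZ x₀ hx v).preimage (f := fun t : ℝ => (t : ℂ)) Complex.ofReal_injective
    refine this.mono fun t ht => ?_
    simpa using ht
  · intro J hJ p δ hδ
    obtain ⟨a, ha, ha'⟩ : ∃ a : ℂ, ‖a‖ < δ / 2 ∧ eval x₀ p + a ≠ 0 := by
      by_cases h0 : eval x₀ p = 0
      · refine ⟨((δ / 4 : ℝ) : ℂ), ?_, ?_⟩
        · rw [Complex.norm_real, Real.norm_of_nonneg (by positivity)]; linarith
        · rw [h0, zero_add]; exact_mod_cast (by positivity : (δ/4) ≠ 0)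
      · exact ⟨0, by simpa using half_pos hδ, by simpa using h0⟩
    have h1 : r (p + C a) ∈ S := ⟨_, by simpa using ha', rfl⟩
    obtain ⟨f, hf, hd⟩ := Metric.mem_closure_iff.1 (hST h1) (δ/2) (by positivity)
    refine ⟨c f, fun z hz h0 => hJ z hz ?_, fun z hz => ?_⟩
    · simp only [mem_iUnion]; exact ⟨f, hf, h0⟩
    · have h2 := (ContinuousMap.dist_lt_iff (by positivity)).1 hd ⟨z, hz⟩
      rw [← hc2 f hf, dist_eq_norm] at h2
      change ‖eval z (p + C a) - eval z (c f)‖ < δ / 2 at h2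
      rw [map_add, eval_C] at h2
      calc ‖eval z p - eval z (c f)‖ = ‖(eval z p + a - eval z (c f)) - a‖ := by congr 1; ring
        _ ≤ _ := norm_sub_le _ _
        _ < δ := by linarith

theorem line_count (x v c : ℝ) (h : x ≠ c) : {t : ℝ | x + t * v = c}.Countable := by
  refine Set.Subsingleton.countable fun s hs t ht => ?_
  have h1 : x + s * v = c := hs
  have h2 : x + t * v = c := ht
  have hv : v ≠ 0 := by rintro rfl; apply h; linarith
  exact mul_right_cancel₀ hv (by linarith)

theorem grid_null {N : ℕ} (i : Fin N) (c : ℝ) :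
    volume {z : Fin N → ℂ | (z i).re = c ∨ (z i).im = c} = 0 := by
  have hm1 : IsClosed {z : Fin N → ℂ | (z i).re = c} :=
    isClosed_eq (Complex.continuous_re.comp (continuous_apply i)) continuous_const
  have hm2 : IsClosed {z : Fin N → ℂ | (z i).im = c} :=
    isClosed_eq (Complex.continuous_im.comp (continuous_apply i)) continuous_const
  refine null_of_lines (S := {z : Fin N → ℂ | (z i).re = c ∨ (z i).im = c})
    (hm1.union hm2).measurableSet (fun _ => ⟨c + 1, c + 1⟩) fun v => ?_
  refine ((line_count (c+1) (v i).re c (by simp)).union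
    (line_count (c+1) (v i).im c (by simp))).mono ?_
  intro t ht
  simpa using ht

theorem exists_delta {N : ℕ} {Ω : Set (Fin N → ℂ)} (hb : Bornology.IsBounded Ω)
    (hm : MeasurableSet Ω) (ε : ENNReal) (hε : ε ≠ 0) :
    ∃ δ : ℕ → ℝ, (∀ n, 0 < δ n) ∧
      volume (Ω \ {z | ∀ i, (z i).re ∈ CS δ ∧ (z i).im ∈ CS δ}) < ε := by
  obtain ⟨e, he0, he⟩ := ENNReal.exists_pos_sum_of_countable' hε ℕ
  let A : ℕ → ℝ → Set (Fin N → ℂ) := fun n s =>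
    {z | z ∈ Ω ∧ ∃ i, ∃ j : ℤ, |(z i).re - j / 2 ^ n| < s ∨ |(z i).im - j / 2 ^ n| < s}
  have hcr : ∀ i, Continuous fun z : Fin N → ℂ => (z i).re := fun i =>
    Complex.continuous_re.comp (continuous_apply i)
  have hci : ∀ i, Continuous fun z : Fin N → ℂ => (z i).im := fun i =>
    Complex.continuous_im.comp (continuous_apply i)
  have hA : ∀ n s, MeasurableSet (A n s) := by
    intro n s
    have : A n s = Ω ∩ ⋃ i, ⋃ j : ℤ, {z | |(z i).re - j / 2 ^ n| < s} ∪
      {z | |(z i).im - j / 2 ^ n| < s} := by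
      ext z; simp [A]
    rw [this]
    refine hm.inter (IsOpen.measurableSet ?_)
    refine isOpen_iUnion fun i => isOpen_iUnion fun j => IsOpen.union ?_ ?_
    · exact isOpen_lt ((hcr i).sub continuous_const).abs continuous_const
    · exact isOpen_lt ((hci i).sub continuous_const).abs continuous_const
  have hd : ∀ n, ∃ s : ℝ, 0 < s ∧ volume (A n s) < e n := by
    intro n
    have hanti : Antitone fun k : ℕ => A n (1 / ((k:ℝ) + 1)) := by
      intro k l hkl z hz
      obtain ⟨h1, i, j, h2⟩ := hz
      have : 1 / ((l:ℝ) + 1) ≤ 1 / ((k:ℝ) + 1) := by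
        gcongr
      exact ⟨h1, i, j, h2.imp (fun h => h.trans_le this) (fun h => h.trans_le this)⟩
    have ht := tendsto_measure_iInter_atTop (μ := volume)
      (fun k : ℕ => (hA n (1 / ((k:ℝ) + 1))).nullMeasurableSet) hanti
      ⟨0, ((measure_mono fun z hz => hz.1).trans_lt hb.measure_lt_top).ne⟩
    have h0 : volume (⋂ k : ℕ, A n (1 / ((k:ℝ) + 1))) = 0 := by
      have hsub : (⋂ k : ℕ, A n (1 / ((k:ℝ) + 1))) ⊆
          ⋃ i : Fin N, ⋃ j : ℤ, {z | (z i).re = j / 2 ^ n ∨ (z i).im = j / 2 ^ n} := by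
        intro z hz
        rw [mem_iInter] at hz
        by_contra hcon
        simp only [mem_iUnion, not_exists] at hcon
        -- pick the nearest grid point
        have key : ∀ x : ℝ, (∀ j : ℤ, x ≠ j / 2 ^ n) → ∃ s > 0, ∀ j : ℤ, s ≤ |x - j / 2 ^ n| := by
          intro x hx
          have h2 : (0:ℝ) < 2 ^ n := by positivity
          refine ⟨min (x - ⌊x * 2 ^ n⌋ / 2 ^ n) ((⌊x * 2 ^ n⌋ + 1) / 2 ^ n - x), ?_, ?_⟩
          · have a1 := Int.floor_le (x * 2 ^ n)
            have a2 := Int.lt_floor_add_one (x * 2 ^ n)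
            apply lt_min
            · rw [sub_pos, lt_iff_le_and_ne]
              exact ⟨by rwa [div_le_iff₀ h2], (hx _).symm⟩
            · rw [sub_pos, lt_div_iff₀ h2]; exact a2
          · intro j
            rcases le_or_gt j ⌊x * 2 ^ n⌋ with hj | hj
            · have : (j:ℝ) ≤ ⌊x * 2 ^ n⌋ := by exact_mod_cast hj
              refine (min_le_left _ _).trans ((?_ : _ ≤ x - j / 2 ^ n).trans (le_abs_self _))
              gcongr
            · have : (⌊x * 2 ^ n⌋:ℝ) + 1 ≤ j := by exact_mod_cast hj
              refine (min_le_right _ _).trans ((?_ : _ ≤ -(x - j / 2 ^ n)).trans (neg_le_abs _))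
              rw [neg_sub]
              gcongr
        have key2 : ∀ i : Fin N, ∃ s > 0, ∀ j : ℤ, s ≤ |(z i).re - j / 2 ^ n| ∧
            s ≤ |(z i).im - j / 2 ^ n| := by
          intro i
          obtain ⟨s1, hs1, h1⟩ := key (z i).re fun j h => hcon i j (Or.inl h)
          obtain ⟨s2, hs2, h2⟩ := key (z i).im fun j h => hcon i j (Or.inr h)
          exact ⟨min s1 s2, lt_min hs1 hs2, fun j =>
            ⟨(min_le_left _ _).trans (h1 j), (min_le_right _ _).trans (h2 j)⟩⟩
        choose s hs1 hs2 using key2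
        obtain ⟨s0, hs0, hs0'⟩ : ∃ s0 > 0, ∀ i, s0 ≤ s i := by
          rcases isEmpty_or_nonempty (Fin N) with hN | hN
          · exact ⟨1, one_pos, fun i => isEmptyElim i⟩
          · obtain ⟨i, hi⟩ := Finite.exists_min s
            exact ⟨s i, hs1 i, hi⟩
        obtain ⟨k, hk⟩ := exists_nat_one_div_lt hs0
        obtain ⟨_, i, j, h⟩ := hz k
        rcases h with h | h
        · linarith [(hs2 i j).1, hs0' i]
        · linarith [(hs2 i j).2, hs0' i]
      refine measure_mono_null hsub ?_
      exact measure_iUnion_null fun i => measure_iUnion_null fun j => grid_null i _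
    rw [h0] at ht
    obtain ⟨k, hk⟩ := (ht.eventually (gt_mem_nhds (he0 n))).exists
    exact ⟨_, by positivity, hk⟩
  choose δ hδ1 hδ2 using hd
  refine ⟨δ, hδ1, ?_⟩
  calc _ ≤ volume (⋃ n, A n (δ n)) := by
        apply measure_mono
        intro z hz
        by_contra hcon
        apply hz.2
        simp only [mem_iUnion, not_exists] at hcon
        intro i
        constructor
        · intro n j
          by_contra h
          exact hcon n ⟨hz.1, i, j, Or.inl (not_le.1 h)⟩
        · intro n j
          by_contra h
          exact hcon n ⟨hz.1, i, j, Or.inr (not_le.1 h)⟩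
    _ ≤ ∑' n, volume (A n (δ n)) := measure_iUnion_le _
    _ ≤ ∑' n, e n := ENNReal.tsum_le_tsum fun n => (hδ2 n).le
    _ < ε := he

theorem exists_K {N : ℕ} {Ω : Set (Fin N → ℂ)} (ho : IsOpen Ω) (hb : Bornology.IsBounded Ω)
    {Z : Set (Fin N → ℂ)} (hZ : MeasurableSet Z) (hZ0 : volume Z = 0) {ε : ℝ} (hε : 0 < ε) :
    ∃ δ : ℕ → ℝ, (∀ n, 0 < δ n) ∧ ∃ K : Set (Fin N → ℂ), IsCompact K ∧ K ⊆ Ω \ Z ∧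
      (∀ z ∈ K, ∀ i, (z i).re ∈ CS δ ∧ (z i).im ∈ CS δ) ∧
      volume (Ω \ K) < ENNReal.ofReal ε := by
  obtain ⟨δ, hδ, hv⟩ := exists_delta hb ho.measurableSet (ENNReal.ofReal (ε/2))
    (by simpa using hε)
  refine ⟨δ, hδ, ?_⟩
  set G : Set (Fin N → ℂ) := {z | ∀ i, (z i).re ∈ CS δ ∧ (z i).im ∈ CS δ} with hG
  have hGc : IsClosed G := by
    have : G = ⋂ i, {z | (z i).re ∈ CS δ} ∩ {z | (z i).im ∈ CS δ} := by
      ext z; simp [hG]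
    rw [this]
    exact isClosed_iInter fun i => ((CS_closed δ).preimage (Complex.continuous_re.comp
      (continuous_apply i))).inter ((CS_closed δ).preimage (Complex.continuous_im.comp
      (continuous_apply i)))
  have hmA : MeasurableSet ((Ω \ Z) ∩ G) := (ho.measurableSet.diff hZ).inter hGc.measurableSet
  have hfin : volume ((Ω \ Z) ∩ G) ≠ ⊤ :=
    ((measure_mono fun z hz => hz.1.1).trans_lt hb.measure_lt_top).ne
  obtain ⟨K, hK1, hK2, hK3⟩ := hmA.exists_isCompact_sdiff_lt hfin
    (ε := ENNReal.ofReal (ε/2)) (by simpa using hε)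
  refine ⟨K, hK2, fun z hz => (hK1 hz).1, fun z hz => (hK1 hz).2, ?_⟩
  calc volume (Ω \ K) ≤ volume ((Ω \ G) ∪ Z ∪ (((Ω \ Z) ∩ G) \ K)) := by
        apply measure_mono
        intro z hz
        by_cases h1 : z ∈ G
        · by_cases h2 : z ∈ Z
          · exact Or.inl (Or.inr h2)
          · exact Or.inr ⟨⟨⟨hz.1, h2⟩, h1⟩, hz.2⟩
        · exact Or.inl (Or.inl ⟨hz.1, h1⟩)
    _ ≤ volume (Ω \ G) + volume Z + volume (((Ω \ Z) ∩ G) \ K) :=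
        (measure_union_le _ _).trans (by gcongr; exact measure_union_le _ _)
    _ < ENNReal.ofReal (ε/2) + ENNReal.ofReal (ε/2) := by
        rw [hZ0, add_zero]; exact ENNReal.add_lt_add hv hK3
    _ = ENNReal.ofReal ε := by
        rw [← ENNReal.ofReal_add (by positivity) (by positivity)]; congr 1; ring


end partk

section partl

abbrev CN (N : ℕ) := Fin N → ℂ

inductive Tr (N : ℕ) where
  | seg (p q : CN N) : Tr N
  | box (B Q : Set (CN N)) (a b y y' : CN N) : Tr N
  | cat (s t : Tr N) : Tr N

namespace Tr
variable {N : ℕ}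

def car : Tr N → Set (CN N)
  | seg p q => segment ℝ p q
  | box B _ _ _ _ _ => B
  | cat s t => car s ∪ car t

def st : Tr N → CN N
  | seg p _ => p
  | box _ _ a _ _ _ => a
  | cat s _ => st s

def en : Tr N → CN N
  | seg _ q => q
  | box _ _ _ b _ _ => b
  | cat _ t => en t

def len : Tr N → ℝ
  | seg _ _ => 1
  | box _ _ _ _ _ _ => 0
  | cat s t => len s + len t

open Classical in
def g : Tr N → CN N → ℝ
  | seg p q, x => dist p x / dist p q
  | box _ _ _ _ _ _, _ => 0
  | cat s t, x => if x ∈ car s then g s x else len s + g t x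

def Valid (Z : Set (CN N)) (F : Set (Set (CN N) × Set (CN N))) : Tr N → Prop
  | seg p q => p ≠ q ∧ ∀ z ∈ segment ℝ p q, z ∉ Z
  | box B Q a b y y' => (B, Q) ∈ F ∧ a ≠ b ∧ a ∈ B ∧ b ∈ B ∧ a ∉ interior B ∧ b ∉ interior B ∧
      y ∈ Q ∧ y' ∈ Q ∧ (∀ z ∈ segment ℝ a y, z ∈ Q → z = y) ∧
      (∀ z ∈ segment ℝ b y', z ∈ Q → z = y') ∧
      (∀ z ∈ segment ℝ a y, z ∈ segment ℝ b y' → z ∈ Q) ∧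
      (∀ z ∈ segment ℝ a y, z ≠ a → z ∈ interior B) ∧
      (∀ z ∈ segment ℝ b y', z ≠ b → z ∈ interior B) ∧
      (∀ z ∈ segment ℝ a y, z ∉ Z) ∧ (∀ z ∈ segment ℝ b y', z ∉ Z)
  | cat s t => Valid Z F s ∧ Valid Z F t ∧ en s = st t ∧ ∀ x ∈ car s, x ∈ car t → x = en s

def QQ : Tr N → Set (CN N)
  | seg _ _ => ∅
  | box _ Q _ _ _ _ => Q
  | cat s t => QQ s ∪ QQ t

def D : Tr N → Set (CN N)
  | seg p q => segment ℝ p q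
  | box _ Q a b y y' => Q ∪ segment ℝ a y ∪ segment ℝ b y'
  | cat s t => D s ∪ D t

variable {Z : Set (CN N)} {F : Set (Set (CN N) × Set (CN N))}

theorem len_cat (s t : Tr N) : len (cat s t) = len s + len t := rfl

open Classical in
theorem g_cat (s t : Tr N) (x : CN N) :
    g (cat s t) x = if x ∈ car s then g s x else len s + g t x := rfl

theorem Valid.mono {F' : Set (Set (CN N) × Set (CN N))} (hF : F ⊆ F') :
    ∀ {T : Tr N}, Valid Z F T → Valid Z F' T
  | seg _ _, h => h
  | box _ _ _ _ _ _, h => ⟨hF h.1, h.2⟩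
  | cat _ _, h => ⟨h.1.mono hF, h.2.1.mono hF, h.2.2⟩

theorem st_mem : ∀ {T : Tr N}, Valid Z F T → st T ∈ car T
  | seg p q, _ => left_mem_segment ℝ p q
  | box _ _ _ _ _ _, h => h.2.2.1
  | cat _ _, h => Or.inl (st_mem h.1)

theorem en_mem : ∀ {T : Tr N}, Valid Z F T → en T ∈ car T
  | seg p q, _ => right_mem_segment ℝ p q
  | box _ _ _ _ _ _, h => h.2.2.2.1
  | cat _ _, h => Or.inr (en_mem h.2.1)

theorem st_ne_en : ∀ {T : Tr N}, Valid Z F T → st T ≠ en T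
  | seg _ _, h => h.1
  | box _ _ _ _ _ _, h => h.2.1
  | cat s t, h => by
    intro e
    have h1 : st s = en t := e
    exact st_ne_en h.1 (h.2.2.2 _ (st_mem h.1) (h1 ▸ en_mem h.2.1))

theorem st_notMem_right {s t : Tr N} (h : Valid Z F (cat s t)) : st s ∉ car t := fun h1 =>
  st_ne_en h.1 (h.2.2.2 _ (st_mem h.1) h1)

theorem car_compact (hF : ∀ b ∈ F, IsCompact b.1) : ∀ {T : Tr N}, Valid Z F T → IsCompact (car T)
  | seg p q, _ => isCompact_seg p q
  | box _ _ _ _ _ _, h => hF _ h.1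
  | cat _ _, h => (car_compact hF h.1).union (car_compact hF h.2.1)

theorem car_preconn (hF : ∀ b ∈ F, Convex ℝ b.1) :
    ∀ {T : Tr N}, Valid Z F T → IsPreconnected (car T)
  | seg p q, _ => (convex_segment p q).isPreconnected
  | box _ _ _ _ _ _, h => (hF _ h.1).isPreconnected
  | cat s t, h => by
    refine (car_preconn hF h.1).union (en s) (en_mem h.1) ?_ (car_preconn hF h.2.1)
    rw [h.2.2.1]; exact st_mem h.2.1

theorem len_nonneg : ∀ (T : Tr N), 0 ≤ len T
  | seg _ _ => zero_le_one
  | box _ _ _ _ _ _ => le_rfl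
  | cat s t => add_nonneg (len_nonneg s) (len_nonneg t)

theorem g_nonneg : ∀ (T : Tr N) (x : CN N), 0 ≤ g T x
  | seg _ _, _ => by unfold g; positivity
  | box _ _ _ _ _ _, _ => le_rfl
  | cat s t, x => by
    rw [g_cat]
    split_ifs
    · exact g_nonneg s x
    · exact add_nonneg (len_nonneg s) (g_nonneg t x)

theorem dist_seg_le {p q x : CN N} (h : x ∈ segment ℝ p q) : dist p x + dist x q = dist p q :=
  dist_add_dist_of_mem_segment h

theorem g_le : ∀ {T : Tr N}, Valid Z F T → ∀ x ∈ car T, g T x ≤ len T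
  | seg p q, h, x, hx => by
    unfold g len
    rw [div_le_one (dist_pos.2 h.1)]
    have := dist_seg_le hx
    linarith [dist_nonneg (x := x) (y := q)]
  | box _ _ _ _ _ _, _, _, _ => le_rfl
  | cat s t, h, x, hx => by
    rw [g_cat, len_cat]
    split_ifs with h1
    · linarith [g_le h.1 x h1, len_nonneg t]
    · have := g_le h.2.1 x (hx.resolve_left h1); linarith

theorem g_st : ∀ {T : Tr N}, Valid Z F T → g T (st T) = 0
  | seg p q, h => by simp [g, st]
  | box _ _ _ _ _ _, _ => rfl
  | cat s t, h => by
    change g (cat s t) (st s) = 0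
    rw [g_cat, if_pos (st_mem h.1)]; exact g_st h.1

theorem g_en : ∀ {T : Tr N}, Valid Z F T → g T (en T) = len T
  | seg p q, h => by
    have := dist_pos.2 h.1
    simp only [g, en, len]; field_simp
  | box _ _ _ _ _ _, _ => rfl
  | cat s t, h => by
    have h1 : en t ∉ car s := by
      intro h2
      exact st_ne_en h.2.1 (h.2.2.1 ▸ (h.2.2.2 _ h2 (en_mem h.2.1)).symm)
    change g (cat s t) (en t) = _
    rw [g_cat, len_cat, if_neg h1, g_en h.2.1]

theorem g_cat_right {s t : Tr N} (h : Valid Z F (cat s t)) {x : CN N} (hx : x ∈ car t) :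
    g (cat s t) x = len s + g t x := by
  rw [g_cat]
  split_ifs with h1
  · rw [h.2.2.2 x h1 hx, g_en h.1, h.2.2.1, g_st h.2.1, add_zero]
  · rfl

theorem g_cat_left {s t : Tr N} {x : CN N} (hx : x ∈ car s) :
    g (cat s t) x = g s x := by
  rw [g_cat, if_pos hx]

theorem g_cont (hF : ∀ b ∈ F, IsCompact b.1) :
    ∀ {T : Tr N}, Valid Z F T → ContinuousOn (g T) (car T)
  | seg p q, h => by
    change ContinuousOn (fun x => dist p x / dist p q) _
    fun_prop
  | box _ _ _ _ _ _, h => continuousOn_const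
  | cat s t, h => by
    have c1 := (car_compact hF h.1).isClosed
    have c2 := (car_compact hF h.2.1).isClosed
    refine ContinuousOn.union_of_isClosed ?_ ?_ c1 c2
    · exact (g_cont hF h.1).congr fun x hx => g_cat_left hx
    · exact (continuousOn_const.add (g_cont hF h.2.1)).congr fun x hx => g_cat_right h hx

/-- zero length trees sit in one box -/
theorem len_zero (hd : ∀ b ∈ F, ∀ b' ∈ F, b ≠ b' → Disjoint b.1 b'.1) :
    ∀ {T : Tr N}, Valid Z F T → len T = 0 → ∃ b ∈ F, car T ⊆ b.1
  | seg _ _, _, h0 => by simp [len] at h0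
  | box B Q _ _ _ _, h, _ => ⟨(B, Q), h.1, Subset.rfl⟩
  | cat s t, h, h0 => by
    rw [len_cat] at h0
    obtain ⟨b, hb, hs⟩ := len_zero hd h.1 (by linarith [len_nonneg s, len_nonneg t])
    obtain ⟨b', hb', ht⟩ := len_zero hd h.2.1 (by linarith [len_nonneg s, len_nonneg t])
    have e : b = b' := by
      by_contra hne
      exact disjoint_left.1 (hd b hb b' hb' hne) (hs (en_mem h.1))
        (ht (h.2.2.1 ▸ st_mem h.2.1))
    exact ⟨b, hb, union_subset hs (e ▸ ht)⟩

theorem g_zero (hd : ∀ b ∈ F, ∀ b' ∈ F, b ≠ b' → Disjoint b.1 b'.1) :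
    ∀ {T : Tr N}, Valid Z F T → ∀ x ∈ car T, g T x = 0 → x = st T ∨ ∃ b ∈ F, x ∈ b.1 ∧ st T ∈ b.1
  | seg p q, h, x, hx, h0 => by
    unfold g at h0
    have := dist_pos.2 h.1
    rw [div_eq_zero_iff] at h0
    rcases h0 with h0 | h0
    · left; exact (dist_eq_zero.1 h0).symm
    · linarith
  | box B Q a b y y', h, x, hx, _ => Or.inr ⟨(B, Q), h.1, hx, h.2.2.1⟩
  | cat s t, h, x, hx, h0 => by
    rw [g_cat] at h0
    split_ifs at h0 with h1
    · exact g_zero hd h.1 x h1 h0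
    · have hs : len s = 0 := by linarith [len_nonneg s, g_nonneg t x]
      have ht : g t x = 0 := by linarith [len_nonneg s, g_nonneg t x]
      obtain ⟨b, hb, hsb⟩ := len_zero hd h.1 hs
      right
      have hxt := hx.resolve_left h1
      have hen : st t ∈ b.1 := h.2.2.1 ▸ hsb (en_mem h.1)
      refine ⟨b, hb, ?_, hsb (st_mem h.1)⟩
      rcases g_zero hd h.2.1 x hxt ht with h2 | ⟨b', hb', h2, h3⟩
      · rw [h2]; exact hen
      · have e : b = b' := by
          by_contra hne
          exact disjoint_left.1 (hd b hb b' hb' hne) hen h3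
        rw [e]; exact h2

theorem g_full (hd : ∀ b ∈ F, ∀ b' ∈ F, b ≠ b' → Disjoint b.1 b'.1) :
    ∀ {T : Tr N}, Valid Z F T → ∀ x ∈ car T, g T x = len T →
      x = en T ∨ ∃ b ∈ F, x ∈ b.1 ∧ en T ∈ b.1
  | seg p q, h, x, hx, h0 => by
    unfold g len at h0
    have h1 := dist_pos.2 h.1
    rw [div_eq_one_iff_eq h1.ne'] at h0
    have := dist_seg_le hx
    left
    change x = q
    exact dist_eq_zero.1 (by linarith)
  | box B Q a b y y', h, x, hx, _ => Or.inr ⟨(B, Q), h.1, hx, h.2.2.2.1⟩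
  | cat s t, h, x, hx, h0 => by
    by_cases h1 : x ∈ car t
    · rw [g_cat_right h h1] at h0
      exact g_full hd h.2.1 x h1 (by rw [len_cat] at h0; linarith)
    · have hxs := hx.resolve_right h1
      rw [g_cat_left hxs] at h0
      rw [len_cat] at h0
      have h2 := g_le h.1 x hxs
      have ht : len t = 0 := by linarith [len_nonneg t]
      obtain ⟨b, hb, hsb⟩ := len_zero hd h.2.1 ht
      right
      have hen : en s ∈ b.1 := h.2.2.1 ▸ hsb (st_mem h.2.1)
      refine ⟨b, hb, ?_, hsb (en_mem h.2.1)⟩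
      rcases g_full hd h.1 x hxs (by linarith) with h2 | ⟨b', hb', h2, h3⟩
      · rw [h2]; exact hen
      · have e : b = b' := by
          by_contra hne
          exact disjoint_left.1 (hd b hb b' hb' hne) hen h3
        rw [e]; exact h2

theorem g_inj_aux (hd : ∀ b ∈ F, ∀ b' ∈ F, b ≠ b' → Disjoint b.1 b'.1) {s t : Tr N}
    (h : Valid Z F (cat s t)) {x y : CN N} (hx : x ∈ car s) (hy : y ∈ car t)
    (e : g s x = len s + g t y) : x = y ∨ ∃ b ∈ F, x ∈ b.1 ∧ y ∈ b.1 := by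
  have h1 := g_le h.1 x hx
  have h2 := g_nonneg t y
  have hen : en s = st t := h.2.2.1
  rcases g_full hd h.1 x hx (by linarith) with h3 | ⟨b, hb, h3, h3'⟩ <;>
  rcases g_zero hd h.2.1 y hy (by linarith) with h4 | ⟨b', hb', h4, h4'⟩
  · left; rw [h3, h4, hen]
  · right; exact ⟨b', hb', by rw [h3, hen]; exact h4', h4⟩
  · right; exact ⟨b, hb, h3, by rw [h4, ← hen]; exact h3'⟩
  · right
    have e : b = b' := by
      by_contra hne
      exact disjoint_left.1 (hd b hb b' hb' hne) h3' (hen ▸ h4')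
    exact ⟨b, hb, h3, e ▸ h4⟩

theorem g_inj (hd : ∀ b ∈ F, ∀ b' ∈ F, b ≠ b' → Disjoint b.1 b'.1) :
    ∀ {T : Tr N}, Valid Z F T → ∀ x ∈ car T, ∀ y ∈ car T, g T x = g T y →
      x = y ∨ ∃ b ∈ F, x ∈ b.1 ∧ y ∈ b.1
  | seg p q, h, x, hx, y, hy, e => by
    unfold g at e
    have h1 := dist_pos.2 h.1
    rw [div_left_inj' h1.ne'] at e
    left
    have hx' : x ∈ segment ℝ p q := hx
    have hy' : y ∈ segment ℝ p q := hy
    rw [segment_eq_image'] at hx' hy'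
    obtain ⟨s, hs, rfl⟩ := hx'
    obtain ⟨t, ht, rfl⟩ := hy'
    simp only [dist_self_add_right, norm_smul, Real.norm_eq_abs, abs_of_nonneg hs.1,
      abs_of_nonneg ht.1] at e
    have h2 : ‖q - p‖ ≠ 0 := by rw [norm_ne_zero_iff, sub_ne_zero]; exact h.1.symm
    rw [mul_right_cancel₀ h2 e]
  | box B Q a b y y', h, x, hx, z, hz, _ => Or.inr ⟨(B, Q), h.1, hx, hz⟩
  | cat s t, h, x, hx, y, hy, e => by
    by_cases h1 : x ∈ car s <;> by_cases h2 : y ∈ car s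
    · rw [g_cat_left h1, g_cat_left h2] at e
      exact g_inj hd h.1 x h1 y h2 e
    · have h2' := hy.resolve_left h2
      rw [g_cat_left h1, g_cat_right h h2'] at e
      exact g_inj_aux hd h h1 h2' e
    · have h1' := hx.resolve_left h1
      rw [g_cat_left h2, g_cat_right h h1'] at e
      rcases g_inj_aux hd h h2 h1' e.symm with h3 | ⟨b, hb, h3, h4⟩
      · exact Or.inl h3.symm
      · exact Or.inr ⟨b, hb, h4, h3⟩
    · have h1' := hx.resolve_left h1
      have h2' := hy.resolve_left h2
      rw [g_cat_right h h2', g_cat_right h h1'] at e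
      exact g_inj hd h.2.1 x h1' y h2' (by linarith)

theorem car_Z : ∀ {T : Tr N}, Valid Z F T → ∀ x ∈ car T, x ∉ Z ∨ ∃ b ∈ F, x ∈ b.1
  | seg p q, h, x, hx => Or.inl (h.2 x hx)
  | box B Q _ _ _ _, h, x, hx => Or.inr ⟨(B, Q), h.1, hx⟩
  | cat s t, h, x, hx => hx.elim (car_Z h.1 x) (car_Z h.2.1 x)

inductive Refines : Tr N → Tr N → Prop
  | seg (p q) : Refines (seg p q) (seg p q)
  | box (B Q a b y y' T') (h1 : st T' = a) (h2 : en T' = b) (h3 : car T' ⊆ B) :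
      Refines (box B Q a b y y') T'
  | cat (s t s' t') (h1 : Refines s s') (h2 : Refines t t') : Refines (cat s t) (cat s' t')

theorem Refines.st_eq {T T' : Tr N} (h : Refines T T') : st T' = st T := by
  induction h with
  | seg => rfl
  | box B Q a b y y' T' h1 h2 h3 => exact h1
  | cat s t s' t' _ _ h1 h2 => exact h1

theorem Refines.en_eq {T T' : Tr N} (h : Refines T T') : en T' = en T := by
  induction h with
  | seg => rfl
  | box B Q a b y y' T' h1 h2 h3 => exact h2
  | cat s t s' t' _ _ h1 h2 => exact h2

theorem Refines.car_subset {T T' : Tr N} (h : Refines T T') : car T' ⊆ car T := by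
  induction h with
  | seg => exact Subset.rfl
  | box B Q a b y y' T' h1 h2 h3 => exact h3
  | cat s t s' t' _ _ h1 h2 => exact union_subset_union h1 h2

theorem Refines.mono {F' : Set (Set (CN N) × Set (CN N))} {T T' : Tr N} (h : Refines T T')
    (hT : Valid Z F T) (hT' : Valid Z F' T') :
    ∀ x ∈ car T', ∀ y ∈ car T', g T x < g T y → g T' x < g T' y := by
  induction h with
  | seg => exact fun x _ y _ h => h
  | box B Q a b y y' T' h1 h2 h3 => intro x _ y _ h; exact absurd h (lt_irrefl _)
  | cat s t s' t' hs ht ihs iht =>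
    have ihs := ihs hT.1 hT'.1
    have iht := iht hT.2.1 hT'.2.1
    have key : ∀ x ∈ car (Tr.cat s' t'), x ∈ car s → x ∈ car s' := by
      intro x hx hxs
      rcases hx with hx | hx
      · exact hx
      · have := hT.2.2.2 x hxs (ht.car_subset hx)
        rw [this, ← hs.en_eq]; exact en_mem hT'.1
    intro x hx y hy hlt
    by_cases hxs : x ∈ car s <;> by_cases hys : y ∈ car s
    · rw [g_cat_left hxs, g_cat_left hys] at hlt
      rw [g_cat_left (key x hx hxs), g_cat_left (key y hy hys)]
      exact ihs x (key x hx hxs) y (key y hy hys) hlt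
    · have hx' := key x hx hxs
      have hy' : y ∈ car t' := hy.resolve_left fun h => hys (hs.car_subset h)
      rw [g_cat_left hxs, g_cat_right hT (ht.car_subset hy')] at hlt
      rw [g_cat_left hx', g_cat_right hT' hy']
      have b1 := g_le hT'.1 x hx'
      have b2 := g_nonneg t' y
      rcases lt_or_ge (g s x) (len s) with h1 | h1
      · have := ihs x hx' (en s') (en_mem hT'.1) (by rw [hs.en_eq, g_en hT.1]; exact h1)
        rw [g_en hT'.1] at this
        linarith
      · have := iht (st t') (st_mem hT'.2.1) y hy' (by rw [ht.st_eq, g_st hT.2.1]; linarith)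
        rw [g_st hT'.2.1] at this
        linarith
    · exfalso
      have hx' : x ∈ car t' := hx.resolve_left fun h => hxs (hs.car_subset h)
      rw [g_cat_left hys, g_cat_right hT (ht.car_subset hx')] at hlt
      linarith [g_le hT.1 y hys, g_nonneg t x]
    · have hx' : x ∈ car t' := hx.resolve_left fun h => hxs (hs.car_subset h)
      have hy' : y ∈ car t' := hy.resolve_left fun h => hys (hs.car_subset h)
      rw [g_cat_right hT (ht.car_subset hx'), g_cat_right hT (ht.car_subset hy')] at hlt
      rw [g_cat_right hT' hx', g_cat_right hT' hy']
      linarith [iht x hx' y hy' (by linarith)]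

end Tr

end partl

section partm

variable {N : ℕ}

theorem first_hit {p q : CN N} {F : Set (CN N)} (hF : IsClosed F)
    (hne : (segment ℝ p q ∩ F).Nonempty) :
    ∃ h ∈ segment ℝ p q, h ∈ F ∧ segment ℝ p h ⊆ segment ℝ p q ∧
      ∀ x ∈ segment ℝ p h, x ∈ F → x = h := by
  obtain ⟨h, hh, hmin⟩ := ((isCompact_seg p q).inter_right hF).exists_isMinOn hne
    (f := fun x => dist p x) (by fun_prop)
  have hsub : segment ℝ p h ⊆ segment ℝ p q :=
    (convex_segment p q).segment_subset (left_mem_segment ℝ p q) hh.1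
  refine ⟨h, hh.1, hh.2, hsub, fun x hx hxF => ?_⟩
  have h1 : dist p h ≤ dist p x := hmin ⟨hsub hx, hxF⟩
  have h2 := Tr.dist_seg_le hx
  exact dist_eq_zero.1 (le_antisymm (by linarith) dist_nonneg)

theorem trunc {Z F : Set (CN N)} (hF : IsClosed F) : ∀ {T : Tr N}, T.Valid Z ∅ →
    T.st ∉ F → (T.car ∩ F).Nonempty → ∃ T' : Tr N, T'.Valid Z ∅ ∧ T'.st = T.st ∧
      T'.car ⊆ T.car ∧ T'.en ∈ F ∧ ∀ x ∈ T'.car, x ∈ F → x = T'.en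
  | .seg p q, h, hst, hne => by
    obtain ⟨y, hy, hyF, hsub, hx⟩ := first_hit hF hne
    refine ⟨.seg p y, ⟨?_, fun z hz => h.2 z (hsub hz)⟩, rfl, hsub, hyF, hx⟩
    rintro rfl; exact hst hyF
  | .box _ _ _ _ _ _, h, _, _ => absurd h.1 (notMem_empty _)
  | .cat s t, h, hst, hne => by
    by_cases hs : (s.car ∩ F).Nonempty
    · obtain ⟨T', h1, h2, h3, h4⟩ := trunc hF h.1 hst hs
      exact ⟨T', h1, h2, h3.trans subset_union_left, h4⟩
    · rw [not_nonempty_iff_eq_empty] at hs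
      have hsF : ∀ x ∈ s.car, x ∉ F := fun x hx hxF => by
        have : x ∈ s.car ∩ F := ⟨hx, hxF⟩
        rw [hs] at this; exact this
      have ht : (t.car ∩ F).Nonempty := by
        obtain ⟨x, hx, hxF⟩ := hne
        exact ⟨x, hx.resolve_left fun h => hsF x h hxF, hxF⟩
      obtain ⟨T', h1, h2, h3, h4, h5⟩ := trunc hF h.2.1
        (h.2.2.1 ▸ hsF _ (Tr.en_mem h.1)) ht
      refine ⟨.cat s T', ⟨h.1, h1, h2 ▸ h.2.2.1, fun x hx hx' => h.2.2.2 x hx (h3 hx')⟩, rfl,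
        union_subset_union_right _ h3, h4, ?_⟩
      rintro x (hx | hx) hxF
      · exact absurd hxF (hsF x hx)
      · exact h5 x hx hxF

/-- accessibility -/
def Acc' (Z V : Set (CN N)) (a : CN N) : Prop :=
  ∃ c, c ≠ a ∧ (∀ x ∈ segment ℝ a c, x ≠ a → x ∈ V) ∧ ∀ x ∈ segment ℝ a c, x ∉ Z

theorem Acc'.shorten {Z V C : Set (CN N)} {a : CN N} (h : Acc' Z V a) (hC : IsClosed C)
    (ha : a ∉ C) : Acc' Z (V \ C) a := by
  obtain ⟨c, hca, hV, hZ⟩ := h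
  have hcont : Continuous fun t : ℝ => AffineMap.lineMap a c t := AffineMap.lineMap_continuous
  have h0 : ∀ᶠ t : ℝ in 𝓝 0, AffineMap.lineMap a c t ∉ C := by
    have h1 : AffineMap.lineMap a c (0:ℝ) ∈ Cᶜ := by
      rw [AffineMap.lineMap_apply_zero]; exact ha
    exact hcont.continuousAt.preimage_mem_nhds (hC.isOpen_compl.mem_nhds h1)
  obtain ⟨r, hr, hr'⟩ := Metric.eventually_nhds_iff.1 h0
  set t0 := min (r/2) 1 with ht0
  have ht0p : 0 < t0 := lt_min (by positivity) one_pos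
  have hmem : AffineMap.lineMap a c t0 ∈ segment ℝ a c := by
    rw [segment_eq_image_lineMap]; exact ⟨t0, ⟨ht0p.le, min_le_right _ _⟩, rfl⟩
  have hsub : segment ℝ a (AffineMap.lineMap a c t0) ⊆ segment ℝ a c :=
    (convex_segment a c).segment_subset (left_mem_segment ℝ a c) hmem
  refine ⟨AffineMap.lineMap a c t0, ?_, fun x hx hxa => ⟨hV x (hsub hx) hxa, ?_⟩,
    fun x hx => hZ x (hsub hx)⟩
  · intro h
    rw [AffineMap.lineMap_eq_left_iff] at h
    rcases h with h | h
    · exact hca h.symm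
    · exact ht0p.ne' h
  · rw [segment_eq_image_lineMap] at hx
    obtain ⟨s, hs, rfl⟩ := hx
    have e : AffineMap.lineMap a (AffineMap.lineMap a c t0) s =
      (AffineMap.lineMap a c (s * t0) : CN N) := by
      simp [AffineMap.lineMap_apply, smul_smul]
    rw [e]
    apply hr'
    rw [Real.dist_eq, sub_zero, abs_of_nonneg (mul_nonneg hs.1 ht0p.le)]
    have := min_le_left (r/2) 1
    nlinarith [hs.2]

theorem Acc'.notMem {Z V : Set (CN N)} {a : CN N} (h : Acc' Z V a) : a ∉ Z := by
  obtain ⟨c, _, _, h⟩ := h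
  exact h a (left_mem_segment ℝ a c)

theorem GZ.dense {Z : Set (CN N)} (hZ : GZ Z) {p : CN N} (hp : p ∉ Z) : Dense Zᶜ := by
  intro x
  rw [mem_closure_iff_nhds]
  intro t ht
  have hcont : Continuous fun τ : ℂ => p + τ • (x - p) := by fun_prop
  have h1 : (fun τ : ℂ => p + τ • (x - p)) ⁻¹' t ∈ 𝓝 (1:ℂ) := by
    apply hcont.continuousAt
    simpa using ht
  have h2 := (hZ p hp (x - p)).dense_compl ℝ
  obtain ⟨τ, hτ1, hτ2⟩ := mem_closure_iff_nhds.1 (h2 1) _ h1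
  exact ⟨_, hτ1, hτ2⟩

theorem wiggle {Z D : Set (CN N)} (hZ : GZ Z) (hD : IsOpen D) (hc : Convex ℝ D) {p y : CN N}
    (hp : p ∈ D) (hpZ : p ∉ Z) (hy : y ∈ D) (hyZ : y ∉ Z) :
    ∃ w ∈ D, (∀ x ∈ segment ℝ p w, x ∉ Z) ∧ ∀ x ∈ segment ℝ w y, x ∉ Z := by
  have hA := hZ p hpZ (y - p)
  set A := {t : ℂ | p + t • (y - p) ∈ Z} with hAd
  let w : ℝ → CN N := fun s => p + (⟨1/2, s⟩ : ℂ) • (y - p)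
  have hbad : ((fun τ : ℂ => τ.im / (2 * τ.re)) '' A ∪
    (fun τ : ℂ => τ.im / (2 * (1 - τ.re))) '' A).Countable := (hA.image _).union (hA.image _)
  have hwc : Continuous w := by
    have : Continuous fun s : ℝ => (⟨1/2, s⟩ : ℂ) := by
      have : (fun s : ℝ => (⟨1/2, s⟩ : ℂ)) = fun s : ℝ => (1/2 : ℂ) + s * Complex.I := by
        funext s; apply Complex.ext <;> simp
      rw [this]; fun_prop
    fun_prop
  have hw0 : w 0 ∈ D := by
    have : w 0 = (1/2:ℝ) • p + (1/2:ℝ) • y := by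
      have e : (⟨1/2, 0⟩ : ℂ) = ((1/2 : ℝ) : ℂ) := rfl
      ext i
      simp only [w, e, Pi.add_apply, Pi.smul_apply, Pi.sub_apply, smul_eq_mul, Complex.real_smul]
      push_cast; ring
    rw [this]
    exact hc hp hy (by norm_num) (by norm_num) (by norm_num)
  have h1 : w ⁻¹' D ∈ 𝓝 (0:ℝ) := hwc.continuousAt (hD.mem_nhds hw0)
  obtain ⟨s, hs1, hs2⟩ := mem_closure_iff_nhds.1 ((hbad.dense_compl ℝ) 0) _ h1
  refine ⟨w s, hs1, fun x hx hxZ => ?_, fun x hx hxZ => ?_⟩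
  · rw [segment_eq_image'] at hx
    obtain ⟨θ, hθ, rfl⟩ := hx
    change p + θ • (w s - p) ∈ Z at hxZ
    have e : p + θ • (w s - p) = p + ((θ:ℂ) * ⟨1/2, s⟩) • (y - p) := by
      ext i
      simp only [w, Pi.add_apply, Pi.smul_apply, Pi.sub_apply, smul_eq_mul, Complex.real_smul]
      ring
    rw [e] at hxZ
    apply hs2
    left
    refine ⟨(θ:ℂ) * ⟨1/2, s⟩, hxZ, ?_⟩
    have hθ0 : θ ≠ 0 := by
      rintro rfl
      apply hpZ; simpa using hxZ
    simp
    field_simp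
  · rw [segment_symm, segment_eq_image'] at hx
    obtain ⟨θ, hθ, rfl⟩ := hx
    change y + θ • (w s - y) ∈ Z at hxZ
    have e : y + θ • (w s - y) = p + (1 - (θ:ℂ) * (1 - ⟨1/2, s⟩)) • (y - p) := by
      ext i
      simp only [w, Pi.add_apply, Pi.smul_apply, Pi.sub_apply, smul_eq_mul, Complex.real_smul]
      ring
    rw [e] at hxZ
    apply hs2
    right
    refine ⟨_, hxZ, ?_⟩
    have hθ0 : θ ≠ 0 := by
      rintro rfl
      apply hyZ; simpa using hxZ
    simp
    field_simp
    ring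

theorem extend_tree {Z V : Set (CN N)} {a p y : CN N} (ha : a ∉ V) {T : Tr N}
    (hT : T.Valid Z ∅) (hst : T.st = a) (hen : T.en = p) (hcar : T.car ⊆ insert a V)
    (hseg : ∀ x ∈ segment ℝ p y, x ∈ V) (hZ : ∀ x ∈ segment ℝ p y, x ∉ Z) :
    ∃ T' : Tr N, T'.Valid Z ∅ ∧ T'.st = a ∧ T'.en = y ∧ T'.car ⊆ insert a V := by
  obtain ⟨T', h1, h2, h3, h4, h5⟩ := trunc (isCompact_seg p y).isClosed hT
    (by rw [hst]; exact fun h => ha (hseg a h)) ⟨p, hen ▸ Tr.en_mem hT, left_mem_segment ℝ p y⟩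
  by_cases he : T'.en = y
  · exact ⟨T', h1, h2.trans hst, he, h3.trans hcar⟩
  · have hsub : segment ℝ T'.en y ⊆ segment ℝ p y :=
      (convex_segment p y).segment_subset h4 (right_mem_segment ℝ p y)
    refine ⟨.cat T' (.seg T'.en y), ⟨h1, ⟨he, fun z hz => hZ z (hsub hz)⟩, rfl,
      fun x hx hx' => h5 x hx (hsub hx')⟩, h2.trans hst, rfl, ?_⟩
    exact union_subset (h3.trans hcar) fun x hx => Or.inr (hseg x (hsub hx))

theorem connect {Z V : Set (CN N)} (hZ : GZ Z) (hV : IsOpen V) (hVc : IsPreconnected V)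
    {a b : CN N} (hab : a ≠ b) (ha : a ∉ V) (hb : b ∉ V) (haa : Acc' Z V a) (hba : Acc' Z V b) :
    ∃ T : Tr N, T.Valid Z ∅ ∧ T.st = a ∧ T.en = b ∧ T.car ⊆ insert a (insert b V) := by
  have haZ := haa.notMem
  have hdense := hZ.dense haZ
  obtain ⟨ca, hca, hca1, hca2⟩ := haa
  obtain ⟨cb, hcb, hcb1, hcb2⟩ := hba
  have hcaV : ca ∈ V := hca1 ca (right_mem_segment ℝ a ca) hca
  have hcbV : cb ∈ V := hcb1 cb (right_mem_segment ℝ b cb) hcb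
  let R : Set (CN N) := {x | ∃ T : Tr N, T.Valid Z ∅ ∧ T.st = a ∧ T.en = x ∧ T.car ⊆ insert a V}
  have hcaR : ca ∈ R := ⟨.seg a ca, ⟨hca.symm, hca2⟩, rfl, rfl, fun x hx => by
    by_cases h : x = a
    · exact Or.inl h
    · exact Or.inr (hca1 x hx h)⟩
  have hball : ∀ D : Set (CN N), IsOpen D → Convex ℝ D → D ⊆ V → ∀ p ∈ D, p ∈ R → p ∉ Z →
      D \ Z ⊆ R := by
    rintro D hDo hDc hDV p hpD ⟨T, h1, h2, h3, h4⟩ hpZ y ⟨hy, hyZ⟩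
    obtain ⟨w, hw, hw1, hw2⟩ := wiggle hZ hDo hDc hpD hpZ hy hyZ
    obtain ⟨T', h1', h2', h3', h4'⟩ := extend_tree ha h1 h2 h3 h4
      (fun x hx => hDV (hDc.segment_subset hpD hw hx)) hw1
    exact extend_tree ha h1' h2' h3' h4' (fun x hx => hDV (hDc.segment_subset hw hy hx)) hw2
  let u : Set (CN N) := interior {x | x ∉ Z → x ∈ R}
  have hu : V ⊆ u := by
    refine hVc.subset_of_closure_inter_subset isOpen_interior ⟨ca, hcaV, ?_⟩ ?_
    · obtain ⟨r, hr, hrV⟩ := Metric.isOpen_iff.1 hV ca hcaV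
      refine mem_interior.2 ⟨Metric.ball ca r, fun x hx hxZ => ?_, Metric.isOpen_ball,
        Metric.mem_ball_self hr⟩
      exact hball _ Metric.isOpen_ball (convex_ball _ _) hrV ca (Metric.mem_ball_self hr) hcaR
        (hca2 ca (right_mem_segment ℝ a ca)) ⟨hx, hxZ⟩
    · rintro x ⟨hxu, hxV⟩
      obtain ⟨r, hr, hrV⟩ := Metric.isOpen_iff.1 hV x hxV
      obtain ⟨p0, hp0, hp0u⟩ := mem_closure_iff.1 hxu _ Metric.isOpen_ball (Metric.mem_ball_self hr)
      obtain ⟨p, ⟨hp, hpu⟩, hpZ⟩ := hdense.inter_open_nonempty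
        (Metric.ball x r ∩ u) (Metric.isOpen_ball.inter isOpen_interior) ⟨p0, hp0, hp0u⟩
      have hpR : p ∈ R := (interior_subset hpu : _ → _) hpZ
      refine mem_interior.2 ⟨Metric.ball x r, fun y hy hyZ => ?_, Metric.isOpen_ball,
        Metric.mem_ball_self hr⟩
      exact hball _ Metric.isOpen_ball (convex_ball _ _) hrV p hp hpR hpZ ⟨hy, hyZ⟩
  have hcbR : cb ∈ R := (interior_subset (hu hcbV) : _ → _) (hcb2 cb (right_mem_segment ℝ b cb))
  obtain ⟨T, h1, h2, h3, h4⟩ := hcbR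
  have haF : a ∉ segment ℝ b cb := fun h => ha (hcb1 a h hab)
  obtain ⟨T', h1', h2', h3', h4', h5'⟩ := trunc (isCompact_seg b cb).isClosed h1
    (by rw [h2]; exact haF) ⟨cb, h3 ▸ Tr.en_mem h1, right_mem_segment ℝ b cb⟩
  have hsub : segment ℝ T'.en b ⊆ segment ℝ b cb :=
    (convex_segment b cb).segment_subset h4' (left_mem_segment ℝ b cb)
  have hbe : T'.en ≠ b := by
    intro h
    have := h4 (h3' (Tr.en_mem h1'))
    rw [h] at this
    exact this.elim (fun h => hab h.symm) hb
  refine ⟨.cat T' (.seg T'.en b), ⟨h1', ⟨hbe, fun z hz => hcb2 z (hsub hz)⟩, rfl,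
    fun x hx hx' => h5' x hx (hsub hx')⟩, h2'.trans h2, rfl, ?_⟩
  refine union_subset ?_ fun x hx => ?_
  · intro x hx
    rcases h4 (h3' hx) with h | h
    · exact Or.inl h
    · exact Or.inr (Or.inr h)
  · by_cases h : x = b
    · exact Or.inr (Or.inl h)
    · exact Or.inr (Or.inr (hcb1 x (hsub hx) h))

theorem rank_CN (hN : 1 ≤ N) : 1 < Module.rank ℝ (CN N) := by
  have h : Module.finrank ℝ (CN N) = N * 2 := by
    have := Module.finrank_pi_fintype ℝ (ι := Fin N) (M := fun _ => ℂ)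
    simpa [Complex.finrank_real_complex] using this
  rw [← Module.finrank_eq_rank, h]
  have : 1 < N * 2 := by omega
  exact_mod_cast this

theorem slit_tree (hN : 1 ≤ N) {Z : Set (CN N)} : ∀ {T : Tr N}, T.Valid Z ∅ → ∀ {W : Set (CN N)},
    IsOpen W → IsPreconnected W → T.st ∉ W → (∀ x ∈ T.car, x ≠ T.st → x ∈ W) →
      IsPreconnected (W \ T.car)
  | .seg p q, h, W, hW, hWc, hst, hsub =>
    slit_preconnected (rank_CN hN) hW hWc hst h.1 hsub
  | .box _ _ _ _ _ _, h, _, _, _, _, _ => absurd h.1 (notMem_empty _)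
  | .cat s t, h, W, hW, hWc, hst, hsub => by
    have hc := (Tr.car_compact (by simp) h.1).isClosed
    have h1 := slit_tree hN h.1 hW hWc hst fun x hx hne => hsub x (Or.inl hx) hne
    have h2 := slit_tree hN h.2.1 (hW.sdiff hc) h1 (fun h' => h'.2 (h.2.2.1 ▸ Tr.en_mem h.1))
      fun x hx hne => ⟨hsub x (Or.inr hx) (fun e => Tr.st_notMem_right h (e ▸ hx)), fun hxs =>
        hne (h.2.2.1 ▸ h.2.2.2 x hxs hx)⟩
    have e : W \ (Tr.cat s t).car = (W \ s.car) \ t.car := by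
      rw [sdiff_sdiff]; rfl
    rw [e]; exact h2

theorem two_rays (hN : 1 ≤ N) {Z : Set (CN N)} (hZ : GZ Z) {c : CN N} (hc : c ∉ Z) :
    ∃ v w : CN N, v ≠ 0 ∧ w ≠ 0 ∧ (∀ s t : ℝ, 0 < s → s • v ≠ t • w) ∧
      (∀ t : ℝ, 0 ≤ t → c + t • v ∉ Z) ∧ (∀ t : ℝ, 0 ≤ t → c + t • w ∉ Z) := by
  let v0 : CN N := fun _ => 1
  have hA := hZ c hc v0
  have hbad := hA.image fun τ : ℂ => τ.im / τ.re
  obtain ⟨s, hs⟩ := (hbad.dense_compl ℝ).nonempty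
  obtain ⟨s', hs'⟩ := ((hbad.union (countable_singleton s)).dense_compl ℝ).nonempty
  have hray : ∀ s : ℝ, s ∉ (fun τ : ℂ => τ.im / τ.re) '' {t : ℂ | c + t • v0 ∈ Z} →
      ∀ t : ℝ, 0 ≤ t → c + t • (fun _ => (⟨1, s⟩ : ℂ) : CN N) ∉ Z := by
    intro s hs t ht hmem
    have e : c + t • (fun _ => (⟨1, s⟩ : ℂ) : CN N) = c + ((t:ℂ) * ⟨1, s⟩) • v0 := by
      ext i; simp [v0]
    rw [e] at hmem
    have ht0 : t ≠ 0 := by rintro rfl; apply hc; simpa using hmem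
    apply hs
    refine ⟨_, hmem, ?_⟩
    simp
    field_simp
  refine ⟨fun _ => ⟨1, s⟩, fun _ => ⟨1, s'⟩, ?_, ?_, ?_, hray s hs,
    hray s' fun h => hs' (Or.inl h)⟩
  · intro h
    have := congrArg Complex.re (congrFun h ⟨0, hN⟩)
    simp at this
  · intro h
    have := congrArg Complex.re (congrFun h ⟨0, hN⟩)
    simp at this
  · intro x y hx h
    have h1 := congrArg Complex.re (congrFun h ⟨0, hN⟩)
    have h2 := congrArg Complex.im (congrFun h ⟨0, hN⟩)
    simp at h1 h2
    subst h1
    apply hs'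
    right
    exact (mul_left_cancel₀ hx.ne' h2).symm


end partm

section partn

variable {N : ℕ}

theorem exit_point {B : Set (CN N)} (hB : Convex ℝ B) (hBk : IsCompact B) {c v : CN N}
    (hc : c ∈ interior B) (hv : v ≠ 0) :
    ∃ T : ℝ, 0 < T ∧ c + T • v ∈ B ∧ c + T • v ∉ interior B ∧
      (∀ t : ℝ, 0 ≤ t → t < T → c + t • v ∈ interior B) ∧ ∀ t : ℝ, T < t → c + t • v ∉ B := by
  have hcont : Continuous fun t : ℝ => c + t • v := by fun_prop
  have hvn : 0 < ‖v‖ := norm_pos_iff.2 hv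
  let S : Set ℝ := {t | 0 ≤ t ∧ c + t • v ∈ B}
  have hScl : IsClosed S := isClosed_Ici.inter (hBk.isClosed.preimage hcont)
  obtain ⟨M, hM⟩ := hBk.isBounded.subset_closedBall c
  have hSb : S ⊆ Icc 0 (M / ‖v‖) := by
    intro t ht
    refine ⟨ht.1, ?_⟩
    rw [le_div_iff₀ hvn]
    have := hM ht.2
    rw [Metric.mem_closedBall, dist_self_add_left, norm_smul, Real.norm_eq_abs,
      abs_of_nonneg ht.1] at this
    exact this
  have hSk : IsCompact S := isCompact_Icc.of_isClosed_subset hScl hSb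
  have hS0 : (0:ℝ) ∈ S := ⟨le_rfl, by simpa using interior_subset hc⟩
  obtain ⟨T, hT, hmax⟩ := hSk.exists_isMaxOn ⟨0, hS0⟩ (f := fun t : ℝ => t) continuousOn_id
  have hlast : ∀ t : ℝ, T < t → c + t • v ∉ B := by
    intro t ht hmem
    have : t ≤ T := hmax (⟨hT.1.trans ht.le, hmem⟩ : t ∈ S)
    linarith
  have hnint : ∀ t : ℝ, c + t • v ∈ interior B → ∃ t' > t, c + t' • v ∈ B := by
    intro t ht
    have h1 : ∀ᶠ s in 𝓝 t, c + s • v ∈ interior B :=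
      hcont.continuousAt.preimage_mem_nhds (isOpen_interior.mem_nhds ht)
    obtain ⟨s, hs, hst⟩ := ((h1.filter_mono nhdsWithin_le_nhds).and
      (self_mem_nhdsWithin : Ioi t ∈ 𝓝[>] t)).exists
    exact ⟨s, hst, interior_subset hs⟩
  have hTn : c + T • v ∉ interior B := by
    intro h
    obtain ⟨t', ht', hm⟩ := hnint T h
    exact hlast t' ht' hm
  have hTpos : 0 < T := by
    rcases hT.1.lt_or_eq with h | h
    · exact h
    · exfalso; apply hTn; rw [← h]; simpa using hc
  refine ⟨T, hTpos, hT.2, hTn, fun t ht htT => ?_, hlast⟩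
  rcases ht.lt_or_eq with h | h
  · apply hB.openSegment_interior_closure_subset_interior hc (subset_closure hT.2)
    refine ⟨1 - t / T, t / T, ?_, by positivity, by ring, ?_⟩
    · rw [sub_pos, div_lt_one hTpos]; exact htT
    · rw [smul_add, smul_smul, div_mul_cancel₀ _ hTpos.ne', ← add_assoc, ← add_smul]
      simp
  · rw [← h]; simpa using hc

theorem proj_mem {B : Set (CN N)} (hBc : Convex ℝ B) (hBk : IsCompact B) {c x : CN N}
    (hc : c ∈ interior B) (hx : x ∈ B) (hxc : x ≠ c) :
    ∃ r : ℝ, 0 < r ∧ r ≤ 1 ∧ gauge ((fun y => c + y) ⁻¹' B) (x - c) = r ∧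
      c + r⁻¹ • (x - c) ∈ B := by
  set B0 : Set (CN N) := (fun y => c + y) ⁻¹' B with hB0
  have hB0c : Convex ℝ B0 := hBc.translate_preimage_right c
  have hcont : Continuous fun y : CN N => c + y := by fun_prop
  have hB0cl : IsClosed B0 := hBk.isClosed.preimage hcont
  have hB0n : B0 ∈ 𝓝 (0 : CN N) := by
    apply hcont.continuousAt.preimage_mem_nhds
    simpa using mem_interior_iff_mem_nhds.1 hc
  have hB0k : IsCompact B0 := (Homeomorph.addLeft c).isCompact_preimage.2 hBk
  have hB0b : Bornology.IsVonNBounded ℝ B0 := hB0k.isVonNBounded ℝ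
  have hpos : 0 < gauge B0 (x - c) :=
    (gauge_pos (absorbent_nhds_zero hB0n) hB0b).2 (sub_ne_zero.2 hxc)
  refine ⟨gauge B0 (x - c), hpos, ?_, rfl, ?_⟩
  · apply gauge_le_one_of_mem
    simpa [hB0] using hx
  · have h1 : (gauge B0 (x - c))⁻¹ • (x - c) ∈ closure B0 :=
      (gauge_le_one_iff_mem_closure hB0c hB0n).1 (by
        rw [gauge_smul_of_nonneg (inv_nonneg.2 hpos.le), smul_eq_mul, inv_mul_cancel₀ hpos.ne'])
    exact hB0cl.closure_subset h1

theorem remove_boxes (hN : 1 ≤ N) : ∀ (L : List (Set (CN N) × Set (CN N))) (U : Set (CN N)),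
    IsOpen U → IsPreconnected U → Uᶜ.Nonempty → (∀ b ∈ L, Convex ℝ b.1) →
    (∀ b ∈ L, IsCompact b.1) → (∀ b ∈ L, (interior b.1).Nonempty) → (∀ b ∈ L, b.1 ⊆ U) →
    L.Pairwise (fun b b' => Disjoint b.1 b'.1) → IsPreconnected (U \ ⋃ b ∈ L, b.1)
  | [], U, _, hc, _, _, _, _, _, _ => by simpa using hc
  | b :: L, U, ho, hc, hne, h1, h2, h3, h4, h5 => by
    rw [List.pairwise_cons] at h5
    have e : U \ ⋃ x ∈ b :: L, x.1 = (U \ b.1) \ ⋃ x ∈ L, x.1 := by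
      rw [sdiff_sdiff]
      congr 1
      ext z; simp
    rw [e]
    obtain ⟨c, hcb⟩ := h3 b (by simp)
    have hb2 := h2 b (by simp)
    have hb1 := h1 b (by simp)
    have hb4 := h4 b (by simp)
    have hbc : IsPreconnected (U \ b.1) := by
      refine body_removal ho hne hb1 hb2 hcb (mem_singleton c)
        (singleton_subset_iff.2 (interior_subset hcb)) (point_removal (rank_CN hN) ho hc c) ?_
      rintro x ⟨hx, hxc⟩
      obtain ⟨r, _, _, hr, hm⟩ := proj_mem hb1 hb2 hcb hx hxc
      rw [hr]; exact hb4 hm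
    refine remove_boxes hN L (U \ b.1) (ho.sdiff hb2.isClosed) hbc
      (hne.mono (compl_subset_compl.2 sdiff_subset)) (fun x hx => h1 x (by simp [hx]))
      (fun x hx => h2 x (by simp [hx])) (fun x hx => h3 x (by simp [hx])) ?_ h5.2
    intro x hx z hz
    exact ⟨h4 x (by simp [hx]) hz, fun hzb => disjoint_left.1 (h5.1 x hx) hzb hz⟩

/-- points of a segment from an exit point back to the centre -/
theorem mem_seg_ray {c v z : CN N} {T : ℝ} (hT : 0 < T) (hz : z ∈ segment ℝ (c + T • v) c) :
    ∃ t : ℝ, 0 ≤ t ∧ t ≤ T ∧ z = c + t • v := by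
  rw [segment_symm, segment_eq_image'] at hz
  obtain ⟨θ, hθ, rfl⟩ := hz
  refine ⟨θ * T, mul_nonneg hθ.1 hT.le, by nlinarith [hθ.2], ?_⟩
  simp [smul_smul]

theorem ray_acc {Z U B : Set (CN N)} {c v : CN N} {T : ℝ} (hU : IsOpen U) (hB : IsClosed B)
    (hv : v ≠ 0) (hZ : ∀ t : ℝ, 0 ≤ t → c + t • v ∉ Z) (hT : 0 < T)
    (hlast : ∀ t : ℝ, T < t → c + t • v ∉ B) (hm : c + T • v ∈ U) :
    Acc' Z (U \ B) (c + T • v) := by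
  have hcont : Continuous fun t : ℝ => c + t • v := by fun_prop
  have h1 : (fun t : ℝ => c + t • v) ⁻¹' U ∈ 𝓝 T :=
    hcont.continuousAt.preimage_mem_nhds (hU.mem_nhds hm)
  obtain ⟨r, hr, hrU⟩ := Metric.mem_nhds_iff.1 h1
  refine ⟨c + (T + r/2) • v, ?_, ?_, ?_⟩
  · intro h
    have h2 := add_left_cancel h
    have h3 := smul_left_injective ℝ hv h2
    simp at h3; linarith
  · intro x hx hne
    rw [segment_eq_image'] at hx
    obtain ⟨θ, hθ, rfl⟩ := hx
    have e : c + T • v + θ • (c + (T + r/2) • v - (c + T • v)) = c + (T + θ * (r/2)) • v := by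
      module
    change c + T • v + θ • (c + (T + r/2) • v - (c + T • v)) ≠ c + T • v at hne
    change c + T • v + θ • (c + (T + r/2) • v - (c + T • v)) ∈ U \ B
    rw [e] at hne ⊢
    have hθ0 : 0 < θ := by
      rcases hθ.1.lt_or_eq with h | h
      · exact h
      · exfalso; apply hne; rw [← h]; simp
    refine ⟨?_, hlast _ (by nlinarith)⟩
    apply hrU
    rw [Metric.mem_ball, Real.dist_eq, add_sub_cancel_left, abs_of_nonneg (by positivity)]
    nlinarith [hθ.2]
  · intro x hx
    rw [segment_eq_image'] at hx
    obtain ⟨θ, hθ, rfl⟩ := hx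
    have e : c + T • v + θ • (c + (T + r/2) • v - (c + T • v)) = c + (T + θ * (r/2)) • v := by
      module
    change c + T • v + θ • (c + (T + r/2) • v - (c + T • v)) ∉ Z
    rw [e]
    apply hZ
    have := hθ.1
    positivity

theorem box_valid {Z K B Q : Set (CN N)} {η : ℝ} {F : Set (Set (CN N) × Set (CN N))}
    (hF : Level K η F) (hBQ : (B, Q) ∈ F) {c v w : CN N} (hc : c ∈ Q) {S T : ℝ} (hS : 0 < S)
    (hT : 0 < T) (hw : w ≠ 0) (hvw : ∀ s t : ℝ, 0 < s → s • v ≠ t • w)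
    (hvZ : ∀ t : ℝ, 0 ≤ t → c + t • v ∉ Z) (hwZ : ∀ t : ℝ, 0 ≤ t → c + t • w ∉ Z)
    (hS1 : c + S • v ∈ B) (hS2 : c + S • v ∉ interior B)
    (hS3 : ∀ t : ℝ, 0 ≤ t → t < S → c + t • v ∈ interior B)
    (hT1 : c + T • w ∈ B) (hT2 : c + T • w ∉ interior B)
    (hT3 : ∀ t : ℝ, 0 ≤ t → t < T → c + t • w ∈ interior B) :
    ∃ y y', (Tr.box B Q (c + S • v) (c + T • w) y y').Valid Z F := by
  have hQc := (hF.qcomp _ hBQ).isClosed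
  obtain ⟨y, hy, hyQ, hsub, hyu⟩ := first_hit hQc
    ⟨c, right_mem_segment ℝ (c + S • v) c, hc⟩
  obtain ⟨y', hy', hyQ', hsub', hyu'⟩ := first_hit hQc
    ⟨c, right_mem_segment ℝ (c + T • w) c, hc⟩
  refine ⟨y, y', hBQ, fun h => hvw S T hS (add_left_cancel h), hS1, hT1, hS2, hT2, hyQ, hyQ',
    hyu, hyu', ?_, ?_, ?_, ?_, ?_⟩
  · intro z hz hz'
    obtain ⟨s, hs0, hs1, e⟩ := mem_seg_ray hS (hsub hz)
    obtain ⟨t, ht0, ht1, e'⟩ := mem_seg_ray hT (hsub' hz')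
    rcases hs0.lt_or_eq with h | h
    · exact absurd (add_left_cancel (e.symm.trans e')) (hvw s t h)
    · rw [e, ← h]; simpa using hc
  · intro z hz hne
    obtain ⟨s, hs0, hs1, rfl⟩ := mem_seg_ray hS (hsub hz)
    exact hS3 s hs0 (lt_of_le_of_ne hs1 (by rintro rfl; exact hne rfl))
  · intro z hz hne
    obtain ⟨s, hs0, hs1, rfl⟩ := mem_seg_ray hT (hsub' hz)
    exact hT3 s hs0 (lt_of_le_of_ne hs1 (by rintro rfl; exact hne rfl))
  · intro z hz
    obtain ⟨s, hs0, hs1, rfl⟩ := mem_seg_ray hS (hsub hz)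
    exact hvZ s hs0
  · intro z hz
    obtain ⟨s, hs0, hs1, rfl⟩ := mem_seg_ray hT (hsub' hz)
    exact hwZ s hs0

theorem chain (hN : 1 ≤ N) {Z K : Set (CN N)} (hZ : GZ Z) (hKZ : ∀ z ∈ K, z ∉ Z) {η : ℝ}
    {F : Set (Set (CN N) × Set (CN N))} (hF : Level K η F) :
    ∀ (L : List (Set (CN N) × Set (CN N))) (U : Set (CN N)) (a b : CN N),
    (∀ x ∈ L, x ∈ F) → L.Nodup → IsOpen U → IsPreconnected U → (∀ x ∈ L, x.1 ⊆ U) → a ≠ b →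
    a ∉ U → b ∉ U → Acc' Z U a → Acc' Z U b →
    ∃ T : Tr N, T.Valid Z F ∧ T.st = a ∧ T.en = b ∧ T.car ⊆ insert a (insert b U) ∧
      ∀ x ∈ L, x.1 ⊆ T.car
  | [], U, a, b, _, _, hU, hUc, _, hab, ha, hb, haa, hba => by
    obtain ⟨T, h1, h2, h3, h4⟩ := connect hZ hU hUc hab ha hb haa hba
    exact ⟨T, h1.mono (empty_subset _), h2, h3, h4, by simp⟩
  | (B, Q) :: L, U, a, b, hLF, hnd, hU, hUc, hLU, hab, ha, hb, haa, hba => by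
    rw [List.nodup_cons] at hnd
    have hBF : (B, Q) ∈ F := hLF _ (by simp)
    have hBU : B ⊆ U := hLU (B, Q) (by simp)
    have hBc : Convex ℝ B := hF.conv _ hBF
    have hBk : IsCompact B := hF.comp _ hBF
    obtain ⟨c, hcK, hcB⟩ := hF.Kne _ hBF
    have hcQ : c ∈ Q := hF.Kq _ hBF ⟨hcK, hcB⟩
    have hcI : c ∈ interior B := hF.qint _ hBF hcQ
    obtain ⟨v, w, hv, hw, hvw, hvZ, hwZ⟩ := two_rays hN hZ (hKZ c hcK)
    obtain ⟨S, hS0, hS1, hS2, hS3, hS4⟩ := exit_point hBc hBk hcI hv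
    obtain ⟨T, hT0, hT1, hT2, hT3, hT4⟩ := exit_point hBc hBk hcI hw
    obtain ⟨y, y', hbox⟩ := box_valid hF hBF hcQ hS0 hT0 hw hvw hvZ hwZ hS1 hS2 hS3 hT1 hT2 hT3
    have hab1 : c + S • v ≠ c + T • w := fun h => hvw S T hS0 (add_left_cancel h)
    set a1 := c + S • v with ha1
    set b1 := c + T • w with hb1
    have hdisL : ∀ x ∈ L, Disjoint B x.1 := fun x hx =>
      hF.dis (B, Q) hBF x (hLF x (by simp [hx])) (by rintro rfl; exact hnd.1 hx)
    let R : Set (CN N) := ⋃ x ∈ L, x.1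
    have hRc : IsClosed R := by
      have hfin : {x | x ∈ L}.Finite := List.finite_toSet L
      exact hfin.isClosed_biUnion fun x hx => (hF.comp x (hLF x (by simp [show x ∈ L from hx]))).isClosed
    have hBR : Disjoint B R := by
      rw [disjoint_left]
      intro z hz hzR
      simp only [R, mem_iUnion] at hzR
      obtain ⟨x, hx, hzx⟩ := hzR
      exact disjoint_left.1 (hdisL x hx) hz hzx
    have hRU : R ⊆ U := iUnion₂_subset fun x hx => hLU x (by simp [hx])
    let V : Set (CN N) := (U \ R) \ B
    have hVo : IsOpen V := (hU.sdiff hRc).sdiff hBk.isClosed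
    have hVc : IsPreconnected V := by
      have := remove_boxes hN ((B, Q) :: L) U hU hUc ⟨a, ha⟩
        (fun x hx => hF.conv x (hLF x hx)) (fun x hx => hF.comp x (hLF x hx))
        (fun x hx => by
          obtain ⟨z, hz⟩ := hF.Kne x (hLF x hx)
          exact ⟨z, hF.qint x (hLF x hx) (hF.Kq x (hLF x hx) hz)⟩) hLU
        (by
          rw [List.pairwise_cons]
          refine ⟨hdisL, ?_⟩
          refine hnd.2.imp_of_mem fun {x y} hx hy hxy => ?_
          exact hF.dis x (hLF x (by simp [hx])) y (hLF y (by simp [hy])) hxy)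
      have e : U \ ⋃ x ∈ (B, Q) :: L, x.1 = V := by
        change _ = (U \ R) \ B
        rw [sdiff_sdiff]
        congr 1
        ext z; simp [R, or_comm]
      rwa [e] at this
    have hVU : V ⊆ U := fun z hz => hz.1.1
    have ha1U : a1 ∈ U := hBU hS1
    have hb1U : b1 ∈ U := hBU hT1
    have haa1 : a ≠ a1 := by rintro h; exact ha (h ▸ ha1U)
    have ha1R : a1 ∉ R := fun h => disjoint_left.1 hBR hS1 h
    have hb1R : b1 ∉ R := fun h => disjoint_left.1 hBR hT1 h
    have haccV : Acc' Z V a := (haa.shorten hRc fun h => ha (hRU h)).shorten hBk.isClosed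
      fun h => ha (hBU h)
    have hacc1 : Acc' Z V a1 :=
      ray_acc (hU.sdiff hRc) hBk.isClosed hv hvZ hS0 hS4 ⟨ha1U, ha1R⟩
    obtain ⟨α, hα, hα1, hα2, hα3⟩ := connect hZ hVo hVc haa1 (fun h => ha (hVU h))
      (fun h => h.2 hS1) haccV hacc1
    have hαc : IsClosed α.car := (Tr.car_compact (by simp) hα).isClosed
    have hαB : ∀ x ∈ α.car, x ∈ B → x = a1 := by
      intro x hx hxB
      rcases hα3 hx with h | h | h
      · exact absurd (hBU hxB) (h ▸ ha)
      · exact h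
      · exact absurd hxB h.2
    have hαR : ∀ x ∈ α.car, x ∉ R := by
      intro x hx hxR
      rcases hα3 hx with h | h | h
      · exact ha (h ▸ hRU hxR)
      · exact ha1R (h ▸ hxR)
      · exact h.1.2 hxR
    have ha1α : a1 ∈ α.car := hα2 ▸ Tr.en_mem hα
    have hb1α : b1 ∉ α.car := fun h => hab1 (hαB b1 h hT1).symm
    have hbα : b ∉ α.car := by
      intro h
      rcases hα3 h with h | h | h
      · exact hab h.symm
      · exact hb (h ▸ ha1U)
      · exact hb (hVU h)
    -- connectedness of the complement
    have hW1 : IsPreconnected (U \ α.car) := by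
      refine slit_tree hN hα hU hUc (hα1 ▸ ha) fun x hx hne => ?_
      rcases hα3 hx with h | h | h
      · exact absurd (h.trans hα1.symm) hne
      · exact h ▸ ha1U
      · exact hVU h
    have hWo : IsOpen (U \ α.car) := hU.sdiff hαc
    have hca1 : a1 ≠ c := by
      intro h
      exact hS2 (h ▸ hcI)
    have hsegB : segment ℝ a1 c ⊆ B := hBc.segment_subset hS1 hcB
    have hW2 : IsPreconnected ((U \ α.car) \ segment ℝ a1 c) := by
      refine slit_preconnected (rank_CN hN) hWo hW1 (fun h => h.2 ha1α) hca1 fun x hx hne => ?_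
      exact ⟨hBU (hsegB hx), fun hxα => hne (hαB x hxα (hsegB hx))⟩
    have hW3 : IsPreconnected ((U \ α.car) \ B) := by
      refine body_removal hWo ⟨a, fun h => ha h.1⟩ hBc hBk hcI (right_mem_segment ℝ a1 c) hsegB
        hW2 ?_
      rintro x ⟨hxB, hxS⟩
      have hxc : x ≠ c := fun h => hxS (h ▸ right_mem_segment ℝ a1 c)
      obtain ⟨r, hr0, hr1, hr, hm⟩ := proj_mem hBc hBk hcI hxB hxc
      rw [hr]
      refine ⟨hBU hm, fun hmα => hxS ?_⟩
      have e := hαB _ hmα hm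
      rw [segment_symm, segment_eq_image']
      refine ⟨r, ⟨hr0.le, hr1⟩, ?_⟩
      change c + r • (a1 - c) = x
      rw [← e, add_sub_cancel_left, smul_smul, mul_inv_cancel₀ hr0.ne', one_smul]
      abel
    have hU'o : IsOpen ((U \ α.car) \ B) := hWo.sdiff hBk.isClosed
    have hb1b : b1 ≠ b := by rintro h; exact hb (h ▸ hb1U)
    have haccb1 : Acc' Z ((U \ α.car) \ B) b1 :=
      ray_acc hWo hBk.isClosed hw hwZ hT0 hT4 ⟨hb1U, hb1α⟩
    have haccb : Acc' Z ((U \ α.car) \ B) b :=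
      (hba.shorten hαc hbα).shorten hBk.isClosed fun h => hb (hBU h)
    obtain ⟨T', k1, k2, k3, k4, k5⟩ := chain hN hZ hKZ hF L ((U \ α.car) \ B) b1 b
      (fun x hx => hLF x (by simp [hx])) hnd.2 hU'o hW3
      (fun x hx z hz => by
        have hzR : z ∈ R := mem_biUnion (show x ∈ {x | x ∈ L} from hx) hz
        exact ⟨⟨hRU hzR, fun h => hαR z h hzR⟩, fun h => disjoint_left.1 hBR h hzR⟩)
      hb1b (fun h => h.2 hT1) (fun h => hb h.1.1) haccb1 haccb
    refine ⟨.cat (.cat α (.box B Q a1 b1 y y')) T', ⟨⟨hα.mono (empty_subset _), hbox, hα2, ?_⟩,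
      k1, k2.symm, ?_⟩, hα1, k3, ?_, ?_⟩
    · intro x hx hxB
      rw [hα2]; exact hαB x hx hxB
    · intro x hx hx'
      change x = b1
      rcases k4 hx' with h | h | h
      · exact h
      · exfalso
        rcases hx with hx | hx
        · exact hbα (h ▸ hx)
        · exact hb (hBU (h ▸ hx))
      · exfalso
        rcases hx with hx | hx
        · exact h.1.2 hx
        · exact h.2 hx
    · rintro x ((hx | hx) | hx)
      · rcases hα3 hx with h | h | h
        · exact Or.inl h
        · exact Or.inr (Or.inr (h ▸ ha1U))
        · exact Or.inr (Or.inr (hVU h))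
      · exact Or.inr (Or.inr (hBU hx))
      · rcases k4 hx with h | h | h
        · exact Or.inr (Or.inr (h ▸ hb1U))
        · exact Or.inr (Or.inl h)
        · exact Or.inr (Or.inr h.1.1)
    · intro x hx
      rcases List.mem_cons.1 hx with rfl | hx
      · exact fun z hz => Or.inl (Or.inr hz)
      · exact (k5 x hx).trans subset_union_right


end partn

section parto
variable {N : ℕ}

theorem PolyEqContinuous.mono' {X Y : Set (CN N)} (h : PolyEqContinuous X) (hYX : Y ⊆ X)
    (hY : IsCompact Y) : PolyEqContinuous Y :=
  CP.polyEq hY (h.cp.mono hYX)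

theorem polyEq_singleton (x : CN N) : PolyEqContinuous ({x} : Set (CN N)) := by
  intro f _ δ hδ
  refine ⟨MvPolynomial.C (f x), ?_⟩
  rintro z rfl
  simpa using hδ

theorem polyEq_add_point {X : Set (CN N)} (hX : IsCompact X) (hP : PolyEqContinuous X) (x : CN N) :
    PolyEqContinuous (X ∪ {x}) := by
  rcases X.eq_empty_or_nonempty with h | ⟨w, hw⟩
  · rw [h, empty_union]; exact polyEq_singleton x
  by_cases hx : x ∈ X
  · rw [union_eq_self_of_subset_right (by simpa using hx)]; exact hP
  obtain ⟨p, -, hpX, -, hu⟩ := first_hit (p := x) (q := w) hX.isClosed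
    ⟨w, right_mem_segment ℝ x w, hw⟩
  have hpx : p ≠ x := fun h => hx (h ▸ hpX)
  have := seg_one_ended hX hP hpx hpX (fun z hz hzX => hu z (segment_symm ℝ p x ▸ hz) hzX)
  refine this.mono' ?_ (hX.union isCompact_singleton)
  refine union_subset_union_right _ ?_
  simpa using right_mem_segment ℝ p x

namespace Tr
variable {Z K : Set (CN N)} {η : ℝ} {F : Set (Set (CN N) × Set (CN N))}

theorem seg_sub_box {B Q : Set (CN N)} {a b y y' : CN N} (h : Valid Z F (box B Q a b y y')) :
    segment ℝ a y ⊆ B ∧ segment ℝ b y' ⊆ B := by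
  obtain ⟨h1, h2, h3, h4, h5, h6, h7, h8, h9, h10, h11, h12, h13, h14, h15⟩ := h
  constructor
  · intro z hz
    by_cases e : z = a
    · rw [e]; exact h3
    · exact interior_subset (h12 z hz e)
  · intro z hz
    by_cases e : z = b
    · rw [e]; exact h4
    · exact interior_subset (h13 z hz e)

theorem QQ_sub (hF : Level K η F) : ∀ {T : Tr N}, Valid Z F T → QQ T ⊆ car T
  | seg _ _, _ => empty_subset _
  | box _ _ _ _ _ _, h => (hF.qint _ h.1).trans interior_subset
  | cat _ _, h => union_subset_union (QQ_sub hF h.1) (QQ_sub hF h.2.1)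

theorem QQ_compact (hF : Level K η F) : ∀ {T : Tr N}, Valid Z F T → IsCompact (QQ T)
  | seg _ _, _ => isCompact_empty
  | box _ _ _ _ _ _, h => hF.qcomp _ h.1
  | cat _ _, h => (QQ_compact hF h.1).union (QQ_compact hF h.2.1)

theorem QQ_sub_union : ∀ {T : Tr N}, Valid Z F T → QQ T ⊆ ⋃ b ∈ F, b.2
  | seg _ _, _ => empty_subset _
  | box B Q _ _ _ _, h => fun x hx => mem_iUnion₂.2 ⟨(B, Q), h.1, hx⟩
  | cat _ _, h => union_subset (QQ_sub_union h.1) (QQ_sub_union h.2.1)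

theorem D_compact (hF : Level K η F) : ∀ {T : Tr N}, Valid Z F T → IsCompact (D T)
  | seg p q, _ => isCompact_seg p q
  | box _ _ _ _ _ _, h => ((hF.qcomp _ h.1).union (isCompact_seg _ _)).union (isCompact_seg _ _)
  | cat _ _, h => (D_compact hF h.1).union (D_compact hF h.2.1)

theorem D_sub (hF : Level K η F) : ∀ {T : Tr N}, Valid Z F T → D T ⊆ car T
  | seg _ _, _ => Subset.rfl
  | box _ _ _ _ _ _, h => union_subset (union_subset ((hF.qint _ h.1).trans interior_subset)
      (seg_sub_box h).1) (seg_sub_box h).2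
  | cat _ _, h => union_subset_union (D_sub hF h.1) (D_sub hF h.2.1)

theorem st_mem_D : ∀ (T : Tr N), st T ∈ D T
  | seg p q => left_mem_segment ℝ p q
  | box _ _ a _ y _ => Or.inl (Or.inr (left_mem_segment ℝ a y))
  | cat s _ => Or.inl (st_mem_D s)

theorem en_mem_D : ∀ (T : Tr N), en T ∈ D T
  | seg p q => right_mem_segment ℝ p q
  | box _ _ _ b _ y' => Or.inr (left_mem_segment ℝ b y')
  | cat _ t => Or.inr (en_mem_D t)

theorem st_notMem_QQ (hF : Level K η F) : ∀ {T : Tr N}, Valid Z F T → st T ∉ QQ T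
  | seg _ _, _ => notMem_empty _
  | box _ _ _ _ _ _, h => fun h' => h.2.2.2.2.1 (hF.qint _ h.1 h')
  | cat _ _, h => fun h' => h'.elim (st_notMem_QQ hF h.1)
      fun h2 => st_notMem_right h (QQ_sub hF h.2.1 h2)

theorem polyEq_step (hF : Level K η F) : ∀ {T : Tr N}, Valid Z F T → ∀ X1 X2 : Set (CN N),
    IsCompact X1 → IsCompact X2 → st T ∈ X1 → (∀ x ∈ X1, x ∈ car T → x = st T) →
    Disjoint X2 (X1 ∪ car T) → PolyEqContinuous (X1 ∪ QQ T ∪ X2) →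
    PolyEqContinuous (X1 ∪ D T ∪ X2)
  | seg p q, h, X1, X2, h1, h2, hst, hX1, hX2, hP => by
    have hP' : PolyEqContinuous (X1 ∪ X2) := by
      have e : X1 ∪ QQ (seg p q) ∪ X2 = X1 ∪ X2 := by
        change X1 ∪ ∅ ∪ X2 = _; rw [union_empty]
      rwa [e] at hP
    have := seg_one_ended (h1.union h2) hP' h.1 (Or.inl hst) (by
      rintro z hz (hz1 | hz2)
      · exact hX1 z hz1 hz
      · exact absurd (Or.inr hz) (disjoint_left.1 hX2 hz2))
    rw [union_right_comm] at this
    exact this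
  | box B Q a b y y', h, X1, X2, h1, h2, hst, hX1, hX2, hP => by
    have hs := seg_sub_box h
    obtain ⟨g1, g2, g3, g4, g5, g6, g7, g8, g9, g10, g11, g12, g13, g14, g15⟩ := h
    have hQB : Q ⊆ interior B := hF.qint _ g1
    have hQc : IsCompact Q := hF.qcomp _ g1
    change PolyEqContinuous (X1 ∪ Q ∪ X2) at hP
    change ∀ x ∈ X1, x ∈ B → x = a at hX1
    change a ∈ X1 at hst
    change Disjoint X2 (X1 ∪ B) at hX2
    have haQ : a ∉ Q := fun h' => g5 (hQB h')
    have hX2' : ∀ z ∈ X2, z ∉ B := fun z hz hB => disjoint_left.1 hX2 hz (Or.inr hB)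
    have hd : Disjoint X1 (Q ∪ X2) := by
      rw [disjoint_left]
      rintro z hz (hQ | h')
      · exact haQ (hX1 z hz (interior_subset (hQB hQ)) ▸ hQ)
      · exact disjoint_left.1 hX2 h' (Or.inl hz)
    rw [union_assoc] at hP
    have hP1 := seg_join h1 (hQc.union h2) hd hP hst (Or.inl g7) (by
      rintro z hz (h' | h' | h')
      · exact Or.inl (hX1 z h' (hs.1 hz))
      · exact Or.inr (g9 z hz h')
      · exact absurd (hs.1 hz) (hX2' z h'))
    have hyb : y' ≠ b := fun e => g6 (e ▸ hQB g8)
    have hP2 := seg_one_ended ((h1.union (hQc.union h2)).union (isCompact_seg a y)) hP1 hyb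
      (Or.inl (Or.inr (Or.inl g8))) (by
      intro z hz
      rw [segment_symm] at hz
      rintro ((h' | h' | h') | h')
      · have e := hX1 z h' (hs.2 hz)
        rw [e] at hz
        exact absurd (g11 a (left_mem_segment ℝ a y) hz) haQ
      · exact g10 z hz h'
      · exact absurd (hs.2 hz) (hX2' z h')
      · exact g10 z hz (g11 z h' hz))
    have e : X1 ∪ (Q ∪ segment ℝ a y ∪ segment ℝ b y') ∪ X2 =
        X1 ∪ (Q ∪ X2) ∪ segment ℝ a y ∪ segment ℝ y' b := by
      rw [segment_symm ℝ y' b]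
      ext z; simp only [mem_union]; tauto
    change PolyEqContinuous (X1 ∪ (Q ∪ segment ℝ a y ∪ segment ℝ b y') ∪ X2)
    rw [e]; exact hP2
  | cat s t, h, X1, X2, h1, h2, hst, hX1, hX2, hP => by
    have hX2' : ∀ z ∈ X2, z ∉ X1 ∧ z ∉ car s ∧ z ∉ car t := fun z hz =>
      ⟨fun h' => disjoint_left.1 hX2 hz (Or.inl h'),
       fun h' => disjoint_left.1 hX2 hz (Or.inr (Or.inl h')),
       fun h' => disjoint_left.1 hX2 hz (Or.inr (Or.inr h'))⟩
    have hX1t : ∀ z ∈ X1, z ∉ car t := fun z hz hzt =>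
      st_notMem_right h (hX1 z hz (Or.inr hzt) ▸ hzt)
    have e1 : X1 ∪ QQ (cat s t) ∪ X2 = X1 ∪ QQ s ∪ (QQ t ∪ X2) := by
      change X1 ∪ (QQ s ∪ QQ t) ∪ X2 = _
      ext z; simp only [mem_union]; tauto
    rw [e1] at hP
    have hs := polyEq_step hF h.1 X1 (QQ t ∪ X2) h1 ((QQ_compact hF h.2.1).union h2) hst
      (fun x hx hx' => hX1 x hx (Or.inl hx')) (by
      rw [disjoint_left]
      rintro z (hz | hz) (h' | h')
      · exact hX1t z h' (QQ_sub hF h.2.1 hz)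
      · have e := h.2.2.2 z h' (QQ_sub hF h.2.1 hz)
        rw [e, h.2.2.1] at hz
        exact st_notMem_QQ hF h.2.1 hz
      · exact (hX2' z hz).1 h'
      · exact (hX2' z hz).2.1 h') hP
    have e2 : X1 ∪ D s ∪ (QQ t ∪ X2) = (X1 ∪ D s) ∪ QQ t ∪ X2 := by
      rw [union_assoc (X1 ∪ D s)]
    rw [e2] at hs
    have ht := polyEq_step hF h.2.1 (X1 ∪ D s) X2 (h1.union (D_compact hF h.1)) h2
      (Or.inr (h.2.2.1 ▸ en_mem_D s)) (by
      rintro x (hx | hx) hxt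
      · exact absurd hxt (hX1t x hx)
      · rw [h.2.2.2 x (D_sub hF h.1 hx) hxt, h.2.2.1]) (by
      rw [disjoint_left]
      rintro z hz ((h' | h') | h')
      · exact (hX2' z hz).1 h'
      · exact (hX2' z hz).2.1 (D_sub hF h.1 h')
      · exact (hX2' z hz).2.2 h') hs
    have e3 : X1 ∪ D (cat s t) ∪ X2 = X1 ∪ D s ∪ D t ∪ X2 := by
      change X1 ∪ (D s ∪ D t) ∪ X2 = _
      rw [← union_assoc X1 (D s) (D t)]
    rw [e3]; exact ht

theorem polyEq_D (hF : Level K η F) {T : Tr N} (h : Valid Z F T) : PolyEqContinuous (D T) := by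
  have hQ : PolyEqContinuous (QQ T) :=
    CP.polyEq (QQ_compact hF h) (hF.cp.mono (QQ_sub_union h))
  have h0 := polyEq_add_point (QQ_compact hF h) hQ (st T)
  have := polyEq_step hF h {st T} ∅ isCompact_singleton isCompact_empty rfl
    (fun x hx _ => hx) (empty_disjoint _) (by rwa [union_empty, union_comm])
  exact this.mono' (fun x hx => Or.inl (Or.inr hx)) (D_compact hF h)

end Tr


end parto

section partp
variable {N : ℕ}

theorem half_seg_comp {W : Set (CN N)} {a y : CN N} (h : ∀ z ∈ segment ℝ a y, z ≠ a → z ∈ W)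
    {x : CN N} (hx : x ∈ segment ℝ a y) (hxa : x ≠ a) : x ∈ connectedComponentIn W y := by
  have hsub : segment ℝ x y ⊆ segment ℝ a y :=
    (convex_segment a y).segment_subset hx (right_mem_segment ℝ a y)
  have : segment ℝ x y ⊆ connectedComponentIn W y := by
    refine (convex_segment x y).isPreconnected.subset_connectedComponentIn
      (right_mem_segment ℝ x y) fun z hz => h z (hsub hz) ?_
    rintro rfl
    have h1 := Tr.dist_seg_le hx
    have h2 := Tr.dist_seg_le hz
    have h3 : dist x z = 0 := by
      rw [dist_comm z x] at h1
      linarith [dist_nonneg (x := x) (y := z)]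
    exact hxa (dist_eq_zero.1 h3)
  exact this (left_mem_segment ℝ x y)

theorem refine_tree (hN : 1 ≤ N) {Z K : Set (CN N)} (hZ : GZ Z) (hK : IsCompact K)
    (hKZ : ∀ z ∈ K, z ∉ Z) {η : ℝ} {F : Set (Set (CN N) × Set (CN N))} (hF : Level K η F)
    {O : Set (CN N)} (hO : IsOpen O) : ∀ {T : Tr N}, T.Valid Z F → T.D ⊆ O →
    ∃ η0 : ℝ, 0 < η0 ∧ ∀ η' ≤ η0, ∀ F', Level K η' F' → ∃ T' : Tr N, T'.Valid Z F' ∧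
      Tr.Refines T T' ∧ T'.car ⊆ O ∧ K ∩ T.car ⊆ T'.car
  | .seg p q, h, hD => ⟨1, one_pos, fun η' _ F' _ => ⟨.seg p q, h, .seg p q, hD,
      inter_subset_right⟩⟩
  | .cat s t, h, hD => by
    obtain ⟨e1, he1, H1⟩ := refine_tree hN hZ hK hKZ hF hO h.1 (subset_union_left.trans hD)
    obtain ⟨e2, he2, H2⟩ := refine_tree hN hZ hK hKZ hF hO h.2.1 (subset_union_right.trans hD)
    refine ⟨min e1 e2, lt_min he1 he2, fun η' hη F' hF' => ?_⟩
    obtain ⟨s', hs1, hs2, hs3, hs4⟩ := H1 η' (hη.trans (min_le_left _ _)) F' hF'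
    obtain ⟨t', ht1, ht2, ht3, ht4⟩ := H2 η' (hη.trans (min_le_right _ _)) F' hF'
    refine ⟨.cat s' t', ⟨hs1, ht1, ?_, ?_⟩, .cat _ _ _ _ hs2 ht2, union_subset hs3 ht3, ?_⟩
    · rw [hs2.en_eq, ht2.st_eq]; exact h.2.2.1
    · intro x hx hx'
      rw [hs2.en_eq]
      exact h.2.2.2 x (hs2.car_subset hx) (ht2.car_subset hx')
    · rintro x ⟨hxK, hx | hx⟩
      · exact Or.inl (hs4 ⟨hxK, hx⟩)
      · exact Or.inr (ht4 ⟨hxK, hx⟩)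
  | .box B Q a b y y', h, hD => by
    have hs := Tr.seg_sub_box h
    obtain ⟨g1, g2, g3, g4, g5, g6, g7, g8, g9, g10, g11, g12, g13, g14, g15⟩ := h
    have hQB : Q ⊆ interior B := hF.qint _ g1
    have hQO : Q ⊆ O := fun x hx => hD (Or.inl (Or.inl hx))
    have haO : segment ℝ a y ⊆ O := fun x hx => hD (Or.inl (Or.inr hx))
    have hbO : segment ℝ b y' ⊆ O := fun x hx => hD (Or.inr hx)
    set W := O ∩ interior B with hW
    have hWo : IsOpen W := hO.inter isOpen_interior
    set U := connectedComponentIn W y with hU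
    have hUo : IsOpen U := hWo.connectedComponentIn
    have hUc : IsPreconnected U := isPreconnected_connectedComponentIn
    have hUW : U ⊆ W := connectedComponentIn_subset W y
    have hQU : Q ⊆ U := (hF.qconn _ g1).subset_connectedComponentIn g7 (subset_inter hQO hQB)
    have hUeq : U = connectedComponentIn W y' := connectedComponentIn_eq (hQU g8)
    have haU : a ∉ U := fun h' => g5 (hUW h').2
    have hbU : b ∉ U := fun h' => g6 (hUW h').2
    have hya : y ≠ a := fun e => g5 (e ▸ hQB g7)
    have hyb : y' ≠ b := fun e => g6 (e ▸ hQB g8)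
    have hA : Acc' Z U a := ⟨y, hya, fun x hx hxa =>
      half_seg_comp (W := W) (fun z hz hza => ⟨haO hz, g12 z hz hza⟩) hx hxa, g14⟩
    have hB' : Acc' Z U b := ⟨y', hyb, fun x hx hxb => by
      rw [hUeq]
      exact half_seg_comp (W := W) (fun z hz hza => ⟨hbO hz, g13 z hz hza⟩) hx hxb, g15⟩
    have hBk : IsCompact B := hF.comp _ g1
    obtain ⟨d, hd, hdU⟩ := (hK.inter_right hBk.isClosed).exists_thickening_subset_open hUo
      ((hF.Kq _ g1).trans hQU)
    refine ⟨d / 2, by positivity, fun η' hη F' hF' => ?_⟩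
    classical
    set L := (hF'.fin.toFinset.filter (fun x => (x.1 ∩ (K ∩ B)).Nonempty)).toList with hL
    have hmem : ∀ x, x ∈ L ↔ x ∈ F' ∧ (x.1 ∩ (K ∩ B)).Nonempty := by
      intro x; rw [hL]; simp
    have hLU : ∀ x ∈ L, x.1 ⊆ U := by
      intro x hx
      obtain ⟨hxF, w, hw1, hw2⟩ := (hmem x).1 hx
      intro z hz
      apply hdU
      rw [Metric.mem_thickening_iff]
      refine ⟨w, hw2, ?_⟩
      have := hF'.diam x hxF z hz w hw1
      linarith
    obtain ⟨T', hT1, hT2, hT3, hT4, hT5⟩ := chain hN hZ hKZ hF' L U a b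
      (fun x hx => ((hmem x).1 hx).1) (Finset.nodup_toList _) hUo hUc hLU g2 haU hbU hA hB'
    refine ⟨T', hT1, .box _ _ _ _ _ _ _ hT2 hT3 ?_, ?_, ?_⟩
    · refine hT4.trans ?_
      rintro z (rfl | rfl | hz)
      · exact g3
      · exact g4
      · exact interior_subset (hUW hz).2
    · refine hT4.trans ?_
      rintro z (rfl | rfl | hz)
      · exact haO (left_mem_segment ℝ _ _)
      · exact hbO (left_mem_segment ℝ _ _)
      · exact (hUW hz).1
    · rintro z ⟨hzK, hzB⟩
      obtain ⟨x, hxF, hzx⟩ := mem_iUnion₂.1 (hF'.cov hzK)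
      exact hT5 x ((hmem x).2 ⟨hxF, z, hzx, hzK, hzB⟩) hzx


end partp

section partq
variable {N : ℕ}

theorem preconn_iInter {C : ℕ → Set (CN N)} (hc : ∀ n, IsCompact (C n))
    (hp : ∀ n, IsPreconnected (C n)) (ha : Antitone C) : IsPreconnected (⋂ n, C n) := by
  have hJ : IsCompact (⋂ n, C n) := (hc 0).of_isClosed_subset
    (isClosed_iInter fun n => (hc n).isClosed) (iInter_subset _ 0)
  intro u v hu hv hcov ⟨x, hxJ, hxu⟩ ⟨y, hyJ, hyv⟩
  by_contra hne
  have hdis : ∀ z ∈ ⋂ n, C n, z ∈ u → z ∉ v := fun z hz h1 h2 => hne ⟨z, hz, h1, h2⟩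
  have hA : IsCompact ((⋂ n, C n) \ v) := hJ.diff hv
  have hB : IsCompact ((⋂ n, C n) \ u) := hJ.diff hu
  have hAB : Disjoint ((⋂ n, C n) \ v) ((⋂ n, C n) \ u) := by
    rw [disjoint_left]
    rintro z ⟨hz, hzv⟩ ⟨_, hzu⟩
    exact (hcov hz).elim hzu hzv
  obtain ⟨u', v', hu', hv', hAu, hBv, hd⟩ := SeparatedNhds.of_isCompact_isCompact hA hB hAB
  have hsub : (⋂ n, C n) ⊆ u' ∪ v' := by
    intro z hz
    by_cases hzv : z ∈ v
    · exact Or.inr (hBv ⟨hz, fun h => hdis z hz h hzv⟩)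
    · exact Or.inl (hAu ⟨hz, hzv⟩)
  obtain ⟨n, hn⟩ := exists_subset_nhds_of_isCompact (V := C)
    (directed_of_isDirected_le fun i j h => ha h) hc
    (U := u' ∪ v') (fun z hz => (hu'.union hv').mem_nhds (hsub hz))
  have hx : x ∈ u' := hAu ⟨hxJ, hdis x hxJ hxu⟩
  have hy : y ∈ v' := hBv ⟨hyJ, fun h => hdis y hyJ h hyv⟩
  obtain ⟨z, _, hz1, hz2⟩ := hp n u' v' hu' hv' hn ⟨x, mem_iInter.1 hxJ n, hx⟩
    ⟨y, mem_iInter.1 hyJ n, hy⟩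
  exact disjoint_left.1 hd hz1 hz2

theorem isArc_of_fun {J : Set (CN N)} (hJ : IsCompact J) (hc : IsPreconnected J) {h : CN N → ℝ}
    (hh : ContinuousOn h J) (hi : InjOn h J) {x y : CN N} (hx : x ∈ J) (hy : y ∈ J)
    (hxy : x ≠ y) : IsArc J := by
  have hK : IsCompact (h '' J) := hJ.image_of_continuousOn hh
  have hCo : IsConnected (h '' J) := ⟨⟨h x, x, hx, rfl⟩, hc.image h hh⟩
  have hI := eq_Icc_of_connected_compact hCo hK
  set α := sInf (h '' J)
  set β := sSup (h '' J)
  have h1 : h x ∈ Icc α β := hI ▸ mem_image_of_mem h hx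
  have h2 : h y ∈ Icc α β := hI ▸ mem_image_of_mem h hy
  have hαβ : α < β := by
    rcases lt_or_ge α β with h' | h'
    · exact h'
    · exact absurd (hi hx hy (by linarith [h1.1, h1.2, h2.1, h2.2])) hxy
  have : CompactSpace J := isCompact_iff_compactSpace.1 hJ
  have : Nonempty J := ⟨⟨x, hx⟩⟩
  set φ : J → ℝ := J.domRestrict h with hφ
  have hφc : Continuous φ := continuousOn_iff_continuous_domRestrict.1 hh
  have hφi : Function.Injective φ := injOn_iff_injective.1 hi
  have hφe := hφc.isClosedEmbedding hφi
  have hr : range φ = Icc α β := by rw [hφ, range_domRestrict, hI]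
  set aff : ℝ → ℝ := fun t => α + t * (β - α) with haff
  have haffI : ∀ t ∈ Icc (0:ℝ) 1, aff t ∈ range φ := by
    intro t ht
    rw [hr]
    constructor
    · have := mul_nonneg ht.1 (sub_pos.2 hαβ).le
      simp only [haff]; linarith
    · have := mul_le_mul_of_nonneg_right ht.2 (sub_pos.2 hαβ).le
      simp only [haff]; linarith
  set γ : ℝ → J := fun t => Function.invFun φ (aff t) with hγ
  have hφγ : ∀ t ∈ Icc (0:ℝ) 1, φ (γ t) = aff t := fun t ht =>
    Function.invFun_eq (haffI t ht)
  have hγc : ContinuousOn γ (Icc 0 1) := by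
    rw [hφe.isInducing.continuousOn_iff]
    have : ContinuousOn aff (Icc 0 1) := by fun_prop
    exact this.congr hφγ
  refine ⟨_, _, fun t => (γ t : CN N), continuous_subtype_val.comp_continuousOn hγc, ?_, ?_,
    rfl, rfl⟩
  · intro s hs t ht e
    have e' : γ s = γ t := Subtype.ext e
    have : aff s = aff t := by rw [← hφγ s hs, ← hφγ t ht, e']
    simp only [haff] at this
    have h3 : s * (β - α) = t * (β - α) := by linarith
    exact mul_right_cancel₀ (sub_pos.2 hαβ).ne' h3
  · ext z
    constructor
    · rintro ⟨t, _, rfl⟩; exact (γ t).2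
    · intro hz
      have hzI : h z ∈ Icc α β := hI ▸ mem_image_of_mem h hz
      have hpos := sub_pos.2 hαβ
      have htI : (h z - α) / (β - α) ∈ Icc (0:ℝ) 1 := by
        constructor
        · exact div_nonneg (by linarith [hzI.1]) hpos.le
        · rw [div_le_one hpos]; linarith [hzI.2]
      refine ⟨(h z - α) / (β - α), htI, ?_⟩
      have : φ (γ ((h z - α) / (β - α))) = φ ⟨z, hz⟩ := by
        rw [hφγ _ htI]
        change α + (h z - α) / (β - α) * (β - α) = h z
        rw [div_mul_cancel₀ _ hpos.ne']
        ring
      exact congrArg Subtype.val (hφi this)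

theorem arc_of_seq {Z K : Set (CN N)} {T : ℕ → Tr N} {F : ℕ → Set (Set (CN N) × Set (CN N))}
    {η : ℕ → ℝ} (hF : ∀ n, Level K (η n) (F n)) (hT : ∀ n, (T n).Valid Z (F n))
    (hR : ∀ n, Tr.Refines (T n) (T (n+1))) (hη : ∀ d : ℝ, 0 < d → ∃ n, η n < d) :
    IsCompact (⋂ n, (T n).car) ∧ (T 0).st ∈ (⋂ n, (T n).car) ∧ IsArc (⋂ n, (T n).car) := by
  set J := ⋂ n, (T n).car with hJd
  have hcomp : ∀ n, IsCompact (T n).car := fun n => Tr.car_compact (hF n).comp (hT n)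
  have hanti : Antitone fun n => (T n).car := antitone_nat_of_succ_le fun n => (hR n).car_subset
  have hJ : IsCompact J := (hcomp 0).of_isClosed_subset
    (isClosed_iInter fun n => (hcomp n).isClosed) (iInter_subset _ 0)
  have hJc : IsPreconnected J :=
    preconn_iInter hcomp (fun n => Tr.car_preconn (hF n).conv (hT n)) hanti
  have hst : ∀ n, (T n).st = (T 0).st := by
    intro n; induction n with
    | zero => rfl
    | succ n ih => rw [(hR n).st_eq, ih]
  have hen : ∀ n, (T n).en = (T 0).en := by
    intro n; induction n with
    | zero => rfl
    | succ n ih => rw [(hR n).en_eq, ih]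
  have hstJ : (T 0).st ∈ J := mem_iInter.2 fun n => hst n ▸ Tr.st_mem (hT n)
  have henJ : (T 0).en ∈ J := mem_iInter.2 fun n => hen n ▸ Tr.en_mem (hT n)
  have hmono : ∀ m n, m ≤ n → ∀ x ∈ J, ∀ y ∈ J, (T m).g x < (T m).g y →
      (T n).g x < (T n).g y := by
    intro m n hmn x hx y hy hxy
    induction n, hmn using Nat.le_induction with
    | base => exact hxy
    | succ n _ ih =>
      exact (hR n).mono (hT n) (hT (n+1)) x (mem_iInter.1 hx (n+1)) y
        (mem_iInter.1 hy (n+1)) ih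
  set f : ℕ → CN N → ℝ := fun n x => (1/2:ℝ)^n * ((T n).g x / (1 + (T n).len)) with hf
  have hpos : ∀ n, 0 < 1 + (T n).len := fun n => by linarith [Tr.len_nonneg (T n)]
  have hfb : ∀ n, ∀ x ∈ J, ‖f n x‖ ≤ (1/2:ℝ)^n := by
    intro n x hx
    have h0 := Tr.g_nonneg (T n) x
    have h1 := Tr.g_le (hT n) x (mem_iInter.1 hx n)
    have h2 : (T n).g x / (1 + (T n).len) ≤ 1 := by
      rw [div_le_one (hpos n)]; linarith
    have h3 : 0 ≤ (T n).g x / (1 + (T n).len) := div_nonneg h0 (hpos n).le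
    rw [hf, Real.norm_of_nonneg (mul_nonneg (by positivity) h3)]
    exact mul_le_of_le_one_right (by positivity) h2
  have hgeo : Summable fun n : ℕ => (1/2:ℝ)^n := summable_geometric_two
  have hfs : ∀ x ∈ J, Summable fun n => f n x := fun x hx =>
    Summable.of_norm_bounded hgeo fun n => hfb n x hx
  have hcont : ContinuousOn (fun x => ∑' n, f n x) J := by
    refine continuousOn_tsum (fun n => ?_) hgeo hfb
    have := (Tr.g_cont (hF n).comp (hT n)).mono (iInter_subset (fun n => (T n).car) n)
    exact continuousOn_const.mul (this.div_const _)
  have hlt : ∀ x ∈ J, ∀ y ∈ J, ∀ n, (T n).g x < (T n).g y → ∑' n, f n x < ∑' n, f n y := by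
    intro x hx y hy n hn
    refine Summable.tsum_lt_tsum (i := n) (fun m => ?_) ?_ (hfs x hx) (hfs y hy)
    · have : (T m).g x ≤ (T m).g y := by
        by_contra hc
        push Not at hc
        rcases le_total m n with hmn | hmn
        · exact absurd (hmono m n hmn y hy x hx hc) (not_lt.2 hn.le)
        · exact absurd (hmono n m hmn x hx y hy hn) (not_lt.2 hc.le)
      have h0 := hpos m
      simp only [hf]; gcongr
    · have h0 := hpos n
      simp only [hf]; gcongr
  have hinj : InjOn (fun x => ∑' n, f n x) J := by
    intro x hx y hy e
    by_contra hxy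
    obtain ⟨n, hn⟩ := hη _ (dist_pos.2 hxy)
    have hne : (T n).g x ≠ (T n).g y := by
      intro he
      rcases Tr.g_inj (hF n).dis (hT n) x (mem_iInter.1 hx n) y (mem_iInter.1 hy n) he with
        h | ⟨b, hb, hxb, hyb⟩
      · exact hxy h
      · exact absurd ((hF n).diam b hb x hxb y hyb) (not_le.2 hn)
    rcases lt_or_gt_of_ne hne with h | h
    · exact absurd e (hlt x hx y hy n h).ne
    · exact absurd e (hlt y hy x hx n h).ne'
  exact ⟨hJ, hstJ, isArc_of_fun hJ hJc hcont hinj hstJ henJ (Tr.st_ne_en (hT 0))⟩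


end partq

section partr
variable {N : ℕ}

theorem seg_ray_avoid {Z : Set (CN N)} {p v : CN N} (hv : ∀ t : ℝ, 0 ≤ t → p + t • v ∉ Z)
    {t : ℝ} (ht : 0 ≤ t) : ∀ x ∈ segment ℝ p (p + t • v), x ∉ Z := by
  intro x hx
  rw [segment_eq_image'] at hx
  obtain ⟨θ, hθ, rfl⟩ := hx
  have e : p + θ • (p + t • v - p) = p + (θ * t) • v := by
    rw [add_sub_cancel_left, smul_smul]
  change p + θ • (p + t • v - p) ∉ Z
  rw [e]
  exact hv _ (mul_nonneg hθ.1 ht)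

theorem exists_ray (hN : 1 ≤ N) {Z W : Set (CN N)} (hZ : GZ Z) (hW : IsOpen W) {p : CN N}
    (hp : p ∈ W) (hpZ : p ∉ Z) :
    ∃ c, c ≠ p ∧ segment ℝ p c ⊆ W ∧ ∀ x ∈ segment ℝ p c, x ∉ Z := by
  obtain ⟨v, -, hv, -, -, hvZ, -⟩ := two_rays hN hZ hpZ
  obtain ⟨r, hr, hb⟩ := Metric.isOpen_iff.1 hW p hp
  have hv' : 0 < ‖v‖ := norm_pos_iff.2 hv
  have ht : 0 < r / (2 * ‖v‖) := by positivity
  refine ⟨p + (r / (2 * ‖v‖)) • v, ?_, ?_, seg_ray_avoid hvZ ht.le⟩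
  · intro e
    have : (r / (2 * ‖v‖)) • v = 0 := by simpa using e
    rcases smul_eq_zero.1 this with h | h
    · exact ht.ne' h
    · exact hv h
  · refine ((convex_ball p r).segment_subset (Metric.mem_ball_self hr) ?_).trans hb
    rw [Metric.mem_ball, dist_eq_norm, add_sub_cancel_left, norm_smul, Real.norm_of_nonneg ht.le]
    have : r / (2 * ‖v‖) * ‖v‖ = r / 2 := by field_simp
    rw [this]; linarith

theorem acc_point (hN : 1 ≤ N) {Z W : Set (CN N)} (hZ : GZ Z) (hW : IsOpen W) {p : CN N}
    (hp : p ∈ W) (hpZ : p ∉ Z) : Acc' Z (W \ {p}) p := by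
  obtain ⟨c, hc, hs, hz⟩ := exists_ray hN hZ hW hp hpZ
  exact ⟨c, hc, fun x hx hxp => ⟨hs hx, hxp⟩, hz⟩

abbrev Stg (N : ℕ) := Tr N × Set (Set (CN N) × Set (CN N)) × ℝ

def Good (Z K : Set (CN N)) (s : Stg N) : Prop :=
  Level K s.2.2 s.2.1 ∧ s.1.Valid Z s.2.1 ∧ K ⊆ s.1.car

def Nxt (n : ℕ) (s s' : Stg N) : Prop :=
  s'.2.2 ≤ 1 / ((n:ℝ) + 1) ∧ Tr.Refines s.1 s'.1 ∧
    ∀ i, ∃ p : MvPolynomial (Fin N) ℂ, ∀ z ∈ s'.1.car,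
      ‖eval z p - (starRingEnd ℂ) (z i)‖ < 1 / ((n:ℝ) + 1)

theorem step_exists (hN : 1 ≤ N) {Z K : Set (CN N)} (hZ : GZ Z) (hK : IsCompact K)
    (hKZ : ∀ z ∈ K, z ∉ Z) (hL : ∀ η : ℝ, 0 < η → ∃ F, Level K η F) (n : ℕ) (s : Stg N)
    (hs : Good Z K s) : ∃ s', Good Z K s' ∧ Nxt n s s' := by
  obtain ⟨hF, hV, hKs⟩ := hs
  have hpos : 0 < 1 / ((n:ℝ) + 1) := by positivity
  have hP := (Tr.polyEq_D hF hV).cp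
  choose p hp using fun i => hP i _ hpos
  set O : Set (CN N) := {z | ∀ i, ‖eval z (p i) - (starRingEnd ℂ) (z i)‖ < 1 / ((n:ℝ) + 1)}
    with hO
  have hOo : IsOpen O := by
    rw [hO, setOf_forall]
    refine isOpen_iInter_of_finite fun i => ?_
    have h1 : Continuous fun z : CN N => ‖eval z (p i) - (starRingEnd ℂ) (z i)‖ :=
      ((continuous_eval_mv (p i)).sub
        (Complex.continuous_conj.comp (continuous_apply i))).norm
    exact isOpen_lt h1 continuous_const
  obtain ⟨η0, hη0, H⟩ := refine_tree hN hZ hK hKZ hF hOo hV (fun z hz i => hp i z hz)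
  obtain ⟨F', hF'⟩ := hL (min η0 (1 / ((n:ℝ) + 1))) (lt_min hη0 hpos)
  obtain ⟨T', h1, h2, h3, h4⟩ := H _ (min_le_left _ _) F' hF'
  exact ⟨(T', F', min η0 (1 / ((n:ℝ) + 1))), ⟨hF', h1, fun z hz => h4 ⟨hz, hKs hz⟩⟩,
    min_le_right _ _, h2, fun i => ⟨p i, fun z hz => h3 hz i⟩⟩

theorem exists_stages (hN : 1 ≤ N) {Z K : Set (CN N)} (hZ : GZ Z) (hK : IsCompact K)
    (hKZ : ∀ z ∈ K, z ∉ Z) (hL : ∀ η : ℝ, 0 < η → ∃ F, Level K η F) (s : Stg N)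
    (hs : Good Z K s) : ∃ S : ℕ → Stg N, S 0 = s ∧ (∀ n, Good Z K (S n)) ∧
      ∀ n, Nxt n (S n) (S (n+1)) := by
  choose nx hnx using fun (n : ℕ) (s : {s : Stg N // Good Z K s}) =>
    step_exists hN hZ hK hKZ hL n s.1 s.2
  let S : ℕ → {s : Stg N // Good Z K s} := fun n =>
    Nat.rec ⟨s, hs⟩ (fun n t => ⟨nx n t, (hnx n t).1⟩) n
  exact ⟨fun n => (S n).1, rfl, fun n => (S n).2, fun n => (hnx n (S n)).2⟩

theorem exists_arc (hN : 1 ≤ N) {Z K : Set (CN N)} (hZ : GZ Z) (hK : IsCompact K)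
    (hKZ : ∀ z ∈ K, z ∉ Z) (hL : ∀ η : ℝ, 0 < η → ∃ F, Level K η F) (s : Stg N)
    (hs : Good Z K s) : ∃ J : Set (CN N), IsArc J ∧ IsCompact J ∧ s.1.st ∈ J ∧ J ⊆ s.1.car ∧
      K ⊆ J ∧ (∀ z ∈ J, z ∉ Z) ∧ CP J := by
  obtain ⟨S, h0, hG, hS⟩ := exists_stages hN hZ hK hKZ hL s hs
  have hη : ∀ d : ℝ, 0 < d → ∃ n, (S n).2.2 < d := by
    intro d hd
    obtain ⟨n, hn⟩ := exists_nat_one_div_lt hd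
    exact ⟨n + 1, (hS n).1.trans_lt hn⟩
  obtain ⟨h1, h2, h3⟩ := arc_of_seq (T := fun n => (S n).1) (F := fun n => (S n).2.1)
    (η := fun n => (S n).2.2) (fun n => (hG n).1) (fun n => (hG n).2.1)
    (fun n => (hS n).2.1) hη
  refine ⟨_, h3, h1, ?_, ?_, ?_, ?_, ?_⟩
  · rw [← h0]; exact h2
  · rw [← h0]; exact iInter_subset (fun n => (S n).1.car) 0
  · exact subset_iInter fun n => (hG n).2.2
  · intro z hz hzZ
    refine hKZ z ?_ hzZ
    rw [← hK.isClosed.closure_eq, Metric.mem_closure_iff]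
    intro d hd
    obtain ⟨n, hn⟩ := hη d hd
    rcases Tr.car_Z (hG n).2.1 z (mem_iInter.1 hz n) with h | ⟨b, hb, hzb⟩
    · exact absurd hzZ h
    · obtain ⟨w, hwK, hwb⟩ := (hG n).1.Kne b hb
      exact ⟨w, hwK, ((hG n).1.diam b hb z hzb w hwb).trans_lt hn⟩
  · intro i d hd
    obtain ⟨n, hn⟩ := exists_nat_one_div_lt hd
    obtain ⟨p, hp⟩ := (hS n).2.2 i
    exact ⟨p, fun z hz => (hp z (mem_iInter.1 hz (n+1))).trans hn⟩

theorem main_aux (hN : 1 ≤ N) (Ω : Set (CN N)) (hΩopen : IsOpen Ω)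
    (hΩconn : IsConnected Ω) (hΩbdd : Bornology.IsBounded Ω)
    (x₀ : CN N) (hx₀ : x₀ ∈ Ω) (ε : ℝ) (hε : 0 < ε) :
    ∃ J : Set (CN N), IsArc J ∧ IsPolynomiallyConvex J ∧ x₀ ∈ J ∧ J ⊆ Ω ∧
      volume (Ω \ J) < ENNReal.ofReal ε ∧ PolyEqContinuous J ∧
      ∀ (p : MvPolynomial (Fin N) ℂ) (δ : ℝ), 0 < δ →
        ∃ q : MvPolynomial (Fin N) ℂ, (∀ z ∈ J, eval z q ≠ 0) ∧
          ∀ z ∈ closure Ω, ‖eval z p - eval z q‖ < δ := by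
  obtain ⟨Z, hxZ, hZ, hZm, hZ0, hdense⟩ := exists_Z hΩbdd x₀
  obtain ⟨b, hbx, hbs, hbZ⟩ := exists_ray hN hZ hΩopen hx₀ hxZ
  have hbΩ : b ∈ Ω := hbs (right_mem_segment ℝ x₀ b)
  have hbZ' : b ∉ Z := hbZ b (right_mem_segment ℝ x₀ b)
  have : Nonempty (Fin N) := ⟨⟨0, hN⟩⟩
  have hfin : ({x₀, b} : Set (CN N)).Finite := by simp
  have hZ1 : MeasurableSet (Z ∪ {x₀, b}) := hZm.union hfin.measurableSet
  have hZ2 : volume (Z ∪ {x₀, b}) = 0 :=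
    measure_union_null hZ0 (hfin.measure_zero _)
  obtain ⟨δ, hδ, K, hK, hKΩ, hKC, hKv⟩ := exists_K hΩopen hΩbdd hZ1 hZ2 hε
  have hKZ : ∀ z ∈ K, z ∉ Z := fun z hz h => (hKΩ hz).2 (Or.inl h)
  have hL : ∀ η : ℝ, 0 < η → ∃ F, Level K η F := fun η hη => exists_level hδ hK hKC hη
  set U := (Ω \ {x₀}) \ {b} with hU
  have hUo : IsOpen U := (hΩopen.sdiff isClosed_singleton).sdiff isClosed_singleton
  have hUc : IsPreconnected U := point_removal (rank_CN hN)
    (hΩopen.sdiff isClosed_singleton)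
    (point_removal (rank_CN hN) hΩopen hΩconn.isPreconnected x₀) b
  have hKU : K ⊆ U := by
    intro z hz
    refine ⟨⟨(hKΩ hz).1, fun h => (hKΩ hz).2 (Or.inr (Or.inl h))⟩,
      fun h => (hKΩ hz).2 (Or.inr (Or.inr h))⟩
  have hA : Acc' Z U x₀ := (acc_point hN hZ hΩopen hx₀ hxZ).shorten isClosed_singleton
    (fun h => hbx h.symm)
  have hB : Acc' Z U b := by
    rw [hU, sdiff_right_comm]
    exact (acc_point hN hZ hΩopen hbΩ hbZ').shorten isClosed_singleton (fun h => hbx h)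
  obtain ⟨d, hd, hdU⟩ := hK.exists_thickening_subset_open hUo hKU
  obtain ⟨F, hF⟩ := hL (d / 2) (by positivity)
  have hLU : ∀ x ∈ F, x.1 ⊆ U := by
    intro x hx z hz
    apply hdU
    obtain ⟨w, hwK, hwx⟩ := hF.Kne x hx
    rw [Metric.mem_thickening_iff]
    refine ⟨w, hwK, ?_⟩
    have := hF.diam x hx z hz w hwx
    linarith
  obtain ⟨T, hT1, hT2, hT3, hT4, hT5⟩ := chain hN hZ hKZ hF hF.fin.toFinset.toList U x₀ b
    (fun x hx => by simpa using hx) (Finset.nodup_toList _) hUo hUc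
    (fun x hx => hLU x (by simpa using hx)) hbx.symm (fun h => h.1.2 rfl) (fun h => h.2 rfl) hA hB
  have hTΩ : T.car ⊆ Ω := by
    refine hT4.trans ?_
    rintro z (rfl | rfl | hz)
    · exact hx₀
    · exact hbΩ
    · exact hz.1.1
  have hgood : Good Z K (T, F, d / 2) := by
    refine ⟨hF, hT1, fun z hz => ?_⟩
    obtain ⟨x, hxF, hzx⟩ := mem_iUnion₂.1 (hF.cov hz)
    exact hT5 x (by simpa using hxF) hzx
  obtain ⟨J, hJ1, hJ2, hJ3, hJ4, hJ5, hJ6, hJ7⟩ := exists_arc hN hZ hK hKZ hL _ hgood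
  have hPE := CP.polyEq hJ2 hJ7
  refine ⟨J, hJ1, PolyEqContinuous.isPolynomiallyConvex hJ2 hPE, ?_, hJ4.trans hTΩ, ?_, hPE,
    hdense J hJ6⟩
  · rw [← hT2]; exact hJ3
  · exact (measure_mono (sdiff_subset_sdiff_right hJ5)).trans_lt hKv


end partr

/-- In any bounded connected open `Ω ⊆ ℂ^N` there is a polynomially convex arc through a
given point, of almost full measure, with `P(J) = C(J)` and zero-free polynomials dense. -/
theorem stmt_5 (N : ℕ) (hN : 1 ≤ N) (Ω : Set (Fin N → ℂ)) (hΩopen : IsOpen Ω)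
    (hΩconn : IsConnected Ω) (hΩbdd : Bornology.IsBounded Ω)
    (x₀ : Fin N → ℂ) (hx₀ : x₀ ∈ Ω) (ε : ℝ) (hε : 0 < ε) :
    ∃ J : Set (Fin N → ℂ), IsArc J ∧ IsPolynomiallyConvex J ∧ x₀ ∈ J ∧ J ⊆ Ω ∧
      volume (Ω \ J) < ENNReal.ofReal ε ∧ PolyEqContinuous J ∧
      ∀ (p : MvPolynomial (Fin N) ℂ) (δ : ℝ), 0 < δ →
        ∃ q : MvPolynomial (Fin N) ℂ, (∀ z ∈ J, eval z q ≠ 0) ∧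
          ∀ z ∈ closure Ω, ‖eval z p - eval z q‖ < δ := by
  exact main_aux hN Ω hΩopen hΩconn hΩbdd x₀ hx₀ ε hε

end
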